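/- arXiv:1609.04676 — 12 statements merged into one kernel-verified Lean document; each statement's English description precedes it below -/
import Mathlib

section
/- Let K be a field of characteristic zero, A = K[x₁,…,xₙ] the polynomial ring, f ∈ A a non-constant polynomial, R = A[t] and g = t·f − 1 ∈ R. Let B = R[g⁻¹]/R be the cokernel of the localization map R → Localization.Away g, regarded as an R-module. Then multiplication by f on B is bijective; equivalently, the canonical localization map B → (localization of B at the powers of f) is an isomorphism of R-modules. -/
open Polynomial

set_option synthInstance.maxHeartbeats 1000000
set_option maxHeartbeats 1000000

/-- If `c` is coprime to `g` and every element of `B` is killed by a power of `g`,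
then `c` acts bijectively on `B`. -/
theorem bijective_smul_of_torsion {R B : Type*} [CommRing R] [AddCommGroup B] [Module R B]
    (c g : R) (h : IsCoprime c g) (hB : ∀ b : B, ∃ k : ℕ, g ^ k • b = 0) :
    Function.Bijective (fun b : B => c • b) := by
  constructor
  · refine fun a b hab => sub_eq_zero.mp ?_
    obtain ⟨k, hk⟩ := hB (a - b)
    obtain ⟨p, q, hpq⟩ := h.pow_right (n := k)
    have hc : c • (a - b) = 0 := by
      rw [smul_sub]; exact sub_eq_zero.mpr hab
    rw [← one_smul R (a - b), ← hpq, add_smul, mul_smul, mul_smul, hk, hc]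
    simp
  · intro b
    obtain ⟨k, hk⟩ := hB b
    obtain ⟨p, q, hpq⟩ := h.pow_right (n := k)
    refine ⟨p • b, ?_⟩
    have h1 : (p * c + q * g ^ k) • b = b := by rw [hpq, one_smul]
    rw [add_smul, mul_smul q, hk, smul_zero, add_zero, mul_comm, mul_smul] at h1
    exact h1

theorem torsion_away_quotient {R : Type*} [CommRing R] (g : R)
    (b : Localization.Away g ⧸ LinearMap.range (Algebra.linearMap R (Localization.Away g))) :
    ∃ k : ℕ, g ^ k • b = 0 := by
  obtain ⟨x, rfl⟩ := Submodule.Quotient.mk_surjective _ b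
  obtain ⟨k, r, hr⟩ := IsLocalization.Away.surj g x
  refine ⟨k, ?_⟩
  rw [← Submodule.Quotient.mk_smul, Submodule.Quotient.mk_eq_zero]
  refine ⟨r, ?_⟩
  rw [Algebra.linearMap_apply, ← hr, Algebra.smul_def, map_pow, mul_comm]

theorem stmt0 {K : Type} [Field K] [CharZero K] {n : ℕ} (hn : 1 ≤ n)
    (f : MvPolynomial (Fin n) K) (hf : 1 ≤ f.totalDegree) :
    let A := MvPolynomial (Fin n) K
    let R := Polynomial A
    let g : R := X * C f - 1
    let L := Localization.Away g
    let B := L ⧸ LinearMap.range (Algebra.linearMap R L)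
    Function.Bijective (fun b : B => (C f : R) • b) := by
  intro A R g L B
  exact bijective_smul_of_torsion (C f : R) g ⟨X, -1, by simp only [g]; ring⟩
    (torsion_away_quotient g)
end

section
/- Let K be a field of characteristic zero, A = K[x₁,…,xₙ], f ∈ A non-constant, R = A[t], g = t·f − 1 ∈ R, and B = R[g⁻¹]/R the cokernel of R → Localization.Away g, viewed as an A-module. Then for every A-module M, the A-linear map id_B ⊗ ι : B ⊗_A M → B ⊗_A M_f induced by the canonical localization map ι : M → M_f := LocalizedModule f M is bijective. -/
open Polynomial

set_option synthInstance.maxHeartbeats 1000000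
set_option maxHeartbeats 1000000

theorem aux_tensor {A : Type} [CommRing A] (f : A) (B M : Type) [AddCommGroup B] [Module A B]
    [AddCommGroup M] [Module A M] (hinv : Function.Bijective (fun b : B => f • b)) :
    Function.Bijective (LinearMap.lTensor (R := A) B
        (LocalizedModule.mkLinearMap (Submonoid.powers f) M)) := by
  let e : B ≃ₗ[A] B := LinearEquiv.ofBijective (LinearMap.lsmul A B f) hinv
  have hT : IsUnit (algebraMap A (Module.End A (TensorProduct A B M)) f) := by
    rw [Module.End.isUnit_iff]
    have h := (LinearEquiv.rTensor M e).bijective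
    have h2 : (algebraMap A (Module.End A (TensorProduct A B M)) f)
        = (LinearEquiv.rTensor M e).toLinearMap := by
      ext b m
      simp [e, TensorProduct.smul_tmul']
      rfl
    rw [h2]
    exact h
  have hid : IsLocalizedModule (Submonoid.powers f) (LinearMap.id : B →ₗ[A] B) := by
    refine ⟨?_, fun y => ⟨(y, 1), by simp⟩, fun h => ⟨1, by simpa using h⟩⟩
    rintro ⟨_, k, rfl⟩
    have hB : IsUnit (algebraMap A (Module.End A B) f) := by
      rw [Module.End.isUnit_iff]
      exact hinv
    have := hB.pow k
    rwa [← map_pow] at this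
  have key : IsLocalizedModule (Submonoid.powers f) (LinearMap.lTensor (R := A) B
        (LocalizedModule.mkLinearMap (Submonoid.powers f) M)) :=
    inferInstanceAs (IsLocalizedModule (Submonoid.powers f) (TensorProduct.map LinearMap.id
      (LocalizedModule.mkLinearMap (Submonoid.powers f) M)))
  have hbij : ∀ s : Submonoid.powers f,
      Function.Bijective (fun z : TensorProduct A B M => (s : A) • z) := by
    rintro ⟨_, k, rfl⟩
    have := hT.pow k
    rw [← map_pow, Module.End.isUnit_iff] at this
    exact this
  constructor
  · intro x y hxy
    obtain ⟨c, hc⟩ := (IsLocalizedModule.eq_iff_exists (Submonoid.powers f) _).1 hxy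
    exact (hbij c).1 hc
  · intro y
    obtain ⟨⟨x, s⟩, h⟩ := IsLocalizedModule.surj (Submonoid.powers f) (LinearMap.lTensor (R := A) B
        (LocalizedModule.mkLinearMap (Submonoid.powers f) M)) y
    obtain ⟨z, hz⟩ := (hbij s).2 x
    refine ⟨z, ?_⟩
    have h2 := (Module.End.isUnit_iff _).1 (IsLocalizedModule.map_units (LinearMap.lTensor (R := A) B
        (LocalizedModule.mkLinearMap (Submonoid.powers f) M)) s)
    apply h2.1
    simp only [Module.algebraMap_end_apply]
    rw [← map_smul]
    exact (congrArg _ hz).trans h.symm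

theorem aux_B {A : Type} [CommRing A] (f : A) :
    Function.Bijective (fun b : (Localization.Away (X * C f - 1 : A[X])) ⧸ LinearMap.range
      (Algebra.linearMap A[X] (Localization.Away (X * C f - 1 : A[X]))) => f • b) := by
  set g : A[X] := X * C f - 1 with hg
  set B := (Localization.Away g) ⧸ LinearMap.range
      (Algebra.linearMap A[X] (Localization.Away g))
  have hCf : ∀ b : B, f • b = (C f : A[X]) • b := by
    intro b
    exact (algebraMap_smul A[X] f b).symm
  have htors : ∀ b : B, ∃ k : ℕ, g ^ k • b = 0 := by
    intro b
    obtain ⟨l, rfl⟩ := Submodule.Quotient.mk_surjective _ b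
    obtain ⟨⟨r, ⟨_, k, rfl⟩⟩, h⟩ := IsLocalization.surj (Submonoid.powers g) l
    refine ⟨k, ?_⟩
    rw [← Submodule.Quotient.mk_smul, Submodule.Quotient.mk_eq_zero]
    refine ⟨r, ?_⟩
    rw [Algebra.linearMap_apply, ← h, Algebra.smul_def, mul_comm]
  have hinv : ∀ k : ℕ, ∃ h q : A[X], C f * h + q * g ^ k = 1 := by
    intro k
    have : IsCoprime (C f) (g ^ k) := by
      apply IsCoprime.pow_right
      exact ⟨X, -1, by rw [hg]; ring⟩
    obtain ⟨a, b, h⟩ := this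
    exact ⟨a, b, by rw [← h]; ring⟩
  have hsol : ∀ b : B, ∃ h : A[X], (C f * h) • b = b := by
    intro b
    obtain ⟨k, hk⟩ := htors b
    obtain ⟨h, q, e⟩ := hinv k
    refine ⟨h, ?_⟩
    have e2 := congrArg (· • b) e
    simp only [add_smul, mul_smul q, hk, smul_zero, add_zero, one_smul] at e2
    exact e2
  constructor
  · intro x y hxy
    simp only [hCf] at hxy
    obtain ⟨h, e⟩ := hsol (x - y)
    rw [mul_comm, mul_smul, smul_sub, hxy, sub_self, smul_zero] at e
    exact sub_eq_zero.1 e.symm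
  · intro y
    obtain ⟨h, e⟩ := hsol y
    exact ⟨h • y, by simp only [hCf]; rw [← mul_smul, e]⟩

/-- `B ⊗_A M → B ⊗_A M_f` induced by the localization map
`ι : M → M_f` is bijective, where `B = R[g⁻¹]/R`, `g = tf - 1`. -/
theorem stmt1 {K : Type} [Field K] [CharZero K] {n : ℕ} (hn : 1 ≤ n)
    (f : MvPolynomial (Fin n) K) (hf : 1 ≤ f.totalDegree)
    (M : Type) [AddCommGroup M] [Module (MvPolynomial (Fin n) K) M] :
    let A := MvPolynomial (Fin n) K
    let R := Polynomial A
    let g : R := X * C f - 1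
    let L := Localization.Away g
    let B := L ⧸ LinearMap.range (Algebra.linearMap R L)
    Function.Bijective
      (LinearMap.lTensor (R := A) B
        (LocalizedModule.mkLinearMap (Submonoid.powers f) M)) := by
  intro A R g L B
  exact aux_tensor f B M (aux_B f)
end

section
/- Let K be a field of characteristic zero, A = K[x₁,…,xₙ], f ∈ A non-constant, A_f = Localization.Away f, R′ = A_f[t], and g = t·f − 1 ∈ R′. Let B′ = R′[g⁻¹]/R′ be the cokernel of the localization map R′ → Localization.Away g, regarded as an A_f-module by restriction of scalars. Then the family (δ^(j))_{j∈ℕ}, where δ^(j) is the class in B′ of f^{j+1}/g^{j+1} = f^{j+1}·(tf−1)^{−(j+1)}, is a basis of B′ as an A_f-module; in particular every element of B′ is uniquely a finite A_f-linear combination of the δ^(j). -/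
open Polynomial

set_option synthInstance.maxHeartbeats 4000000
set_option maxHeartbeats 4000000
set_option maxSynthPendingDepth 3

noncomputable section

namespace Stmt3

variable (K : Type) [Field K] (n : ℕ)

/-- `A_f = K[x₁,…,xₙ][f⁻¹]`. -/
abbrev Af (f : MvPolynomial (Fin n) K) := Localization.Away f

/-- `R′ = A_f[t]`. -/
abbrev R' (f : MvPolynomial (Fin n) K) := Polynomial (Af K n f)

/-- `g = t·f − 1 ∈ R′`. -/
abbrev g (f : MvPolynomial (Fin n) K) : R' K n f :=
  X * C (algebraMap (MvPolynomial (Fin n) K) (Af K n f) f) - 1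

/-- `R′[g⁻¹]`. -/
abbrev L' (f : MvPolynomial (Fin n) K) := Localization.Away (g K n f)

/-- `B′ = R′[g⁻¹]/R′`, realizing `B_{Z|Y}[f⁻¹]`. -/
abbrev B' (f : MvPolynomial (Fin n) K) :=
  L' K n f ⧸ LinearMap.range (Algebra.linearMap (R' K n f) (L' K n f))

/-- `δ^(j)`, the class in `B′` of `f^(j+1)/(tf−1)^(j+1)`. -/
def delta (f : MvPolynomial (Fin n) K) (j : ℕ) : B' K n f :=
  Submodule.Quotient.mk
    (Localization.mk
      (C ((algebraMap (MvPolynomial (Fin n) K) (Af K n f) f) ^ (j + 1)) : R' K n f)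
      ⟨(g K n f) ^ (j + 1), j + 1, rfl⟩)

/-- Spanning, abstractly. -/
theorem span_aux {R L : Type*} [CommRing R] [CommRing L] [Algebra R[X] L] [Algebra R L]
    [IsScalarTower R R[X] L] (a b : R) (hab : a * b = 1) (u : L)
    (hu : algebraMap R[X] L (X * C a - 1) * u = 1)
    (S : Submodule R (L ⧸ LinearMap.range (Algebra.linearMap R[X] L)))
    (hS : ∀ j : ℕ, (Submodule.Quotient.mk (algebraMap R[X] L (C (a ^ (j + 1))) * u ^ (j + 1)) :
      L ⧸ LinearMap.range (Algebra.linearMap R[X] L)) ∈ S) (k : ℕ) :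
    ∀ r : R[X], (Submodule.Quotient.mk (algebraMap R[X] L r * u ^ k) :
      L ⧸ LinearMap.range (Algebra.linearMap R[X] L)) ∈ S := by
  induction k with
  | zero =>
    intro r
    have : (Submodule.Quotient.mk (algebraMap R[X] L r * u ^ 0) :
      L ⧸ LinearMap.range (Algebra.linearMap R[X] L)) = 0 := by
      rw [Submodule.Quotient.mk_eq_zero]
      exact ⟨r, by simp⟩
    rw [this]
    exact S.zero_mem
  | succ k ih =>
    intro r
    obtain ⟨q, hq⟩ := X_sub_C_dvd_sub_C_eval (a := b) (p := r)
    have hCab : (C a * C b : R[X]) = 1 := by rw [← C_mul, hab, C_1]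
    have hr : r = (X * C a - 1) * (C b * q) + C (r.eval b * b ^ (k + 1)) * C (a ^ (k + 1)) := by
      have h1 : r.eval b * b ^ (k + 1) * a ^ (k + 1) = r.eval b := by
        rw [mul_assoc, ← mul_pow, mul_comm b a, hab, one_pow, mul_one]
      rw [← C_mul, h1]
      linear_combination hq - X * q * hCab
    have key : algebraMap R[X] L r * u ^ (k + 1) = algebraMap R[X] L (C b * q) * u ^ k +
        (r.eval b * b ^ (k + 1)) • (algebraMap R[X] L (C (a ^ (k + 1))) * u ^ (k + 1)) := by
      rw [Algebra.smul_def, IsScalarTower.algebraMap_apply R R[X] L, ← Polynomial.C_eq_algebraMap]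
      conv_lhs => rw [hr]
      rw [map_add, map_mul, map_mul _ (C (r.eval b * b ^ (k + 1)))]
      linear_combination (algebraMap R[X] L (C b * q) * u ^ k) * hu
    rw [key]
    exact S.add_mem (ih _) (S.smul_mem _ (hS k))

/-- Independence, abstractly. -/
theorem indep_aux {R L : Type*} [CommRing R] [CommRing L] [Algebra R[X] L] [Algebra R L]
    [IsScalarTower R R[X] L] (a b : R) (hab : a * b = 1) (u : L)
    (hu : algebraMap R[X] L (X * C a - 1) * u = 1)
    (hinj : Function.Injective (algebraMap R[X] L)) (c : ℕ → R) (N : ℕ) :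
    (∑ j ∈ Finset.range N, c j • (Submodule.Quotient.mk
      (algebraMap R[X] L (C (a ^ (j + 1))) * u ^ (j + 1)) :
      L ⧸ LinearMap.range (Algebra.linearMap R[X] L))) = 0 → ∀ j < N, c j = 0 := by
  induction N with
  | zero => intro _ j hj; omega
  | succ N ih =>
    intro h
    have hN : c N = 0 := by
      have h' : (Submodule.Quotient.mk (∑ j ∈ Finset.range (N + 1),
          c j • (algebraMap R[X] L (C (a ^ (j + 1))) * u ^ (j + 1))) :
          L ⧸ LinearMap.range (Algebra.linearMap R[X] L)) = 0 := by
        rw [← h]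
        exact map_sum ((Submodule.mkQ
          (LinearMap.range (Algebra.linearMap R[X] L))).toAddMonoidHom) _ _
      rw [Submodule.Quotient.mk_eq_zero] at h'
      obtain ⟨r, hr⟩ := h'
      rw [Algebra.linearMap_apply] at hr
      have h2 : r * (X * C a - 1) ^ (N + 1) =
          ∑ j ∈ Finset.range (N + 1), C (c j * a ^ (j + 1)) * (X * C a - 1) ^ (N - j) := by
        apply hinj
        rw [map_mul, hr, map_sum, Finset.sum_mul]
        refine Finset.sum_congr rfl fun j hj => ?_
        have hj' : N + 1 = (j + 1) + (N - j) := by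
          have := Finset.mem_range.1 hj
          omega
        rw [Algebra.smul_def, IsScalarTower.algebraMap_apply R R[X] L,
          ← Polynomial.C_eq_algebraMap, hj', pow_add, C_mul]
        have h3 : u ^ (j + 1) * algebraMap R[X] L (X * C a - 1) ^ (j + 1) = 1 := by
          rw [← mul_pow, mul_comm, hu, one_pow]
        generalize (X * C a - 1 : R[X]) = P at h3 ⊢
        simp only [map_mul, map_pow] at h3 ⊢
        linear_combination (algebraMap R[X] L (C (c j)) * algebraMap R[X] L (C a) ^ (j + 1) *
          algebraMap R[X] L P ^ (N - j)) * h3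
      have h4 := congrArg (eval b) h2
      have h0 : a * b - 1 = 0 := by rw [hab, sub_self]
      rw [Finset.sum_range_succ, eval_add, eval_finsetSum, Finset.sum_eq_zero] at h4
      · simp [h0] at h4
        calc c N = c N * a ^ (N + 1) * b ^ (N + 1) := by
              rw [mul_assoc, ← mul_pow, hab, one_pow, mul_one]
          _ = 0 := by rw [← h4, zero_mul]
      · intro j hj
        have : N - j ≠ 0 := by
          have := Finset.mem_range.1 hj
          omega
        simp [h0, this]
    intro j hj
    rw [Finset.sum_range_succ, hN, zero_smul, add_zero] at h
    rcases Nat.lt_succ_iff_lt_or_eq.1 hj with hj | rfl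
    · exact ih h j hj
    · exact hN

theorem nzd_aux {R : Type*} [CommRing R] (a b : R) (hab : a * b = 1) :
    (X * C a - 1 : R[X]) ∈ nonZeroDivisors R[X] := by
  have h : (X * C a - 1 : R[X]) = C a * (X - C b) := by
    have : (C a * C b : R[X]) = 1 := by rw [← C_mul, hab, C_1]
    linear_combination this
  rw [h]
  refine mul_mem (IsUnit.mem_nonZeroDivisors ?_) (monic_X_sub_C b).mem_nonZeroDivisors
  exact (IsUnit.of_mul_eq_one b hab).map C

/-- the family `δ^(j) = [f^{j+1}·(tf−1)^{−(j+1)}]`, `j ∈ ℕ`, is a basis of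
`B′ = R′[g⁻¹]/R′` as an `A_f`-module: it is linearly independent and spans. -/
theorem stmt3 [CharZero K] (hn : 1 ≤ n)
    (f : MvPolynomial (Fin n) K) (hf : 1 ≤ f.totalDegree) :
    LinearIndependent (Af K n f) (delta K n f) ∧
      Submodule.span (Af K n f) (Set.range (delta K n f)) = ⊤ := by
  obtain ⟨b, hab⟩ := (IsLocalization.Away.algebraMap_isUnit (S := Af K n f) f).exists_right_inv
  set a := algebraMap (MvPolynomial (Fin n) K) (Af K n f) f with ha
  have hmk : ∀ (r : R' K n f) (k : ℕ) (h : g K n f ^ k ∈ Submonoid.powers (g K n f)),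
      (Localization.mk r ⟨g K n f ^ k, h⟩ : L' K n f) =
        algebraMap _ _ r * (Localization.mk 1 ⟨g K n f, Submonoid.mem_powers _⟩) ^ k := by
    intro r k h
    rw [Localization.mk_pow, ← Localization.mk_one_eq_algebraMap, Localization.mk_mul]
    congr 1
    · simp
    · ext1; simp
  set u : L' K n f := Localization.mk 1 ⟨g K n f, Submonoid.mem_powers _⟩ with hudef
  have hu : algebraMap (R' K n f) (L' K n f) (X * C a - 1) * u = 1 := by
    rw [hudef, ← Localization.mk_one_eq_algebraMap, Localization.mk_mul, mul_one, one_mul]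
    exact Localization.mk_self (⟨g K n f, Submonoid.mem_powers _⟩ : Submonoid.powers (g K n f))
  have hinj : Function.Injective (algebraMap (R' K n f) (L' K n f)) :=
    IsLocalization.injective _ (M := Submonoid.powers (g K n f))
      (Submonoid.powers_le.2 (nzd_aux a b hab))
  have hd : ∀ j, delta K n f j = Submodule.Quotient.mk
      (algebraMap (R' K n f) (L' K n f) (C (a ^ (j + 1))) * u ^ (j + 1)) := by
    intro j
    exact congrArg Submodule.Quotient.mk (hmk (C (a ^ (j + 1))) (j + 1) ⟨j + 1, rfl⟩)
  constructor
  · rw [linearIndependent_iff'']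
    intro s c hc hs i
    by_contra hi
    have hsub : s ⊆ Finset.range (s.sup id + 1) := fun j hj =>
      Finset.mem_range.2 (Nat.lt_succ_of_le (Finset.le_sup (f := id) hj))
    rw [Finset.sum_subset hsub (fun j _ hj => by rw [hc j hj, zero_smul])] at hs
    simp only [hd] at hs
    have his : i ∈ s := by
      by_contra h
      exact hi (hc i h)
    exact hi (indep_aux a b hab u hu hinj c _ hs i (Finset.mem_range.1 (hsub his)))
  · rw [eq_top_iff]
    rintro z -
    obtain ⟨y, rfl⟩ := Submodule.Quotient.mk_surjective _ z
    induction y using Localization.induction_on with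
    | H y =>
      obtain ⟨r, ⟨_, k, rfl⟩⟩ := y
      have := hmk r k ⟨k, rfl⟩
      simp only at this ⊢
      rw [this]
      refine span_aux a b hab u hu _ (fun j => ?_) k r
      rw [← hd]
      exact Submodule.subset_span ⟨j, rfl⟩

end Stmt3
end
end

section
/- Let K be a field of characteristic zero, A = K[x₁,…,xₙ], f ∈ A non-constant, R = A[t], g = t·f − 1, and B = R[g⁻¹]/R. Let ∂_{x_i} and ∂_t denote the K-linear endomorphisms of B induced by the unique derivations of Localization.Away g extending the partial derivatives ∂/∂x_i and ∂/∂t of R (these derivations preserve the image of R, hence descend to B). Then the class δ of f/g in B satisfies (tf−1)·δ = 0 and ∂_{x_i}(δ) = f_i·∂_t(t²·δ) for every i = 1,…,n, where f_i = ∂f/∂x_i. -/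
open Polynomial

set_option synthInstance.maxHeartbeats 4000000
set_option maxHeartbeats 4000000
set_option maxSynthPendingDepth 3

noncomputable section

namespace Stmt5

variable (K : Type) [Field K] (n : ℕ)

/-- `R = A[t]` where `A = K[x₁,…,xₙ]`. -/
abbrev R := Polynomial (MvPolynomial (Fin n) K)

/-- `g = t·f − 1 ∈ R`. -/
abbrev g (f : MvPolynomial (Fin n) K) : R K n := X * C f - 1

/-- `R[g⁻¹]`. -/
abbrev L (f : MvPolynomial (Fin n) K) := Localization.Away (g K n f)

/-- `B = R[g⁻¹]/R`. -/
abbrev B (f : MvPolynomial (Fin n) K) :=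
  L K n f ⧸ LinearMap.range (Algebra.linearMap (R K n) (L K n f))

/-- The element `f/g = f/(tf−1)` of `R[g⁻¹]`. -/
def deltaL (f : MvPolynomial (Fin n) K) : L K n f :=
  Localization.mk (C f) ⟨g K n f, 1, pow_one _⟩

/-- given the (unique) derivations `Dx i` and `Dt` of `R[g⁻¹]` extending the
partial derivatives `∂/∂x_i` (acting coefficientwise on `R = A[t]`) and `∂/∂t` of `R`,
the class `δ` of `f/g` in `B = R[g⁻¹]/R` satisfies `(tf−1)·δ = 0` and
`∂_{x_i}(δ) = f_i·∂_t(t²·δ)` for all `i`, where `f_i = ∂f/∂x_i` and `∂_{x_i}`, `∂_t` denote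
the endomorphisms of `B` induced by `Dx i`, `Dt` (expressed here on representatives). -/
theorem stmt5 [CharZero K] (hn : 1 ≤ n)
    (f : MvPolynomial (Fin n) K) (hf : 1 ≤ f.totalDegree)
    (Dx : Fin n → Derivation K (L K n f) (L K n f))
    (hDx : ∀ i (r : R K n),
      Dx i (algebraMap (R K n) (L K n f) r) =
        algebraMap (R K n) (L K n f)
          (r.sum fun m a => C (MvPolynomial.pderiv i a) * X ^ m))
    (Dt : Derivation K (L K n f) (L K n f))
    (hDt : ∀ r : R K n,
      Dt (algebraMap (R K n) (L K n f) r) =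
        algebraMap (R K n) (L K n f) (derivative r)) :
    (g K n f) • (Submodule.Quotient.mk (deltaL K n f) : B K n f) = 0 ∧
    ∀ i : Fin n,
      (Submodule.Quotient.mk (Dx i (deltaL K n f)) : B K n f) =
        (C (MvPolynomial.pderiv i f) : R K n) •
          (Submodule.Quotient.mk (Dt (((X : R K n) ^ 2) • deltaL K n f)) : B K n f) := by
  have hG : IsUnit (algebraMap (R K n) (L K n f) (g K n f)) :=
    IsLocalization.Away.algebraMap_isUnit (g K n f)
  have hd : algebraMap (R K n) (L K n f) (g K n f) * deltaL K n f
      = algebraMap (R K n) (L K n f) (C f) := by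
    have h := IsLocalization.mk'_spec' (L K n f) (C f : R K n)
      (⟨g K n f, 1, pow_one _⟩ : Submonoid.powers (g K n f))
    rw [← Localization.mk_eq_mk'] at h
    exact h
  have hg : algebraMap (R K n) (L K n f) (g K n f) =
      algebraMap (R K n) (L K n f) X * algebraMap (R K n) (L K n f) (C f) - 1 := by
    rw [← map_mul, ← map_one (algebraMap (R K n) (L K n f)), ← map_sub]
  constructor
  · rw [← Submodule.Quotient.mk_smul, Submodule.Quotient.mk_eq_zero]
    refine ⟨C f, ?_⟩
    rw [Algebra.linearMap_apply, ← hd, Algebra.smul_def]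
  · intro i
    rw [← Submodule.Quotient.mk_smul, Submodule.Quotient.eq]
    refine ⟨-C (MvPolynomial.pderiv i f), ?_⟩
    rw [Algebra.linearMap_apply, Algebra.smul_def, Algebra.smul_def, map_neg]
    have hxf : Dx i (algebraMap (R K n) (L K n f) (C f)) =
        algebraMap (R K n) (L K n f) (C (MvPolynomial.pderiv i f)) := by
      rw [hDx, Polynomial.sum_C_index (by simp)]
      simp
    have hxX : Dx i (algebraMap (R K n) (L K n f) X) = 0 := by
      rw [hDx, Polynomial.sum_X_index (by simp)]
      simp
    have htf : Dt (algebraMap (R K n) (L K n f) (C f)) = 0 := by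
      rw [hDt]; simp
    have htX : Dt (algebraMap (R K n) (L K n f) X) = 1 := by
      rw [hDt]; simp
    rw [map_pow]
    generalize algebraMap (R K n) (L K n f) (C (MvPolynomial.pderiv i f)) = Fi at *
    generalize algebraMap (R K n) (L K n f) (g K n f) = G at *
    generalize algebraMap (R K n) (L K n f) (C f) = F at *
    generalize algebraMap (R K n) (L K n f) X = T at *
    generalize deltaL K n f = d at *
    have h1 := congrArg (Dx i) hd
    have h2 := congrArg Dt hd
    rw [hg] at h1 h2
    simp only [Derivation.leibniz, map_sub, Derivation.map_one_eq_zero, hxf, hxX, htf, htX,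
      smul_eq_mul] at h1 h2
    have h3 : Dt (T ^ 2 * d) = T ^ 2 * Dt d + 2 * T * d := by
      rw [pow_two]
      simp only [Derivation.leibniz, htX, smul_eq_mul]
      ring
    rw [h3]
    apply (hG.pow 2).mul_left_cancel
    generalize Dx i d = a at *
    generalize Dt d = b at *
    clear h3 hxf hxX htf htX hDx hDt hG
    subst hg
    linear_combination (-(T * F - 1)) * h1 + T * Fi * hd
      + Fi * T ^ 2 * ((T * F - 1) * h2 - F * hd) + 2 * Fi * T * (T * F - 1) * hd

end Stmt5
end
end

section
/- Let K be a field of characteristic zero, A = K[x₁,…,xₙ], f ∈ A non-constant, A_f = Localization.Away f, R′ = A_f[t], g = t·f − 1 ∈ R′, and B′ = R′[g⁻¹]/R′. Let ∂_i (i = 1,…,n) and ∂_t be the K-linear endomorphisms of B′ induced by the unique derivations of Localization.Away g extending ∂/∂x_i and ∂/∂t on R′. Let 𝒜 be the K-subalgebra of Module.End K B′ generated by the multiplication operators by all elements of R′ together with ∂_1,…,∂_n,∂_t (modeling D_Y[f⁻¹]). Then the annihilator {P ∈ 𝒜 : P(δ) = 0} of the class δ of f/g equals the left ideal of 𝒜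 generated by the n+1 elements: multiplication by (t − f⁻¹), and ∂_i − M_{f_i·f⁻²}∘∂_t for i = 1,…,n, where M_a denotes multiplication by a ∈ A_f and f_i = ∂f/∂x_i. -/
open Polynomial

set_option synthInstance.maxHeartbeats 4000000
set_option maxHeartbeats 4000000
set_option maxSynthPendingDepth 3

noncomputable section

namespace Stmt7

variable (K : Type) [Field K] (n : ℕ)

/-- `A_f = K[x₁,…,xₙ][f⁻¹]`. -/
abbrev Af (f : MvPolynomial (Fin n) K) := Localization.Away f

/-- `R′ = A_f[t]`. -/
abbrev R' (f : MvPolynomial (Fin n) K) := Polynomial (Af K n f)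

/-- `g = t·f − 1 ∈ R′`. -/
abbrev g (f : MvPolynomial (Fin n) K) : R' K n f :=
  X * C (algebraMap (MvPolynomial (Fin n) K) (Af K n f) f) - 1

/-- `R′[g⁻¹]`. -/
abbrev L' (f : MvPolynomial (Fin n) K) := Localization.Away (g K n f)

/-- `B′ = R′[g⁻¹]/R′`, realizing `B_{Z|Y}[f⁻¹]`. -/
abbrev B' (f : MvPolynomial (Fin n) K) :=
  L' K n f ⧸ LinearMap.range (Algebra.linearMap (R' K n f) (L' K n f))

/-- Multiplication by `r ∈ R′` as a `K`-linear endomorphism of `B′`. -/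
def mulOp (f : MvPolynomial (Fin n) K) (r : R' K n f) : Module.End K (B' K n f) :=
  (LinearMap.lsmul (R' K n f) (B' K n f) r).restrictScalars K

/-- The element `f/g = f/(tf−1)` of `R′[g⁻¹]`. -/
def deltaL (f : MvPolynomial (Fin n) K) : L' K n f :=
  Localization.mk (C (algebraMap (MvPolynomial (Fin n) K) (Af K n f) f)) ⟨g K n f, 1, pow_one _⟩

section Abstract

open Polynomial

/-- Normal form modulo the left ideal. -/
theorem abs_normal {K A E : Type*} [CommRing K] [CommRing A] [Algebra K A] [Ring E] [Algebra K E] {n : ℕ}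
    (M : A[X] →+* E) (d : Fin n → E) (dt : E) (v : A) (c : Fin n → A) (D : Fin n → A → A)
    (hK : ∀ k : K, M (C (algebraMap K A k)) = algebraMap K E k)
    (h1 : ∀ a, dt * M (C a) = M (C a) * dt)
    (h2 : dt * M X = M X * dt + 1)
    (h3 : ∀ i a, d i * M (C a) = M (C (D i a)) + M (C a) * d i)
    (h4 : ∀ i, d i * dt = dt * d i)
    (S : Subalgebra K E) (hS : S = Algebra.adjoin K ((Set.range M ∪ Set.range d) ∪ {dt}))
    (P : E) (hP : P ∈ S) :
    ∃ (p : A[X]) (Q0 : E) (Q : Fin n → E), Q0 ∈ S ∧ (∀ i, Q i ∈ S) ∧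
      P = (p.sum fun k a => M (C a) * dt ^ k) + (Q0 * M (X - C v) +
        ∑ i, Q i * (d i - M (C (c i)) * dt)) := by
  classical
  have hMS : ∀ r, M r ∈ S := fun r => by
    rw [hS]; exact Algebra.subset_adjoin (Or.inl (Or.inl ⟨r, rfl⟩))
  have hdtS : dt ∈ S := by
    rw [hS]; exact Algebra.subset_adjoin (Or.inr rfl)
  let W : A[X] →+ E :=
    { toFun := fun p => p.sum fun k a => M (C a) * dt ^ k
      map_zero' := by simp
      map_add' := fun p q => by
        apply Polynomial.sum_add_index <;> intros <;> simp [add_mul] }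
  have hW : ∀ k a, W (monomial k a) = M (C a) * dt ^ k := fun k a => by
    change (monomial k a).sum (fun k a => M (C a) * dt ^ k) = _
    rw [Polynomial.sum_monomial_index]; simp
  -- the additive subgroup N
  let J : AddSubgroup E :=
    { carrier := {x | ∃ (Q0 : E) (Q : Fin n → E), Q0 ∈ S ∧ (∀ i, Q i ∈ S) ∧
        x = Q0 * M (X - C v) + ∑ i, Q i * (d i - M (C (c i)) * dt)}
      zero_mem' := ⟨0, 0, S.zero_mem, fun _ => S.zero_mem, by simp⟩
      add_mem' := by
        rintro _ _ ⟨Q0, Q, hQ0, hQ, rfl⟩ ⟨R0, R, hR0, hR, rfl⟩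
        refine ⟨Q0 + R0, Q + R, S.add_mem hQ0 hR0, fun i => S.add_mem (hQ i) (hR i), ?_⟩
        simp only [Pi.add_apply, add_mul, Finset.sum_add_distrib]
        abel
      neg_mem' := by
        rintro _ ⟨Q0, Q, hQ0, hQ, rfl⟩
        refine ⟨-Q0, -Q, S.neg_mem hQ0, fun i => S.neg_mem (hQ i), ?_⟩
        simp only [Pi.neg_apply, neg_mul, Finset.sum_neg_distrib]
        abel }
  have hJmul : ∀ a ∈ S, ∀ x ∈ J, a * x ∈ J := by
    rintro a ha _ ⟨Q0, Q, hQ0, hQ, rfl⟩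
    refine ⟨a * Q0, fun i => a * Q i, S.mul_mem ha hQ0, fun i => S.mul_mem ha (hQ i), ?_⟩
    simp only [mul_add, Finset.mul_sum, mul_assoc]
  have hJs : ∀ a ∈ S, a * M (X - C v) ∈ J := fun a ha =>
    ⟨a, 0, ha, fun _ => S.zero_mem, by simp⟩
  have hJd : ∀ i, ∀ a ∈ S, a * (d i - M (C (c i)) * dt) ∈ J := fun i a ha =>
    ⟨0, Pi.single i a, S.zero_mem, fun j => by
      by_cases h : j = i
      · subst h; simpa using ha
      · simp [h, S.zero_mem], by
      rw [Finset.sum_eq_single i]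
      · simp
      · intro j _ h; simp [h]
      · simp⟩
  let N : AddSubgroup E := W.range ⊔ J
  have hWN : ∀ k a, M (C a) * dt ^ k ∈ N := fun k a =>
    (le_sup_left : W.range ≤ N) ⟨monomial k a, hW k a⟩
  have hJN : J ≤ N := le_sup_right
  have step : ∀ y ∈ S, (∀ k a, y * (M (C a) * dt ^ k) ∈ N) → ∀ x ∈ N, y * x ∈ N := by
    intro y hy h x hx
    obtain ⟨w, ⟨p, rfl⟩, j, hj, rfl⟩ := AddSubgroup.mem_sup.1 hx
    rw [mul_add]
    refine N.add_mem ?_ (hJN (hJmul y hy j hj))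
    induction p using Polynomial.induction_on' with
    | add p q hp hq =>
      rw [map_add, mul_add]
      refine N.add_mem (hp ?_) (hq ?_)
      · exact N.add_mem ((le_sup_left : W.range ≤ N) ⟨_, rfl⟩) (hJN hj)
      · exact N.add_mem ((le_sup_left : W.range ≤ N) ⟨_, rfl⟩) (hJN hj)
    | monomial k a => rw [hW]; exact h k a
  have hdtk : ∀ k a, dt ^ k * M (C a) = M (C a) * dt ^ k := fun k a =>
    (Commute.pow_left (h1 a) k)
  have hdk : ∀ i k, d i * dt ^ k = dt ^ k * d i := fun i k =>
    (Commute.pow_right (h4 i) k)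
  have hsk : ∀ k : ℕ, M (X - C v) * dt ^ k = dt ^ k * M (X - C v) - (k : E) * dt ^ (k - 1) := by
    intro k
    have hs : M (X - C v) * dt = dt * M (X - C v) - 1 := by
      rw [map_sub, sub_mul, mul_sub, h2, h1]; abel
    induction k with
    | zero => simp
    | succ k ih =>
      rw [pow_succ, ← mul_assoc, ih, sub_mul, mul_assoc, hs, mul_sub, mul_assoc]
      rcases k with _ | k
      · simp
      · simp only [Nat.add_sub_cancel, mul_one, ← pow_succ]
        rw [← mul_assoc (dt ^ (k + 1)) dt, ← pow_succ]
        push_cast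
        rw [add_mul ((k:E)+1) 1, one_mul]
        abel
  have hMN : ∀ r, ∀ x ∈ N, M r * x ∈ N := by
    have hC : ∀ b, ∀ x ∈ N, M (C b) * x ∈ N := fun b => step _ (hMS _) fun k a => by
      rw [← mul_assoc, ← map_mul, ← C_mul]; exact hWN _ _
    have hs : ∀ x ∈ N, M (X - C v) * x ∈ N := step _ (hMS _) fun k a => by
      rw [← mul_assoc, ← map_mul, mul_comm (X - C v), map_mul, mul_assoc, hsk, mul_sub]
      refine N.sub_mem ?_ ?_
      · rw [← mul_assoc]
        exact hJN (hJs _ (S.mul_mem (hMS _) (S.pow_mem hdtS _)))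
      · have := hWN (k-1) (a * (k : A))
        rwa [C_mul, map_mul, mul_assoc, show M (C (k : A)) = (k : E) by simp] at this
    have hX : ∀ x ∈ N, M X * x ∈ N := fun x hx => by
      have : M X = M (X - C v) + M (C v) := by rw [← map_add]; simp
      rw [this, add_mul]; exact N.add_mem (hs x hx) (hC v x hx)
    have hXk : ∀ k : ℕ, ∀ x ∈ N, M X ^ k * x ∈ N := by
      intro k
      induction k with
      | zero => simp
      | succ k ih => intro x hx; rw [pow_succ, mul_assoc]; exact ih _ (hX x hx)
    intro r x hx
    induction r using Polynomial.induction_on' with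
    | add p q hp hq => rw [map_add, add_mul]; exact N.add_mem hp hq
    | monomial k a =>
      rw [← C_mul_X_pow_eq_monomial, map_mul, map_pow, mul_assoc]
      exact hC _ _ (hXk _ _ hx)
  have hdtN : ∀ x ∈ N, dt * x ∈ N := step _ hdtS fun k a => by
    rw [← mul_assoc, h1, mul_assoc, ← pow_succ']; exact hWN _ _
  have hdN : ∀ i, ∀ x ∈ N, d i * x ∈ N := fun i => step _ (by
    rw [hS]; exact Algebra.subset_adjoin (Or.inl (Or.inr ⟨i, rfl⟩))) fun k a => by
    rw [← mul_assoc, h3, add_mul, mul_assoc _ (d i), hdk]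
    refine N.add_mem (hWN _ _) ?_
    have e : M (C a) * (dt ^ k * d i) =
        (M (C a) * dt ^ k) * (d i - M (C (c i)) * dt) + M (C (a * c i)) * dt ^ (k+1) := by
      rw [mul_sub, mul_assoc _ _ (M (C (c i)) * dt), ← mul_assoc (dt ^ k) (M (C (c i))), hdtk, C_mul, map_mul, pow_succ]
      simp only [mul_assoc]; abel
    rw [e]
    exact N.add_mem (hJN (hJd i _ (S.mul_mem (hMS _) (S.pow_mem hdtS _)))) (hWN _ _)
  have key : ∀ y ∈ S, ∀ x ∈ N, y * x ∈ N := by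
    intro y hy
    rw [hS] at hy
    induction hy using Algebra.adjoin_induction with
    | mem y hy =>
      rcases hy with (⟨r, rfl⟩ | ⟨i, rfl⟩) | rfl
      · exact hMN r
      · exact hdN i
      · exact hdtN
    | algebraMap k => rw [← hK]; exact hMN _
    | add a b _ _ ha hb => intro x hx; rw [add_mul]; exact N.add_mem (ha x hx) (hb x hx)
    | mul a b _ _ ha hb => intro x hx; rw [mul_assoc]; exact ha _ (hb x hx)
  have h1N : (1 : E) ∈ N := by simpa using hWN 0 1
  have := key P hP 1 h1N
  rw [mul_one] at this
  obtain ⟨w, ⟨p, rfl⟩, j, ⟨Q0, Q, hQ0, hQ, rfl⟩, rfl⟩ := AddSubgroup.mem_sup.1 this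
  exact ⟨p, Q0, Q, hQ0, hQ, rfl⟩

theorem abs_main {K A B : Type*} [CommRing K] [CommRing A] [IsDomain A] [CharZero A] [Algebra K A]
    [AddCommGroup B] [Module K B] {n : ℕ}
    (M : A[X] →+* Module.End K B) (d : Fin n → Module.End K B) (dt : Module.End K B) (v : A)
    (c : Fin n → A) (D : Fin n → A → A)
    (hK : ∀ k : K, M (C (algebraMap K A k)) = algebraMap K (Module.End K B) k)
    (h1 : ∀ a, dt * M (C a) = M (C a) * dt)
    (h2 : dt * M X = M X * dt + 1)
    (h3 : ∀ i a, d i * M (C a) = M (C (D i a)) + M (C a) * d i)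
    (h4 : ∀ i, d i * dt = dt * d i)
    (δ : B) (hs : M (X - C v) δ = 0) (hd : ∀ i, d i δ = M (C (c i)) (dt δ))
    (hδ : ∀ a, M (C a) δ = 0 → a = 0)
    (S : Subalgebra K (Module.End K B))
    (hS : S = Algebra.adjoin K ((Set.range M ∪ Set.range d) ∪ {dt}))
    (P : Module.End K B) (hP : P ∈ S) :
    P δ = 0 ↔ ∃ (Q0 : Module.End K B) (Q : Fin n → Module.End K B), Q0 ∈ S ∧ (∀ i, Q i ∈ S) ∧
      P = Q0 * M (X - C v) + ∑ i, Q i * (d i - M (C (c i)) * dt) := by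
  have hJ : ∀ (Q0 : Module.End K B) (Q : Fin n → Module.End K B),
      (Q0 * M (X - C v) + ∑ i, Q i * (d i - M (C (c i)) * dt)) δ = 0 := by
    intro Q0 Q
    simp [-map_sub, Module.End.mul_apply, LinearMap.sum_apply, hs, hd]
  constructor
  · intro h0
    obtain ⟨p, Q0, Q, hQ0, hQ, hPe⟩ := abs_normal M d dt v c D hK h1 h2 h3 h4 S hS P hP
    have hp : p = 0 := by
      by_contra hp
      rw [hPe, LinearMap.add_apply, hJ, add_zero] at h0
      have hsd : ∀ y, M (X - C v) (dt y) = dt (M (X - C v) y) - y := by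
        intro y
        have e : M (X - C v) * dt = dt * M (X - C v) - 1 := by
          rw [map_sub, sub_mul, mul_sub, h2, h1]; abel
        exact LinearMap.congr_fun e y
      have hstep : ∀ k : ℕ, M (X - C v) ((dt ^ (k+1)) δ) = -((k:ℤ)+1) • (dt ^ k) δ := by
        intro k
        induction k with
        | zero => simp [-map_sub, hsd, hs]
        | succ k ih =>
          rw [pow_succ' dt (k+1), Module.End.mul_apply, hsd, ih, map_zsmul, pow_succ' dt k,
            Module.End.mul_apply]
          push_cast
          module
      have htop : ∀ N : ℕ, (M (X - C v) ^ N) ((dt ^ N) δ) = ((-1)^N * (N.factorial : ℤ)) • δ := by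
        intro N
        induction N with
        | zero => simp
        | succ N ih =>
          rw [pow_succ (M _) N, Module.End.mul_apply, hstep, map_zsmul, ih, smul_smul,
            Nat.factorial_succ]
          congr 1
          push_cast; ring
      have hlow : ∀ N k : ℕ, k < N → (M (X - C v) ^ N) ((dt ^ k) δ) = 0 := by
        intro N k hk
        obtain ⟨m, rfl⟩ := Nat.exists_eq_add_of_lt hk
        rw [show k + m + 1 = (m + 1) + k by ring, pow_add, Module.End.mul_apply, htop, map_zsmul,
          pow_succ, Module.End.mul_apply, hs]
        simp
      have h5 := congrArg (M (X - C v) ^ p.natDegree) h0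
      have hcomm : ∀ N a y, (M (X - C v) ^ N) (M (C a) y) = M (C a) ((M (X - C v) ^ N) y) := by
        intro N a y
        rw [← Module.End.mul_apply, ← Module.End.mul_apply, ← map_pow, ← map_mul, ← map_mul,
          mul_comm]
      rw [map_zero, Polynomial.sum_def, LinearMap.sum_apply, map_sum,
        Finset.sum_eq_single p.natDegree] at h5
      · rw [Module.End.mul_apply, hcomm, htop, map_zsmul, ← LinearMap.smul_apply, ← map_zsmul,
          ← map_zsmul] at h5
        have := hδ _ h5
        rw [smul_eq_zero] at this
        rcases this with h | h
        · have := Nat.factorial_ne_zero p.natDegree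
          simp [this] at h
        · exact hp (Polynomial.leadingCoeff_eq_zero.1 h)
      · intro k hk hne
        rw [Module.End.mul_apply, hcomm, hlow, map_zero]
        exact lt_of_le_of_ne (Polynomial.le_natDegree_of_mem_supp k hk) hne
      · intro h; exact absurd (Polynomial.natDegree_mem_support_of_nonzero hp) h
    exact ⟨Q0, Q, hQ0, hQ, by simpa [hp] using hPe⟩
  · rintro ⟨Q0, Q, -, -, rfl⟩
    exact hJ Q0 Q

end Abstract

/-- let `𝒜 ⊆ End_K(B′)` be the `K`-subalgebra generated by the multiplication
operators by elements of `R′` together with the induced derivations `∂_1,…,∂_n,∂_t`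
(modeling `D_Y[f⁻¹]`).  The annihilator in `𝒜` of the class `δ` of `f/g` equals the
left ideal of `𝒜` generated by multiplication by `t − f⁻¹` and by
`∂_i − M_{f_i·f⁻²}∘∂_t`, `i = 1,…,n`. -/
theorem stmt7 [CharZero K] (hn : 1 ≤ n)
    (f : MvPolynomial (Fin n) K) (hf : 1 ≤ f.totalDegree)
    -- the unique derivation of `A_f` extending `pderiv i`:
    (DxA : Fin n → Derivation K (Af K n f) (Af K n f))
    (hDxA : ∀ i (a : MvPolynomial (Fin n) K),
      DxA i (algebraMap (MvPolynomial (Fin n) K) (Af K n f) a) =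
        algebraMap (MvPolynomial (Fin n) K) (Af K n f) (MvPolynomial.pderiv i a))
    -- the unique derivations of `R′[g⁻¹]` extending `∂/∂x_i` and `∂/∂t` on `R′`:
    (Dx : Fin n → Derivation K (L' K n f) (L' K n f))
    (hDx : ∀ i (r : R' K n f),
      Dx i (algebraMap (R' K n f) (L' K n f) r) =
        algebraMap (R' K n f) (L' K n f) (r.sum fun m a => C (DxA i a) * X ^ m))
    (Dt : Derivation K (L' K n f) (L' K n f))
    (hDt : ∀ r : R' K n f,
      Dt (algebraMap (R' K n f) (L' K n f) r) =
        algebraMap (R' K n f) (L' K n f) (derivative r))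
    -- the induced `K`-linear endomorphisms of `B′`:
    (dx : Fin n → Module.End K (B' K n f))
    (hdx : ∀ i (q : L' K n f),
      dx i (Submodule.Quotient.mk q) = Submodule.Quotient.mk (Dx i q))
    (dt : Module.End K (B' K n f))
    (hdt : ∀ q : L' K n f,
      dt (Submodule.Quotient.mk q) = Submodule.Quotient.mk (Dt q)) :
    -- `𝒜`, modeling `D_Y[f⁻¹]`:
    ∀ 𝒜 : Subalgebra K (Module.End K (B' K n f)),
      𝒜 = Algebra.adjoin K
        ((Set.range (mulOp K n f) ∪ Set.range dx) ∪ {dt}) →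
      ∀ P ∈ 𝒜,
        (P (Submodule.Quotient.mk (deltaL K n f)) = 0 ↔
          ∃ (Q0 : Module.End K (B' K n f)) (Q : Fin n → Module.End K (B' K n f)),
            Q0 ∈ 𝒜 ∧ (∀ i, Q i ∈ 𝒜) ∧
            P = Q0 * mulOp K n f
                  (X - C (Ring.inverse
                    (algebraMap (MvPolynomial (Fin n) K) (Af K n f) f))) +
              ∑ i : Fin n,
                Q i * (dx i -
                  mulOp K n f
                    (C (algebraMap (MvPolynomial (Fin n) K) (Af K n f)
                          (MvPolynomial.pderiv i f) *
                        (Ring.inverse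
                          (algebraMap (MvPolynomial (Fin n) K) (Af K n f) f)) ^ 2)) * dt)) := by
  intro 𝒜 h𝒜 P hP
  set u : Af K n f := algebraMap (MvPolynomial (Fin n) K) (Af K n f) f with hu
  have hf0 : f ≠ 0 := by rintro rfl; simp at hf
  have hle : Submonoid.powers f ≤ nonZeroDivisors (MvPolynomial (Fin n) K) :=
    powers_le_nonZeroDivisors_of_noZeroDivisors hf0
  haveI : IsDomain (Af K n f) := IsLocalization.isDomain_localization hle
  haveI : CharZero (Af K n f) := charZero_of_injective_algebraMap
    (FaithfulSMul.algebraMap_injective K (Af K n f))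
  have huu : IsUnit u := IsLocalization.Away.algebraMap_isUnit f
  set v : Af K n f := Ring.inverse u with hv
  have huv : u * v = 1 := Ring.mul_inverse_cancel u huu
  have hg : g K n f = C u * (X - C v) := by
    rw [mul_sub, ← C_mul, huv, map_one, mul_comm]
  have hg0 : g K n f ≠ 0 := by
    rw [hg]; exact mul_ne_zero (by simpa using huu.ne_zero) (X_sub_C_ne_zero v)
  have hinj : Function.Injective (algebraMap (R' K n f) (L' K n f)) :=
    IsLocalization.injective _ (powers_le_nonZeroDivisors_of_noZeroDivisors hg0)
  have hgδ : algebraMap (R' K n f) (L' K n f) (g K n f) * deltaL K n f =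
      algebraMap (R' K n f) (L' K n f) (C u) := by
    rw [deltaL, Localization.mk_eq_mk', mul_comm]
    exact IsLocalization.mk'_spec _ _ _
  have hsδ : algebraMap (R' K n f) (L' K n f) (X - C v) * deltaL K n f = 1 := by
    have e : (X - C v : R' K n f) = C v * g K n f := by
      rw [hg, ← mul_assoc, ← C_mul, mul_comm v, huv, map_one, one_mul]
    rw [e, map_mul, mul_assoc, hgδ, ← map_mul, ← C_mul, mul_comm v, huv, map_one, map_one]
  have hDxC : ∀ i a, Dx i (algebraMap (R' K n f) (L' K n f) (C a)) =
      algebraMap (R' K n f) (L' K n f) (C (DxA i a)) := by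
    intro i a
    rw [hDx, Polynomial.sum_C_index (by simp)]; simp
  have hDxX : ∀ i, Dx i (algebraMap (R' K n f) (L' K n f) X) = 0 := by
    intro i
    rw [hDx, Polynomial.sum_X_index (by simp)]; simp
  have hDtC : ∀ a, Dt (algebraMap (R' K n f) (L' K n f) (C a)) = 0 := by
    intro a; rw [hDt]; simp
  have hDtX : Dt (algebraMap (R' K n f) (L' K n f) X) = 1 := by
    rw [hDt]; simp
  have hDv : ∀ i, DxA i v = -(algebraMap (MvPolynomial (Fin n) K) (Af K n f)
      (MvPolynomial.pderiv i f) * v ^ 2) := by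
    intro i
    have e := congrArg (DxA i) huv
    rw [Derivation.leibniz, Derivation.map_one_eq_zero, hu, hDxA, ← hu, smul_eq_mul,
      smul_eq_mul] at e
    linear_combination v * e - DxA i v * huv
  -- commutation of the derivations
  have hcomm : ∀ i q, Dx i (Dt q) = Dt (Dx i q) := by
    intro i q
    have hR : ∀ r : R' K n f, Dx i (Dt (algebraMap (R' K n f) (L' K n f) r)) =
        Dt (Dx i (algebraMap (R' K n f) (L' K n f) r)) := by
      intro r
      induction r using Polynomial.induction_on' with
      | add p q hp hq => simp only [map_add, hp, hq]
      | monomial k a =>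
        rw [hDt, hDx, hDx, Polynomial.sum_monomial_index _ _ (by simp), hDt,
          Polynomial.derivative_monomial, Polynomial.sum_monomial_index _ _ (by simp),
          Polynomial.derivative_C_mul_X_pow, Derivation.leibniz]
        simp [mul_comm]
    obtain ⟨r, ⟨_, m, rfl⟩, hr⟩ := IsLocalization.exists_mk'_eq (Submonoid.powers (g K n f)) q
    have hspec : q * algebraMap (R' K n f) (L' K n f) (g K n f ^ m) =
        algebraMap (R' K n f) (L' K n f) r := by
      rw [← hr]; exact IsLocalization.mk'_spec _ _ _
    have hunit : IsUnit (algebraMap (R' K n f) (L' K n f) (g K n f ^ m)) :=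
      IsLocalization.map_units (L' K n f) (⟨_, m, rfl⟩ : Submonoid.powers (g K n f))
    have e := hR r
    have e2 := hR (g K n f ^ m)
    rw [← hspec] at e
    simp only [Derivation.leibniz, map_add, smul_eq_mul] at e
    apply hunit.mul_left_cancel
    linear_combination e - q * e2
  have hmk : ∀ r q, mulOp K n f r (Submodule.Quotient.mk q) =
      Submodule.Quotient.mk (algebraMap (R' K n f) (L' K n f) r * q) := by
    intro r q
    rw [← Algebra.smul_def]; rfl
  have hext : ∀ S T : Module.End K (B' K n f), (∀ q : L' K n f, S (Submodule.Quotient.mk q) =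
      T (Submodule.Quotient.mk q)) → S = T := by
    intro S T h
    refine LinearMap.ext fun b => ?_
    obtain ⟨q, rfl⟩ := Submodule.Quotient.mk_surjective _ b
    exact h q
  let M : R' K n f →+* Module.End K (B' K n f) :=
    { toFun := mulOp K n f
      map_one' := hext _ _ fun q => by rw [hmk]; simp
      map_mul' := fun a b => hext _ _ fun q => by
        rw [Module.End.mul_apply, hmk, hmk, hmk, map_mul, mul_assoc]
      map_zero' := hext _ _ fun q => by rw [hmk]; simp
      map_add' := fun a b => hext _ _ fun q => by
        rw [LinearMap.add_apply, hmk, hmk, hmk, map_add, add_mul]; rfl }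
  have hM : ∀ r, M r = mulOp K n f r := fun _ => rfl
  refine abs_main M dx dt v (fun i => algebraMap (MvPolynomial (Fin n) K) (Af K n f)
      (MvPolynomial.pderiv i f) * v ^ 2) (fun i a => DxA i a) ?_ ?_ ?_ ?_ ?_
      (Submodule.Quotient.mk (deltaL K n f)) ?_ ?_ ?_ 𝒜 h𝒜 P hP
  · intro k
    refine hext _ _ fun q => ?_
    rw [hM, hmk, Module.algebraMap_end_apply, ← Submodule.Quotient.mk_smul,
      Algebra.smul_def k q, IsScalarTower.algebraMap_apply K (R' K n f) (L' K n f)]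
    rfl
  · intro a
    refine hext _ _ fun q => ?_
    rw [Module.End.mul_apply, Module.End.mul_apply, hM, hmk, hdt, hdt, hmk, Derivation.leibniz, hDtC]
    simp
  · refine hext _ _ fun q => ?_
    rw [LinearMap.add_apply, Module.End.mul_apply, Module.End.mul_apply, hM, hmk, hdt, hdt, hmk,
      Derivation.leibniz, hDtX, smul_eq_mul, smul_eq_mul, mul_one]
    rfl
  · intro i a
    refine hext _ _ fun q => ?_
    rw [LinearMap.add_apply, Module.End.mul_apply, Module.End.mul_apply, hM, hM, hmk, hdx, hdx, hmk,
      hmk, Derivation.leibniz, hDxC, smul_eq_mul, smul_eq_mul, ← Submodule.Quotient.mk_add,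
      add_comm, mul_comm q]
  · intro i
    refine hext _ _ fun q => ?_
    rw [Module.End.mul_apply, Module.End.mul_apply, hdt, hdx, hdx, hdt, hcomm]
  · rw [hM, hmk, hsδ, Submodule.Quotient.mk_eq_zero]
    exact ⟨1, by simp⟩
  · intro i
    rw [hM, hdx, hdt, hmk]
    congr 1
    have e1 := congrArg (Dx i) hsδ
    have e2 := congrArg Dt hsδ
    rw [Derivation.leibniz, Derivation.map_one_eq_zero, map_sub, map_sub, hDxC, hDxX, hDv,
      smul_eq_mul, smul_eq_mul, ← map_sub] at e1
    rw [Derivation.leibniz, Derivation.map_one_eq_zero, map_sub, map_sub, hDtC, hDtX,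
      smul_eq_mul, smul_eq_mul, ← map_sub] at e2
    rw [C_neg, map_neg] at e1
    generalize algebraMap (R' K n f) (L' K n f) (C (algebraMap (MvPolynomial (Fin n) K) (Af K n f)
      (MvPolynomial.pderiv i f) * v ^ 2)) = c at e1 ⊢
    linear_combination deltaL K n f * e1 - deltaL K n f * c * e2 -
      (Dx i (deltaL K n f) - c * Dt (deltaL K n f)) * hsδ
  · intro a ha
    rw [hM, hmk, Submodule.Quotient.mk_eq_zero] at ha
    obtain ⟨r, hr⟩ := ha
    rw [Algebra.linearMap_apply] at hr
    have e : (X - C v) * r = C a := by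
      apply hinj
      rw [map_mul, hr]
      linear_combination algebraMap (R' K n f) (L' K n f) (C a) * hsδ
    have e2 := congrArg (Polynomial.eval v) e
    simpa using e2.symm

end Stmt7
end
end

section
/- Let K be a field of characteristic zero, A = K[x₁,…,xₙ], f ∈ A of total degree d ≥ 1, and A_f = Localization.Away f. For k ∈ ℕ let F_k be the K-subspace of A_f consisting of all elements of the form a/f^{k+1} with a ∈ A, totalDegree a ≤ (d+1)·k. Then F_k ⊆ F_{k+1} for all k, and the K-dimension of F_k is finite with finrank_K F_k ≤ (n + (d+1)k choose n). -/
set_option synthInstance.maxHeartbeats 4000000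
set_option maxHeartbeats 4000000
set_option maxSynthPendingDepth 3

noncomputable section

namespace Stmt9

variable (K : Type) [Field K] (n : ℕ)

/-- The `K`-linear map `A → A_f`, `a ↦ a/f^(k+1)`. -/
def toLoc (f : MvPolynomial (Fin n) K) (k : ℕ) :
    MvPolynomial (Fin n) K →ₗ[K] Localization.Away f :=
  (LinearMap.mulLeft K
      (Ring.inverse (algebraMap (MvPolynomial (Fin n) K) (Localization.Away f) (f ^ (k + 1))))).comp
    ((Algebra.linearMap (MvPolynomial (Fin n) K) (Localization.Away f)).restrictScalars K)

/-- `F_k`, the `K`-subspace of `A_f` of all `a/f^(k+1)` with `totalDegree a ≤ (d+1)k`. -/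
def F (f : MvPolynomial (Fin n) K) (k : ℕ) : Submodule K (Localization.Away f) :=
  Submodule.map (toLoc K n f k)
    (MvPolynomial.restrictTotalDegree (Fin n) K ((f.totalDegree + 1) * k))

theorem finrank_restrict_le (m : ℕ) :
    Module.finrank K (MvPolynomial.restrictTotalDegree (Fin n) K m) ≤ (n + m).choose n := by
  have hb := Module.finrank_eq_nat_card_basis (MvPolynomial.basisRestrictSupport K
    { s : Fin n →₀ ℕ | (s.sum fun _ e => e) ≤ m })
  have hS : { s : Fin n →₀ ℕ | (s.sum fun _ e => e) ≤ m } =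
      ((Finset.range (m + 1)).biUnion
        (fun j => (Finset.univ : Finset (Fin n)).finsuppAntidiag j) : Finset (Fin n →₀ ℕ)) := by
    ext s
    simp [Finsupp.sum_fintype]
  unfold MvPolynomial.restrictTotalDegree
  rw [hb, hS, Nat.card_coe_set_eq, Set.ncard_coe_finset]
  refine Finset.card_biUnion_le.trans ?_
  simp only [Finset.card_finsuppAntidiag_nat_eq_multichoose, Finset.card_univ, Fintype.card_fin]
  rw [Nat.sum_range_multichoose]
  exact le_of_eq (by congr 1 <;> omega)

theorem toLoc_succ (f a : MvPolynomial (Fin n) K) (k : ℕ) :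
    toLoc K n f (k + 1) (f * a) = toLoc K n f k a := by
  have hu : IsUnit (algebraMap (MvPolynomial (Fin n) K) (Localization.Away f) f) :=
    IsLocalization.Away.algebraMap_isUnit f
  have h1 := hu.pow (k + 1)
  have h2 := hu.pow (k + 1 + 1)
  simp only [toLoc, LinearMap.comp_apply, LinearMap.mulLeft_apply,
    LinearMap.restrictScalars_apply, Algebra.linearMap_apply, map_pow, map_mul]
  apply h2.mul_left_cancel
  rw [← mul_assoc, Ring.mul_inverse_cancel _ h2, pow_succ _ (k + 1), mul_comm _ (algebraMap _ _ f),
    mul_assoc, ← mul_assoc (_ ^ (k + 1)), Ring.mul_inverse_cancel _ h1]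
  ring

/-- the subspaces `F_k ⊆ A_f` of elements `a/f^{k+1}` with
`totalDegree a ≤ (d+1)k` form an increasing filtration, each `F_k` is
finite-dimensional over `K`, and `dim_K F_k ≤ (n + (d+1)k).choose n`. -/
theorem stmt9 [CharZero K] (hn : 1 ≤ n)
    (f : MvPolynomial (Fin n) K) (hf : 1 ≤ f.totalDegree) :
    (∀ k : ℕ, F K n f k ≤ F K n f (k + 1)) ∧
    (∀ k : ℕ, FiniteDimensional K ↥(F K n f k) ∧
      Module.finrank K ↥(F K n f k) ≤ (n + (f.totalDegree + 1) * k).choose n) := by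
  refine ⟨fun k => ?_, fun k => ⟨?_, ?_⟩⟩
  · rintro _ ⟨a, ha, rfl⟩
    refine ⟨f * a, ?_, toLoc_succ K n f a k⟩
    have ha' := (MvPolynomial.mem_restrictTotalDegree _ _ _).1 ha
    refine (MvPolynomial.mem_restrictTotalDegree _ _ _).2 ?_
    have := MvPolynomial.totalDegree_mul f a
    rw [Nat.mul_succ]
    omega
  · unfold F
    infer_instance
  · exact (Submodule.finrank_map_le _ _).trans (finrank_restrict_le K n _)

end Stmt9
end
end

section
/- Let K be a field of characteristic zero, A = K[x₁,…,xₙ], f ∈ A of total degree d ≥ 1, A_f = Localization.Away f, and for k ∈ ℕ let F_k be the K-subspace of A_f of elements a/f^{k+1} with a ∈ A of total degree ≤ (d+1)k. Let ∂_i : A_f → A_f be the unique derivation extending ∂/∂x_i on A. Then for every k and every i = 1,…,n: multiplication by x_i maps F_k into F_{k+1}, and ∂_i maps F_k into F_{k+1}. -/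
set_option synthInstance.maxHeartbeats 4000000
set_option maxHeartbeats 4000000
set_option maxSynthPendingDepth 3

noncomputable section

namespace Stmt10

variable (K : Type) [Field K] (n : ℕ)

/-- The `K`-linear map `A → A_f`, `a ↦ a/f^(k+1)`. -/
def toLoc (f : MvPolynomial (Fin n) K) (k : ℕ) :
    MvPolynomial (Fin n) K →ₗ[K] Localization.Away f :=
  (LinearMap.mulLeft K
      (Ring.inverse (algebraMap (MvPolynomial (Fin n) K) (Localization.Away f) (f ^ (k + 1))))).comp
    ((Algebra.linearMap (MvPolynomial (Fin n) K) (Localization.Away f)).restrictScalars K)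

/-- `F_k`, the `K`-subspace of `A_f` of all `a/f^(k+1)` with `totalDegree a ≤ (d+1)k`. -/
def F (f : MvPolynomial (Fin n) K) (k : ℕ) : Submodule K (Localization.Away f) :=
  Submodule.map (toLoc K n f k)
    (MvPolynomial.restrictTotalDegree (Fin n) K ((f.totalDegree + 1) * k))

theorem totalDegree_pderiv_le' (a : MvPolynomial (Fin n) K) (i : Fin n) :
    (MvPolynomial.pderiv i a).totalDegree ≤ a.totalDegree := by
  classical
  conv_lhs => rw [a.as_sum, map_sum]
  refine MvPolynomial.totalDegree_finsetSum_le ?_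
  intro s hs
  rw [MvPolynomial.pderiv_monomial]
  refine (MvPolynomial.totalDegree_monomial_le _ _).trans ?_
  refine le_trans ?_ (MvPolynomial.le_totalDegree hs)
  have h : s - Finsupp.single i 1 ≤ s := tsub_le_self
  have := Finsupp.degree_mono h
  exact this

theorem mem_F_iff (f : MvPolynomial (Fin n) K) (k : ℕ) (y : Localization.Away f) :
    y ∈ F K n f k ↔ ∃ a : MvPolynomial (Fin n) K,
      a.totalDegree ≤ (f.totalDegree + 1) * k ∧
      y * algebraMap (MvPolynomial (Fin n) K) (Localization.Away f) f ^ (k + 1) =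
        algebraMap (MvPolynomial (Fin n) K) (Localization.Away f) a := by
  have hu : IsUnit (algebraMap (MvPolynomial (Fin n) K) (Localization.Away f) f ^ (k + 1)) :=
    (IsLocalization.Away.algebraMap_isUnit f).pow _
  have key : ∀ a, toLoc K n f k a =
      Ring.inverse (algebraMap (MvPolynomial (Fin n) K) (Localization.Away f) f ^ (k + 1)) *
        algebraMap (MvPolynomial (Fin n) K) (Localization.Away f) a := by
    intro a
    rw [← map_pow]
    rfl
  unfold F
  rw [Submodule.mem_map]
  refine exists_congr fun a => ?_
  rw [MvPolynomial.mem_restrictTotalDegree, key]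
  refine and_congr_right fun _ => ?_
  constructor
  · rintro rfl
    rw [mul_right_comm, Ring.inverse_mul_cancel _ hu, one_mul]
  · intro h
    rw [← h, mul_left_comm, Ring.inverse_mul_cancel _ hu, mul_one]

/-- multiplication by `x_i` and the derivation `∂_i` (the unique extension
to `A_f` of `∂/∂x_i`) map `F_k` into `F_{k+1}`. -/
theorem stmt10 [CharZero K] (hn : 1 ≤ n)
    (f : MvPolynomial (Fin n) K) (hf : 1 ≤ f.totalDegree)
    (D : Fin n → Derivation K (Localization.Away f) (Localization.Away f))
    (hD : ∀ i (a : MvPolynomial (Fin n) K),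
      D i (algebraMap (MvPolynomial (Fin n) K) (Localization.Away f) a) =
        algebraMap (MvPolynomial (Fin n) K) (Localization.Away f) (MvPolynomial.pderiv i a)) :
    ∀ (k : ℕ) (i : Fin n), ∀ y ∈ F K n f k,
      (algebraMap (MvPolynomial (Fin n) K) (Localization.Away f) (MvPolynomial.X i)) * y ∈
          F K n f (k + 1) ∧
        D i y ∈ F K n f (k + 1) := by
  intro k i y hy
  obtain ⟨a, ha, hya⟩ := (mem_F_iff K n f k y).1 hy
  constructor
  · refine (mem_F_iff K n f (k + 1) _).2 ⟨MvPolynomial.X i * a * f, ?_, ?_⟩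
    · refine (MvPolynomial.totalDegree_mul _ _).trans ?_
      have h1 := MvPolynomial.totalDegree_mul (MvPolynomial.X i) a
      rw [MvPolynomial.totalDegree_X] at h1
      rw [mul_add]
      omega
    · rw [map_mul, map_mul, ← hya]
      ring
  · refine (mem_F_iff K n f (k + 1) _).2
      ⟨MvPolynomial.pderiv i a * f - (k + 1 : ℕ) • (a * MvPolynomial.pderiv i f), ?_, ?_⟩
    · refine (MvPolynomial.totalDegree_sub _ _).trans (max_le ?_ ?_)
      · refine (MvPolynomial.totalDegree_mul _ _).trans ?_
        have h1 := totalDegree_pderiv_le' K n a i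
        rw [mul_add]
        omega
      · refine (MvPolynomial.totalDegree_smul_le _ _).trans ?_
        refine (MvPolynomial.totalDegree_mul _ _).trans ?_
        have h1 := totalDegree_pderiv_le' K n f i
        rw [mul_add]
        omega
    · have h := congrArg (D i) hya
      rw [Derivation.leibniz, Derivation.leibniz_pow, hD, hD, Nat.add_sub_cancel] at h
      simp only [smul_eq_mul, nsmul_eq_mul] at h
      rw [map_sub, map_nsmul, map_mul, map_mul, ← hya, ← h, nsmul_eq_mul]
      ring

end Stmt10
end
end

section
/- Let K be a field of characteristic zero, A = K[x₁,…,xₙ], f ∈ A non-constant, and V = Localization.Away f. Let W = V[s] be the polynomial ring over V in a variable s, with twisted derivation operators ∂̃_i : W → W defined K[s]-linearly by ∂̃_i(a·s^m) = (∂_i a)·s^m + (f_i/f)·a·s^{m+1} for a ∈ V, and let 𝒟_s ⊆ End_K(W) be the K-subalgebra generated by multiplication by x₁,…,xₙ, multiplication by s, and ∂̃_1,…,∂̃_n. Suppose b ∈ K[s] is nonzero and there exists P ∈ 𝒟_s with P(f·1) = b(s)·1 in W (the Bernstein functional equation P(s)f^{s+1} = b(s)f^s). Let λ ∈ K satisfy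 b(λ−k) ≠ 0 for every integer k ≥ 1. Then the smallest K-subspace of V containing 1, stable under multiplication by each x_i and under each twisted operator ∂_i^{(λ)} := ∂_i + λ·(f_i/f) (a ↦ ∂_i a + λ(f_i/f)a), is all of V. -/
open Polynomial

set_option synthInstance.maxHeartbeats 4000000
set_option maxHeartbeats 4000000
set_option maxSynthPendingDepth 3

noncomputable section

namespace Stmt11

variable (K : Type) [Field K] (n : ℕ)

/-- `V = K[x,f⁻¹]`. -/
abbrev V (f : MvPolynomial (Fin n) K) := Localization.Away f

/-- `W = V[s]`, realizing `K[x,f⁻¹,s]·f^s` (with `f^s ↔ 1`). -/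
abbrev W (f : MvPolynomial (Fin n) K) := Polynomial (V K n f)

/-- `f_i/f ∈ V`. -/
def c (f : MvPolynomial (Fin n) K) (i : Fin n) : V K n f :=
  algebraMap (MvPolynomial (Fin n) K) (V K n f) (MvPolynomial.pderiv i f) *
    Ring.inverse (algebraMap (MvPolynomial (Fin n) K) (V K n f) f)

/-- with `𝒟_s ⊆ End_K(W)` generated by multiplication by `x₁,…,xₙ`,
multiplication by `s` and the twisted derivations `∂̃_i` (so `𝒟_s` models `D_X[s]`),
if `P(f·1) = b(s)·1` for some `P ∈ 𝒟_s` and some nonzero `b ∈ K[s]`, and if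
`b(λ−k) ≠ 0` for all integers `k ≥ 1`, then the smallest `K`-subspace of `V`
containing `1` and stable under multiplication by the `x_i` and under the twisted
operators `∂_i^{(λ)} = ∂_i + λ·(f_i/f)` is all of `V` (i.e. `K[x,f⁻¹]f^λ = D_X·f^λ`). -/
theorem stmt11 [CharZero K] (hn : 1 ≤ n)
    (f : MvPolynomial (Fin n) K) (hf : 1 ≤ f.totalDegree)
    -- the unique derivation of `V` extending `pderiv i`:
    (Dx : Fin n → Derivation K (V K n f) (V K n f))
    (hDx : ∀ i (a : MvPolynomial (Fin n) K),
      Dx i (algebraMap (MvPolynomial (Fin n) K) (V K n f) a) =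
        algebraMap (MvPolynomial (Fin n) K) (V K n f) (MvPolynomial.pderiv i a))
    -- the twisted derivations `∂̃_i` on `W`, `∂̃_i(a·s^m) = (∂_i a)s^m + (f_i/f)a·s^{m+1}`:
    (Dtil : Fin n → Module.End K (W K n f))
    (hDtil : ∀ i (a : V K n f) (m : ℕ),
      Dtil i (C a * X ^ m) = C (Dx i a) * X ^ m + C (c K n f i * a) * X ^ (m + 1))
    -- the b-function hypothesis: `P(s)·f^{s+1} = b(s)·f^s` with `P ∈ 𝒟_s`, `b ≠ 0`:
    (b : Polynomial K) (hb : b ≠ 0)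
    (P : Module.End K (W K n f))
    (hP : P ∈ Algebra.adjoin K
      (((Set.range fun i : Fin n =>
            (LinearMap.mulLeft K
              (C (algebraMap (MvPolynomial (Fin n) K) (V K n f) (MvPolynomial.X i)) : W K n f)
              : Module.End K (W K n f))) ∪
          {(LinearMap.mulLeft K (X : W K n f) : Module.End K (W K n f))}) ∪
        Set.range Dtil))
    (hPf : P (C (algebraMap (MvPolynomial (Fin n) K) (V K n f) f)) =
      b.map (algebraMap K (V K n f)))
    (lam : K) (hlam : ∀ k : ℕ, 1 ≤ k → b.eval (lam - k) ≠ 0) :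
    sInf {N : Submodule K (V K n f) |
        (1 : V K n f) ∈ N ∧
        (∀ i : Fin n, ∀ v ∈ N,
          algebraMap (MvPolynomial (Fin n) K) (V K n f) (MvPolynomial.X i) * v ∈ N) ∧
        (∀ i : Fin n, ∀ v ∈ N, Dx i v + lam • (c K n f i * v) ∈ N)} = ⊤ := by
  have hu : IsUnit (algebraMap (MvPolynomial (Fin n) K) (V K n f) f) :=
    IsLocalization.Away.algebraMap_isUnit f
  obtain ⟨u, hu⟩ := hu
  obtain ⟨F, hF⟩ : ∃ F, F = algebraMap (MvPolynomial (Fin n) K) (V K n f) f := ⟨_, rfl⟩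
  obtain ⟨g, hg⟩ : ∃ g, g = Ring.inverse (algebraMap (MvPolynomial (Fin n) K) (V K n f) f) :=
    ⟨_, rfl⟩
  have hFg : F * g = 1 := by
    rw [hF, hg, ← hu]; exact Ring.mul_inverse_cancel _ u.isUnit
  have hc : ∀ i, c K n f i = Dx i F * g := by
    intro i; rw [c, hF, hDx, hg]
  have hdg : ∀ i, Dx i g = - (c K n f i * g) := by
    intro i
    have h := congrArg (Dx i) hFg
    rw [Derivation.leibniz, Derivation.map_one_eq_zero, smul_eq_mul, smul_eq_mul] at h
    rw [hc]
    linear_combination g * h - (Dx i g) * hFg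
  have hdgk : ∀ i (k : ℕ), Dx i (g ^ k) = - ((k : V K n f) * (c K n f i * g ^ k)) := by
    intro i k
    induction k with
    | zero => simp
    | succ k ih =>
      rw [pow_succ, Derivation.leibniz, ih, hdg, smul_eq_mul, smul_eq_mul]
      push_cast
      ring
  rw [eq_top_iff]
  refine le_sInf ?_
  rintro N ⟨h1, hX, hD⟩
  have hA : ∀ (p : MvPolynomial (Fin n) K) (v : V K n f), v ∈ N →
      algebraMap (MvPolynomial (Fin n) K) (V K n f) p * v ∈ N := by
    intro p
    induction p using MvPolynomial.induction_on with
    | C a =>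
      intro v hv
      have : algebraMap (MvPolynomial (Fin n) K) (V K n f) (MvPolynomial.C a) * v = a • v := by
        rw [Algebra.smul_def, IsScalarTower.algebraMap_apply K (MvPolynomial (Fin n) K) (V K n f)]
        rfl
      rw [this]
      exact N.smul_mem _ hv
    | add p q hp hq =>
      intro v hv
      rw [map_add, add_mul]
      exact N.add_mem (hp v hv) (hq v hv)
    | mul_X p i hp =>
      intro v hv
      rw [map_mul, mul_assoc]
      exact hp _ (hX i v hv)
  have hgk : ∀ k : ℕ, g ^ k ∈ N := by
    intro k
    induction k with
    | zero => simpa using h1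
    | succ k ih =>
      obtain ⟨μ, hμ⟩ : ∃ μ : K, μ = lam - ((k + 1 : ℕ) : K) := ⟨_, rfl⟩
      obtain ⟨m, hm⟩ : ∃ m : V K n f, m = algebraMap K (V K n f) μ := ⟨_, rfl⟩
      have hm' : m = algebraMap K (V K n f) lam - ((k + 1 : ℕ) : V K n f) := by
        rw [hm, hμ, map_sub, map_natCast]
      have key : ∀ i (w : W K n f), g ^ (k + 1) * (Dtil i w).eval m =
          Dx i (g ^ (k + 1) * w.eval m) + lam • (c K n f i * (g ^ (k + 1) * w.eval m)) := by
        intro i w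
        induction w using Polynomial.induction_on' with
        | add p q hp hq =>
          simp only [map_add, eval_add, mul_add, smul_add] at hp hq ⊢
          rw [hp, hq]
          ring
        | monomial j a =>
          have hmj : Dx i (m ^ j) = 0 := by
            rw [hm, ← map_pow]; exact Derivation.map_algebraMap _ _
          rw [← C_mul_X_pow_eq_monomial, hDtil]
          simp only [eval_add, eval_mul, eval_C, eval_pow, eval_X]
          rw [Derivation.leibniz, Derivation.leibniz, hmj, hdgk, Algebra.smul_def lam]
          simp only [smul_eq_mul]
          have h2 : algebraMap K (V K n f) lam = m + ((k + 1 : ℕ) : V K n f) := by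
            rw [hm']; ring
          rw [h2]
          ring
      have hst : ∀ w : W K n f, g ^ (k + 1) * w.eval m ∈ N →
          g ^ (k + 1) * (P w).eval m ∈ N := by
        clear hPf
        induction hP using Algebra.adjoin_induction with
        | mem Q hQ =>
          intro w hw
          rcases hQ with (⟨i, rfl⟩ | hQ) | ⟨i, rfl⟩
          · have := hX i _ hw
            simp only [LinearMap.mulLeft_apply, eval_mul, eval_C]
            rwa [mul_left_comm]
          · rw [Set.mem_singleton_iff] at hQ
            subst hQ
            have := N.smul_mem μ hw
            rw [Algebra.smul_def, ← hm] at this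
            simp only [LinearMap.mulLeft_apply, eval_mul, eval_X]
            rwa [mul_left_comm]
          · rw [key]
            exact hD i _ hw
        | algebraMap r =>
          intro w hw
          have := N.smul_mem r hw
          rw [Module.algebraMap_end_apply, eval_smul, mul_smul_comm]
          exact this
        | add Q R _ _ hQ hR =>
          intro w hw
          rw [LinearMap.add_apply, eval_add, mul_add]
          exact N.add_mem (hQ w hw) (hR w hw)
        | mul Q R _ _ hQ hR =>
          intro w hw
          exact hQ _ (hR w hw)
      have h3 := hst (C F) (by
        rw [eval_C, pow_succ, mul_assoc, mul_comm g F, hFg, mul_one]; exact ih)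
      rw [hF, hPf, hm, eval_map_algebraMap, aeval_algebraMap_apply, mul_comm, ← Algebra.smul_def]
        at h3
      refine (N.smul_mem_iff ?_).1 h3
      have := hlam (k + 1) (by omega)
      rwa [hμ, coe_aeval_eq_eval]
  intro v _
  obtain ⟨k, a, hka⟩ := IsLocalization.Away.surj f v
  have : v = algebraMap (MvPolynomial (Fin n) K) (V K n f) a * g ^ k := by
    rw [← hka, ← hF, mul_assoc, ← mul_pow, hFg, one_pow, mul_one]
  rw [this]
  exact hA a _ (hgk k)

end Stmt11
end
end

section
/- Let K be a field of characteristic zero, A = K[x₁,…,xₙ], f ∈ A non-constant, V = Localization.Away f, W = V[s] with the twisted derivations ∂̃_i(a·s^m) = (∂_i a)·s^m + (f_i/f)·a·s^{m+1}, and 𝒟_s ⊆ End_K(W) the K-subalgebra generated by multiplication by x₁,…,xₙ, multiplication by s, and the ∂̃_i. Let N be the smallest K-subspace of W containing 1 and stable under all operators in 𝒟_s (realizing M(u,f,s) = D_X[s]f^s). Suppose b ∈ K[s] is nonzero, some P ∈ 𝒟_s satisfies P(f·1) = b(s)·1, and λ ∈ K satisfies b(λ−k) ≠ 0 for every integer k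 ≥ 1. Let ρ_λ : W → V be evaluation of polynomials at s = λ (i.e. p ↦ p.eval((algebraMap K V) λ)). Then N ∩ ker(ρ_λ) = (s−λ)·N. -/
open Polynomial

set_option synthInstance.maxHeartbeats 4000000
set_option maxHeartbeats 4000000
set_option maxSynthPendingDepth 3

noncomputable section

namespace Stmt12

variable (K : Type) [Field K] (n : ℕ)

/-- `V = K[x,f⁻¹]`. -/
abbrev V (f : MvPolynomial (Fin n) K) := Localization.Away f

/-- `W = V[s]`, realizing `K[x,f⁻¹,s]·f^s` (with `f^s ↔ 1`). -/
abbrev W (f : MvPolynomial (Fin n) K) := Polynomial (V K n f)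

/-- `f_i/f ∈ V`. -/
def c (f : MvPolynomial (Fin n) K) (i : Fin n) : V K n f :=
  algebraMap (MvPolynomial (Fin n) K) (V K n f) (MvPolynomial.pderiv i f) *
    Ring.inverse (algebraMap (MvPolynomial (Fin n) K) (V K n f) f)

/-- `𝒟_s ⊆ End_K(W)`: the `K`-subalgebra generated by multiplication by `x₁,…,xₙ`,
multiplication by `s`, and the twisted derivations `∂̃_i`; it models `D_X[s]`. -/
def Ds (f : MvPolynomial (Fin n) K) (Dtil : Fin n → Module.End K (W K n f)) :
    Subalgebra K (Module.End K (W K n f)) :=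
  Algebra.adjoin K
    (((Set.range fun i : Fin n =>
          (LinearMap.mulLeft K
            (C (algebraMap (MvPolynomial (Fin n) K) (V K n f) (MvPolynomial.X i)) : W K n f)
            : Module.End K (W K n f))) ∪
        {(LinearMap.mulLeft K (X : W K n f) : Module.End K (W K n f))}) ∪
      Set.range Dtil)

/-- `N = D_X[s]·f^s ⊆ W`: the smallest `K`-subspace of `W` containing `1` and stable
under all operators of `𝒟_s`; it realizes `M(u,f,s) = D_X[s](u ⊗ f^s)` for `M = K[x]`. -/
def NN (f : MvPolynomial (Fin n) K) (Dtil : Fin n → Module.End K (W K n f)) :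
    Submodule K (W K n f) :=
  sInf {N : Submodule K (W K n f) |
    (1 : W K n f) ∈ N ∧ ∀ P ∈ Ds K n f Dtil, ∀ w ∈ N, P w ∈ N}


/-! Abstract setting -/

section Abstract

variable {K V : Type} [Field K] [CommRing V] [Algebra K V] {n : ℕ}

/-- abstract version of `Ds` -/
def aDs (x : Fin n → V) (Dtil : Fin n → Module.End K V[X]) :
    Subalgebra K (Module.End K V[X]) :=
  Algebra.adjoin K
    (((Set.range fun i : Fin n =>
          (LinearMap.mulLeft K (C (x i) : V[X]) : Module.End K V[X])) ∪
        {(LinearMap.mulLeft K (X : V[X]) : Module.End K V[X])}) ∪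
      Set.range Dtil)

/-- the cyclic module generated by `w` -/
def aS (x : Fin n → V) (Dtil : Fin n → Module.End K V[X]) (w : V[X]) : Submodule K V[X] :=
  (aDs x Dtil).toSubmodule.map (LinearMap.applyₗ w)

theorem mem_aS (x : Fin n → V) (Dtil : Fin n → Module.End K V[X]) (w v : V[X]) :
    v ∈ aS x Dtil w ↔ ∃ Q ∈ aDs x Dtil, Q w = v := by
  simp [aS, Submodule.mem_map]

/-- the shift -/
def aT (K : Type) {V : Type} [Field K] [CommRing V] [Algebra K V] (g : V) :
    Module.End K V[X] where
  toFun w := C g * w.comp (X - 1)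
  map_add' := by intros; simp [mul_add]
  map_smul' := by intros; simp [smul_comp]

theorem aT_apply (g : V) (w : V[X]) : aT K g w = C g * w.comp (X - 1) := rfl

theorem mulLeft_map_mem (x : Fin n → V) (Dtil : Fin n → Module.End K V[X]) (q : K[X]) :
    LinearMap.mulLeft K (q.map (algebraMap K V)) ∈ aDs x Dtil := by
  have hX : (LinearMap.mulLeft K (X : V[X]) : Module.End K V[X]) ∈ aDs x Dtil :=
    Algebra.subset_adjoin (Or.inl (Or.inr rfl))
  have : LinearMap.mulLeft K (q.map (algebraMap K V))
      = aeval (LinearMap.mulLeft K (X : V[X]) : Module.End K V[X]) q := by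
    have h := Polynomial.aeval_algHom_apply (Algebra.lmul K V[X]) X q
    have h2 : aeval (X : V[X]) q = q.map (algebraMap K V) := by
      induction q using Polynomial.induction_on' with
      | add p q hp hq =>
        rw [map_add, Polynomial.map_add, hp (Polynomial.aeval_algHom_apply _ _ _),
          hq (Polynomial.aeval_algHom_apply _ _ _)]
      | monomial m r =>
        rw [aeval_monomial, Polynomial.map_monomial, ← C_mul_X_pow_eq_monomial]
        rfl
    rw [h2] at h
    exact h.symm
  rw [this]
  exact Algebra.adjoin_le (Set.singleton_subset_iff.mpr hX)
    (aeval_mem_adjoin_singleton K _)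

theorem mulLeft_C_mem (x : Fin n → V) (Dtil : Fin n → Module.End K V[X]) (a : V)
    (ha : a ∈ Algebra.adjoin K (Set.range x)) :
    LinearMap.mulLeft K (C a : V[X]) ∈ aDs x Dtil := by
  induction ha using Algebra.adjoin_induction with
  | mem y hy =>
    obtain ⟨i, rfl⟩ := hy
    exact Algebra.subset_adjoin (Or.inl (Or.inl ⟨i, rfl⟩))
  | algebraMap r =>
    have := mulLeft_map_mem x Dtil (C r)
    rwa [Polynomial.map_C] at this
  | add a b _ _ ha hb =>
    have := add_mem ha hb
    convert this using 1
    ext; simp [add_mul]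
  | mul a b _ _ ha hb =>
    have := mul_mem ha hb
    convert this using 1
    ext; simp

theorem end_ext {S T : Module.End K V[X]} (h : ∀ a m, S (C a * X ^ m) = T (C a * X ^ m)) :
    S = T := by
  refine LinearMap.ext fun w => ?_
  induction w using Polynomial.induction_on' with
  | add p q hp hq => simp [hp, hq]
  | monomial m a => rw [← C_mul_X_pow_eq_monomial]; exact h a m

variable (x : Fin n → V) (F g : V) (hFg : F * g = 1)
  (Dx : Fin n → Derivation K V V) (Dtil : Fin n → Module.End K V[X])
  (hDtil : ∀ i (a : V) (m : ℕ),
      Dtil i (C a * X ^ m) = C (Dx i a) * X ^ m + C (Dx i F * g * a) * X ^ (m + 1))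

include hDtil in
theorem Q_comm_X (Q : Module.End K V[X]) (hQ : Q ∈ aDs x Dtil) (w : V[X]) :
    Q (X * w) = X * Q w := by
  unfold aDs at hQ
  induction hQ using Algebra.adjoin_induction generalizing w with
  | mem y hy =>
    rcases hy with (⟨i, rfl⟩ | rfl) | ⟨i, rfl⟩
    · simp; ring
    · simp
    · have : Dtil i * LinearMap.mulLeft K (X : V[X]) = LinearMap.mulLeft K (X : V[X]) * Dtil i := by
        apply end_ext
        intro a m
        have : (X : V[X]) * (C a * X ^ m) = C a * X ^ (m + 1) := by ring
        simp only [Module.End.mul_apply, LinearMap.mulLeft_apply, this, hDtil]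
        ring
      exact LinearMap.congr_fun this w
  | algebraMap r => simp [Algebra.algebraMap_eq_smul_one]
  | add a b _ _ ha hb => simp [ha, hb, mul_add]
  | mul a b _ _ ha hb => simp [ha, hb]

include hDtil in
theorem Q_comm (Q : Module.End K V[X]) (hQ : Q ∈ aDs x Dtil) (q : K[X]) (w : V[X]) :
    Q (q.map (algebraMap K V) * w) = q.map (algebraMap K V) * Q w := by
  induction q using Polynomial.induction_on generalizing w with
  | C r =>
    have h : ∀ u : V[X], (C r : K[X]).map (algebraMap K V) * u = r • u := by
      intro u
      rw [Polynomial.map_C, ← Polynomial.smul_eq_C_mul, algebraMap_smul]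
    rw [h, h, map_smul]
  | add p q hp hq => simp only [Polynomial.map_add, add_mul, map_add, hp, hq]
  | monomial m r h =>
    have : ∀ u : V[X], (C r * X ^ (m + 1) : K[X]).map (algebraMap K V) * u =
      (C r * X ^ m : K[X]).map (algebraMap K V) * (X * u) := by
      intro u
      simp only [Polynomial.map_mul, Polynomial.map_pow, Polynomial.map_X]
      ring
    rw [this, this, h, Q_comm_X x F g Dx Dtil hDtil Q hQ]

include hFg in
theorem Dx_g (i : Fin n) : Dx i g = - (Dx i F * g * g) := by
  have h : Dx i (F * g) = 0 := by rw [hFg]; simp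
  rw [Derivation.leibniz] at h
  simp only [smul_eq_mul] at h
  linear_combination g * h - Dx i g * hFg

include hDtil hFg in
theorem T_comm (Q : Module.End K V[X]) (hQ : Q ∈ aDs x Dtil) :
    ∃ Q' ∈ aDs x Dtil, aT K g * Q = Q' * aT K g := by
  have hQ0 := hQ
  unfold aDs at hQ
  induction hQ using Algebra.adjoin_induction with
  | mem y hy =>
    rcases hy with (⟨i, rfl⟩ | rfl) | ⟨i, rfl⟩
    · refine ⟨_, hQ0, ?_⟩
      ext1 w
      simp [aT_apply]
      try ring
    · refine ⟨_, mulLeft_map_mem x Dtil (X - 1), ?_⟩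
      refine LinearMap.ext fun w => ?_
      simp [aT_apply]
      try ring
    · refine ⟨_, hQ0, ?_⟩
      apply end_ext
      intro a m
      have h1 : aT K g (C a * X ^ m) =
        ((X - 1 : K[X]) ^ m).map (algebraMap K V) * (C (g * a) * X ^ 0) := by
        simp [aT_apply]
        ring
      rw [Module.End.mul_apply, Module.End.mul_apply, h1,
        Q_comm x F g Dx Dtil hDtil _ hQ0, hDtil, hDtil, Derivation.leibniz,
        Dx_g F g hFg Dx]
      simp [aT_apply]
      ring
  | algebraMap r =>
    exact ⟨_, (aDs x Dtil).algebraMap_mem r, (Algebra.commutes r _).symm⟩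
  | add a b ha0 hb0 ha hb =>
    obtain ⟨a', ha, ha'⟩ := ha ha0
    obtain ⟨b', hb, hb'⟩ := hb hb0
    exact ⟨_, add_mem ha hb, by rw [mul_add, ha', hb', add_mul]⟩
  | mul a b ha0 hb0 ha hb =>
    obtain ⟨a', ha, ha'⟩ := ha ha0
    obtain ⟨b', hb, hb'⟩ := hb hb0
    exact ⟨_, mul_mem ha hb, by rw [← mul_assoc, ha', mul_assoc, hb', mul_assoc]⟩

include hDtil hFg in
theorem exists_Pk (b : K[X]) (P : Module.End K V[X]) (hP : P ∈ aDs x Dtil)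
    (hPf : P (C F) = b.map (algebraMap K V)) (k : ℕ) :
    ∃ Q ∈ aDs x Dtil, Q (C (g ^ k * F)) =
      (b.comp (X - C (k : K))).map (algebraMap K V) * C (g ^ k) := by
  induction k with
  | zero => exact ⟨P, hP, by simpa using hPf⟩
  | succ k ih =>
    obtain ⟨Q, hQ, h⟩ := ih
    obtain ⟨Q', hQ', h'⟩ := T_comm x F g hFg Dx Dtil hDtil Q hQ
    refine ⟨Q', hQ', ?_⟩
    have h2 := LinearMap.congr_fun h' (C (g ^ k * F))
    have h3 : aT K g (C (g ^ k * F)) = C (g ^ (k + 1) * F) := by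
      simp [aT_apply]; ring
    rw [Module.End.mul_apply, Module.End.mul_apply, h, h3] at h2
    rw [← h2]
    have e : (b.comp (X - C ((k + 1 : ℕ) : K))) = (b.comp (X - C (k : K))).comp (X - 1) := by
      rw [comp_assoc]; congr 1; simp; ring
    rw [e, aT_apply, mul_comp, Polynomial.map_comp _ _ (X - 1)]
    simp
    ring

include hDtil hFg in
theorem descent (hF : F ∈ Algebra.adjoin K (Set.range x))
    (b : K[X]) (P : Module.End K V[X]) (hP : P ∈ aDs x Dtil)
    (hPf : P (C F) = b.map (algebraMap K V)) (lam : K)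
    (hlam : ∀ k : ℕ, 1 ≤ k → b.eval (lam - k) ≠ 0) (v : V[X])
    (hw : (X - C (algebraMap K V lam)) * v ∈ aS x Dtil 1) (k : ℕ)
    (hv : v ∈ aS x Dtil (C (g ^ k))) : v ∈ aS x Dtil 1 := by
  have hmono : ∀ k, aS x Dtil (C (g ^ k)) ≤ aS x Dtil (C (g ^ (k + 1))) := by
    intro k u hu
    rw [mem_aS] at hu ⊢
    obtain ⟨Q, hQ, rfl⟩ := hu
    refine ⟨Q * LinearMap.mulLeft K (C F), mul_mem hQ (mulLeft_C_mem x Dtil F hF), ?_⟩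
    rw [Module.End.mul_apply, LinearMap.mulLeft_apply, ← C_mul, pow_succ', ← mul_assoc, hFg,
      one_mul]
  have hle : ∀ k, aS x Dtil 1 ≤ aS x Dtil (C (g ^ k)) := by
    intro k
    induction k with
    | zero => simp
    | succ k ih => exact ih.trans (hmono k)
  have hstab : ∀ (k : ℕ) (q : K[X]) (u : V[X]), u ∈ aS x Dtil (C (g ^ k)) →
      q.map (algebraMap K V) * u ∈ aS x Dtil (C (g ^ k)) := by
    intro k q u hu
    rw [mem_aS] at hu ⊢
    obtain ⟨Q, hQ, rfl⟩ := hu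
    exact ⟨_, mul_mem (mulLeft_map_mem x Dtil q) hQ, rfl⟩
  induction k with
  | zero => simpa using hv
  | succ k ih =>
    apply ih
    set β : K[X] := b.comp (X - C ((k + 1 : ℕ) : K)) with hβ
    have hβv : β.map (algebraMap K V) * v ∈ aS x Dtil (C (g ^ k)) := by
      obtain ⟨R, hR, hR'⟩ := exists_Pk x F g hFg Dx Dtil hDtil b P hP hPf (k + 1)
      rw [mem_aS] at hv ⊢
      obtain ⟨Q, hQ, rfl⟩ := hv
      refine ⟨Q * R, mul_mem hQ hR, ?_⟩
      rw [← Q_comm x F g Dx Dtil hDtil Q hQ, ← hR', Module.End.mul_apply]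
      congr 3
      linear_combination (- g ^ k) * hFg
    have hne : β.eval lam ≠ 0 := by
      have := hlam (k + 1) (by omega)
      simpa [hβ] using this
    obtain ⟨q, hq⟩ := Polynomial.X_sub_C_dvd_sub_C_eval (a := lam) (p := β)
    have h2 := hstab k q _ (hle k hw)
    have h3 : v = (β.eval lam)⁻¹ • (β.map (algebraMap K V) * v -
        q.map (algebraMap K V) * ((X - C (algebraMap K V lam)) * v)) := by
      have h4 : β = (X - C lam) * q + C (β.eval lam) := by rw [← hq]; ring
      have h5 : β.map (algebraMap K V) * v -
        q.map (algebraMap K V) * ((X - C (algebraMap K V lam)) * v) = (β.eval lam) • v := by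
        have h6 := congrArg (Polynomial.map (algebraMap K V)) h4
        simp only [Polynomial.map_add, Polynomial.map_mul, Polynomial.map_sub,
          Polynomial.map_X, Polynomial.map_C] at h6
        rw [← algebraMap_smul V (β.eval lam) v, Polynomial.smul_eq_C_mul, h6]
        ring
      rw [h5, smul_smul, inv_mul_cancel₀ hne, one_smul]
    rw [h3]
    exact Submodule.smul_mem _ _ (sub_mem hβv h2)

include hFg in
theorem exhaust (hF : F ∈ Algebra.adjoin K (Set.range x))
    (hx : ∀ v : V, ∃ k : ℕ, v * F ^ k ∈ Algebra.adjoin K (Set.range x)) (v : V[X]) :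
    ∃ k : ℕ, v ∈ aS x Dtil (C (g ^ k)) := by
  have hpow : ∀ k : ℕ, F ^ k * g ^ k = 1 := fun k => by rw [← mul_pow, hFg, one_pow]
  have hle : ∀ k l, aS x Dtil (C (g ^ k)) ≤ aS x Dtil (C (g ^ (k + l))) := by
    intro k l u hu
    rw [mem_aS] at hu ⊢
    obtain ⟨Q, hQ, rfl⟩ := hu
    refine ⟨Q * LinearMap.mulLeft K (C (F ^ l)),
      mul_mem hQ (mulLeft_C_mem x Dtil _ (pow_mem hF l)), ?_⟩
    rw [Module.End.mul_apply, LinearMap.mulLeft_apply, ← C_mul]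
    congr 2
    linear_combination g ^ k * hpow l
  induction v using Polynomial.induction_on' with
  | add p q hp hq =>
    obtain ⟨k, hk⟩ := hp
    obtain ⟨l, hl⟩ := hq
    refine ⟨k + l, add_mem (hle k l hk) ?_⟩
    rw [add_comm k l]
    exact hle l k hl
  | monomial m a =>
    obtain ⟨k, hk⟩ := hx a
    refine ⟨k, ?_⟩
    rw [mem_aS]
    refine ⟨_, mul_mem (mulLeft_map_mem x Dtil (X ^ m)) (mulLeft_C_mem x Dtil _ hk), ?_⟩
    rw [Module.End.mul_apply, LinearMap.mulLeft_apply, LinearMap.mulLeft_apply, ← C_mul,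
      ← C_mul_X_pow_eq_monomial, mul_assoc, hpow, mul_one]
    rw [Polynomial.map_pow, Polynomial.map_X, mul_comm]

include hDtil hFg in
theorem abstract_main (hF : F ∈ Algebra.adjoin K (Set.range x))
    (hx : ∀ v : V, ∃ k : ℕ, v * F ^ k ∈ Algebra.adjoin K (Set.range x))
    (b : K[X]) (P : Module.End K V[X]) (hP : P ∈ aDs x Dtil)
    (hPf : P (C F) = b.map (algebraMap K V)) (lam : K)
    (hlam : ∀ k : ℕ, 1 ≤ k → b.eval (lam - k) ≠ 0) (w : V[X]) :
    (w ∈ aS x Dtil 1 ∧ w.eval (algebraMap K V lam) = 0) ↔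
      ∃ v ∈ aS x Dtil 1, w = (X - C (algebraMap K V lam)) * v := by
  constructor
  · rintro ⟨hw, h0⟩
    obtain ⟨v, rfl⟩ := Polynomial.dvd_iff_isRoot.mpr h0
    obtain ⟨k, hk⟩ := exhaust x F g hFg Dtil hF hx v
    exact ⟨v, descent x F g hFg Dx Dtil hDtil hF b P hP hPf lam hlam v hw k hk, rfl⟩
  · rintro ⟨v, hv, rfl⟩
    refine ⟨?_, by simp⟩
    rw [mem_aS] at hv ⊢
    obtain ⟨Q, hQ, rfl⟩ := hv
    exact ⟨_, mul_mem (mulLeft_map_mem x Dtil (X - C lam)) hQ, by simp⟩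

end Abstract

theorem NN_eq (f : MvPolynomial (Fin n) K) (Dtil : Fin n → Module.End K (W K n f)) :
    NN K n f Dtil = aS (fun i => algebraMap (MvPolynomial (Fin n) K) (V K n f)
      (MvPolynomial.X i)) Dtil 1 := by
  apply le_antisymm
  · apply sInf_le
    constructor
    · rw [mem_aS]; exact ⟨1, one_mem _, rfl⟩
    · intro P hP w hw
      rw [mem_aS] at hw ⊢
      obtain ⟨Q, hQ, rfl⟩ := hw
      exact ⟨P * Q, mul_mem hP hQ, rfl⟩
  · intro v hv
    rw [mem_aS] at hv
    obtain ⟨Q, hQ, rfl⟩ := hv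
    rw [NN, Submodule.mem_sInf]
    rintro N ⟨h1, h2⟩
    exact h2 Q hQ _ h1

theorem adjoin_range (f a : MvPolynomial (Fin n) K) :
    algebraMap (MvPolynomial (Fin n) K) (V K n f) a ∈
      Algebra.adjoin K (Set.range fun i => algebraMap (MvPolynomial (Fin n) K) (V K n f)
      (MvPolynomial.X i)) := by
  induction a using MvPolynomial.induction_on with
  | C r =>
    rw [← MvPolynomial.algebraMap_eq, ← IsScalarTower.algebraMap_apply]
    exact Subalgebra.algebraMap_mem _ r
  | add p q hp hq => rw [map_add]; exact add_mem hp hq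
  | mul_X p i hp => rw [map_mul]; exact mul_mem hp (Algebra.subset_adjoin ⟨i, rfl⟩)

/-- with `N = D_X[s]·f^s ⊆ W` and `ρ_λ : W → V` the evaluation at `s = λ`,
if `P(f·1) = b(s)·1` for some `P ∈ 𝒟_s` and `b ∈ K[s]` nonzero with `b(λ−k) ≠ 0` for all
integers `k ≥ 1`, then `N ∩ ker ρ_λ = (s−λ)·N`. -/
theorem stmt12 [CharZero K] (hn : 1 ≤ n)
    (f : MvPolynomial (Fin n) K) (hf : 1 ≤ f.totalDegree)
    (Dx : Fin n → Derivation K (V K n f) (V K n f))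
    (hDx : ∀ i (a : MvPolynomial (Fin n) K),
      Dx i (algebraMap (MvPolynomial (Fin n) K) (V K n f) a) =
        algebraMap (MvPolynomial (Fin n) K) (V K n f) (MvPolynomial.pderiv i a))
    (Dtil : Fin n → Module.End K (W K n f))
    (hDtil : ∀ i (a : V K n f) (m : ℕ),
      Dtil i (C a * X ^ m) = C (Dx i a) * X ^ m + C (c K n f i * a) * X ^ (m + 1))
    (b : Polynomial K) (hb : b ≠ 0)
    (P : Module.End K (W K n f)) (hP : P ∈ Ds K n f Dtil)
    (hPf : P (C (algebraMap (MvPolynomial (Fin n) K) (V K n f) f)) =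
      b.map (algebraMap K (V K n f)))
    (lam : K) (hlam : ∀ k : ℕ, 1 ≤ k → b.eval (lam - k) ≠ 0) :
    ∀ w : W K n f,
      (w ∈ NN K n f Dtil ∧
          Polynomial.eval (algebraMap K (V K n f) lam) w = 0) ↔
        ∃ v ∈ NN K n f Dtil,
          w = (X - C (algebraMap K (V K n f) lam)) * v := by
  have hu : IsUnit (algebraMap (MvPolynomial (Fin n) K) (V K n f) f) :=
    IsLocalization.Away.algebraMap_isUnit f
  intro w
  rw [NN_eq]
  refine abstract_main (fun i => algebraMap (MvPolynomial (Fin n) K) (V K n f)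
      (MvPolynomial.X i)) (algebraMap (MvPolynomial (Fin n) K) (V K n f) f)
      (Ring.inverse (algebraMap (MvPolynomial (Fin n) K) (V K n f) f))
      (Ring.mul_inverse_cancel _ hu) Dx Dtil ?_ (adjoin_range K n f f) ?_ b P hP hPf lam hlam w
  · intro i a m
    rw [hDtil, hDx, c]
  · intro v
    obtain ⟨k, a, h⟩ := IsLocalization.Away.surj f v
    exact ⟨k, by rw [h]; exact adjoin_range K n f a⟩

end Stmt12
end
end

section
/- Let K be a field of characteristic zero, A = K[x₁,…,xₙ], f ∈ A non-constant, V = Localization.Away f, W = V[s] with twisted derivations ∂̃_i(a·s^m) = (∂_i a)·s^m + (f_i/f)·a·s^{m+1}, and 𝒟_s ⊆ End_K(W) the K-subalgebra generated by multiplication by x₁,…,xₙ, multiplication by s, and the ∂̃_i. Let I(f) = {b ∈ K[s] : ∃ P ∈ 𝒟_s, P(f·1) = b(s)·1 in W}. Suppose b ∈ I(f) is nonzero of minimal degree among the nonzero elements of I(f) (the b-function), and λ ∈ K satisfies b(λ) = 0 and b(λ−k) ≠ 0 for every integer k ≥ 1. For v ∈ V let D⟨v⟩_λ denote the smallest K-subspace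 of V containing v and stable under multiplication by each x_i and under each ∂_i^{(λ)} := ∂_i + λ·(f_i/f). Then D⟨f⟩_λ is strictly contained in D⟨1⟩_λ; in particular V = D⟨1⟩_λ is generated by f^λ but not by f^{λ+1} = f·f^λ over D_X. -/
open Polynomial

set_option synthInstance.maxHeartbeats 4000000
set_option maxHeartbeats 4000000
set_option maxSynthPendingDepth 3

noncomputable section

namespace Stmt13

variable (K : Type) [Field K] (n : ℕ)

/-- `V = K[x,f⁻¹]`. -/
abbrev V (f : MvPolynomial (Fin n) K) := Localization.Away f

/-- `W = V[s]`, realizing `K[x,f⁻¹,s]·f^s` (with `f^s ↔ 1`). -/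
abbrev W (f : MvPolynomial (Fin n) K) := Polynomial (V K n f)

/-- `f_i/f ∈ V`. -/
def c (f : MvPolynomial (Fin n) K) (i : Fin n) : V K n f :=
  algebraMap (MvPolynomial (Fin n) K) (V K n f) (MvPolynomial.pderiv i f) *
    Ring.inverse (algebraMap (MvPolynomial (Fin n) K) (V K n f) f)

/-- `𝒟_s ⊆ End_K(W)`: the `K`-subalgebra generated by multiplication by `x₁,…,xₙ`,
multiplication by `s`, and the twisted derivations `∂̃_i`; it models `D_X[s]`. -/
def Ds (f : MvPolynomial (Fin n) K) (Dtil : Fin n → Module.End K (W K n f)) :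
    Subalgebra K (Module.End K (W K n f)) :=
  Algebra.adjoin K
    (((Set.range fun i : Fin n =>
          (LinearMap.mulLeft K
            (C (algebraMap (MvPolynomial (Fin n) K) (V K n f) (MvPolynomial.X i)) : W K n f)
            : Module.End K (W K n f))) ∪
        {(LinearMap.mulLeft K (X : W K n f) : Module.End K (W K n f))}) ∪
      Set.range Dtil)

/-- `N = D_X[s]·f^s ⊆ W`: the smallest `K`-subspace of `W` containing `1` and stable
under all operators of `𝒟_s`; it realizes `M(u,f,s) = D_X[s](u ⊗ f^s)` for `M = K[x]`. -/
def NN (f : MvPolynomial (Fin n) K) (Dtil : Fin n → Module.End K (W K n f)) :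
    Submodule K (W K n f) :=
  sInf {N : Submodule K (W K n f) |
    (1 : W K n f) ∈ N ∧ ∀ P ∈ Ds K n f Dtil, ∀ w ∈ N, P w ∈ N}


/-- `D⟨v⟩_λ`: the smallest `K`-subspace of `V` containing `v` and stable under
multiplication by the `x_i` and under the twisted operators
`∂_i^{(λ)} = ∂_i + λ·(f_i/f)`; it realizes `D_X·(v⊗f^λ) ⊆ K[x,f⁻¹]f^λ`. -/
def Dgen (f : MvPolynomial (Fin n) K)
    (Dx : Fin n → Derivation K (V K n f) (V K n f)) (lam : K) (v : V K n f) :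
    Submodule K (V K n f) :=
  sInf {N : Submodule K (V K n f) |
    v ∈ N ∧
    (∀ i : Fin n, ∀ u ∈ N,
      algebraMap (MvPolynomial (Fin n) K) (V K n f) (MvPolynomial.X i) * u ∈ N) ∧
    (∀ i : Fin n, ∀ u ∈ N, Dx i u + lam • (c K n f i * u) ∈ N)}

/-- A `K`-subspace of `W` stable under the generators of `𝒟_s`. -/
structure Stable (f : MvPolynomial (Fin n) K) (Dtil : Fin n → Module.End K (W K n f))
    (N : Submodule K (W K n f)) : Prop where
  x : ∀ i, ∀ w ∈ N,
    (C (algebraMap (MvPolynomial (Fin n) K) (V K n f) (MvPolynomial.X i)) : W K n f) * w ∈ N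
  s : ∀ w ∈ N, (X : W K n f) * w ∈ N
  d : ∀ i, ∀ w ∈ N, Dtil i w ∈ N

/-- The `𝒟_s`-submodule generated by `v`. -/
def Orb (f : MvPolynomial (Fin n) K) (Dtil : Fin n → Module.End K (W K n f)) (v : W K n f) :
    Submodule K (W K n f) :=
  (Subalgebra.toSubmodule (Ds K n f Dtil)).map (LinearMap.applyₗ v)

variable {K n}

lemma mem_Orb {f : MvPolynomial (Fin n) K} {Dtil : Fin n → Module.End K (W K n f)}
    {v w : W K n f} : w ∈ Orb K n f Dtil v ↔ ∃ P ∈ Ds K n f Dtil, P v = w := by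
  simp only [Orb, Submodule.mem_map, Subalgebra.mem_toSubmodule, LinearMap.applyₗ_apply_apply]

lemma self_mem_Orb {f : MvPolynomial (Fin n) K} {Dtil : Fin n → Module.End K (W K n f)}
    (v : W K n f) : v ∈ Orb K n f Dtil v :=
  mem_Orb.2 ⟨1, one_mem _, rfl⟩

lemma stable_Orb {f : MvPolynomial (Fin n) K} {Dtil : Fin n → Module.End K (W K n f)}
    (v : W K n f) : Stable K n f Dtil (Orb K n f Dtil v) := by
  refine ⟨?_, ?_, ?_⟩
  · intro i w hw
    obtain ⟨P, hP, rfl⟩ := mem_Orb.1 hw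
    exact mem_Orb.2 ⟨_, mul_mem (Algebra.subset_adjoin (Or.inl (Or.inl ⟨i, rfl⟩))) hP, rfl⟩
  · intro w hw
    obtain ⟨P, hP, rfl⟩ := mem_Orb.1 hw
    exact mem_Orb.2 ⟨_, mul_mem (Algebra.subset_adjoin (Or.inl (Or.inr rfl))) hP, rfl⟩
  · intro i w hw
    obtain ⟨P, hP, rfl⟩ := mem_Orb.1 hw
    exact mem_Orb.2 ⟨_, mul_mem (Algebra.subset_adjoin (Or.inr ⟨i, rfl⟩)) hP, rfl⟩

lemma Orb_le {f : MvPolynomial (Fin n) K} {Dtil : Fin n → Module.End K (W K n f)}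
    {v : W K n f} {N : Submodule K (W K n f)} (hN : Stable K n f Dtil N) (hv : v ∈ N) :
    Orb K n f Dtil v ≤ N := by
  intro w hw
  obtain ⟨P, hP, rfl⟩ := mem_Orb.1 hw
  suffices h : ∀ w ∈ N, P w ∈ N from h v hv
  clear hw hv
  unfold Ds at hP
  induction hP using Algebra.adjoin_induction with
  | mem P h =>
    intro w hw
    rcases h with (⟨i, rfl⟩ | h) | ⟨i, rfl⟩
    · exact hN.x i w hw
    · rw [Set.mem_singleton_iff] at h
      subst h
      exact hN.s w hw
    · exact hN.d i w hw
  | algebraMap r =>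
    intro w hw
    rw [Module.algebraMap_end_apply]
    exact N.smul_mem r hw
  | add P Q _ _ hP hQ => exact fun w hw => N.add_mem (hP w hw) (hQ w hw)
  | mul P Q _ _ hP hQ => exact fun w hw => hP _ (hQ w hw)

lemma mapC {f : MvPolynomial (Fin n) K} (k : K) (w : W K n f) :
    (C k : Polynomial K).map (algebraMap K (V K n f)) * w = k • w := by
  rw [Polynomial.map_C, Algebra.smul_def]
  rfl

lemma Stable.poly {f : MvPolynomial (Fin n) K} {Dtil : Fin n → Module.End K (W K n f)}
    {N : Submodule K (W K n f)} (hN : Stable K n f Dtil N) (q : Polynomial K) :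
    ∀ w ∈ N, q.map (algebraMap K (V K n f)) * w ∈ N := by
  induction q using Polynomial.induction_on with
  | C a => intro w hw; rw [mapC]; exact N.smul_mem _ hw
  | add p q hp hq =>
    intro w hw
    rw [Polynomial.map_add, add_mul]
    exact N.add_mem (hp w hw) (hq w hw)
  | monomial m a h =>
    intro w hw
    have := h _ (hN.s w hw)
    rw [pow_succ, ← mul_assoc, Polynomial.map_mul, Polynomial.map_X, mul_assoc]
    exact this

lemma Stable.coeff {f : MvPolynomial (Fin n) K} {Dtil : Fin n → Module.End K (W K n f)}
    {N : Submodule K (W K n f)} (hN : Stable K n f Dtil N) (a : MvPolynomial (Fin n) K) :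
    ∀ w ∈ N, (C (algebraMap (MvPolynomial (Fin n) K) (V K n f) a) : W K n f) * w ∈ N := by
  induction a using MvPolynomial.induction_on with
  | C a =>
    intro w hw
    have : (C (algebraMap (MvPolynomial (Fin n) K) (V K n f) (MvPolynomial.C a)) : W K n f)
        = (C a : Polynomial K).map (algebraMap K (V K n f)) := by
      rw [Polynomial.map_C, IsScalarTower.algebraMap_apply K (MvPolynomial (Fin n) K) (V K n f)]
      rfl
    rw [this, mapC]
    exact N.smul_mem _ hw
  | add p q hp hq =>
    intro w hw
    rw [map_add, map_add, add_mul]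
    exact N.add_mem (hp w hw) (hq w hw)
  | mul_X p i h =>
    intro w hw
    rw [map_mul, map_mul, mul_assoc]
    exact h _ (hN.x i w hw)

section Dt

variable {f : MvPolynomial (Fin n) K}
    {Dx : Fin n → Derivation K (V K n f) (V K n f)}
    {Dtil : Fin n → Module.End K (W K n f)}

lemma Dtil_C_mul
    (hDtil : ∀ i (a : V K n f) (m : ℕ),
      Dtil i (C a * X ^ m) = C (Dx i a) * X ^ m + C (c K n f i * a) * X ^ (m + 1))
    (i : Fin n) (a : V K n f) (w : W K n f) :
    Dtil i (C a * w) = C (Dx i a) * w + C a * Dtil i w := by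
  induction w using Polynomial.induction_on' with
  | add p q hp hq => rw [mul_add, map_add, hp, hq, map_add]; ring
  | monomial m r =>
    rw [← C_mul_X_pow_eq_monomial, ← mul_assoc, ← C_mul, hDtil, hDtil, Derivation.leibniz]
    simp only [smul_eq_mul, map_add, map_mul]
    ring

lemma Dtil_X_mul
    (hDtil : ∀ i (a : V K n f) (m : ℕ),
      Dtil i (C a * X ^ m) = C (Dx i a) * X ^ m + C (c K n f i * a) * X ^ (m + 1))
    (i : Fin n) (w : W K n f) :
    Dtil i (X * w) = X * Dtil i w := by
  induction w using Polynomial.induction_on' with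
  | add p q hp hq => rw [mul_add, map_add, hp, hq, map_add]; ring
  | monomial m r =>
    have : (X : W K n f) * (C r * X ^ m) = C r * X ^ (m + 1) := by ring
    rw [← C_mul_X_pow_eq_monomial, this, hDtil, hDtil]
    ring

lemma Dtil_poly_mul
    (hDtil : ∀ i (a : V K n f) (m : ℕ),
      Dtil i (C a * X ^ m) = C (Dx i a) * X ^ m + C (c K n f i * a) * X ^ (m + 1))
    (i : Fin n) (q : Polynomial K) : ∀ (w : W K n f),
    Dtil i (q.map (algebraMap K (V K n f)) * w) =
      q.map (algebraMap K (V K n f)) * Dtil i w := by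
  induction q using Polynomial.induction_on with
  | C a => intro w; rw [mapC, mapC, map_smul]
  | add p q hp hq =>
    intro w
    rw [Polynomial.map_add, add_mul, map_add, hp, hq, add_mul]
  | monomial m a h =>
    intro w
    rw [pow_succ, ← mul_assoc, Polynomial.map_mul, Polynomial.map_X, mul_assoc, h,
      Dtil_X_mul hDtil, mul_assoc]

lemma Dtil_C
    (hDtil : ∀ i (a : V K n f) (m : ℕ),
      Dtil i (C a * X ^ m) = C (Dx i a) * X ^ m + C (c K n f i * a) * X ^ (m + 1))
    (i : Fin n) (a : V K n f) :
    Dtil i (C a) = C (Dx i a) + C (c K n f i * a) * X := by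
  simpa using hDtil i a 0

/-- multiplication by `B(s)` pulls stable subspaces back to stable subspaces -/
lemma Stable.comap_poly
    (hDtil : ∀ i (a : V K n f) (m : ℕ),
      Dtil i (C a * X ^ m) = C (Dx i a) * X ^ m + C (c K n f i * a) * X ^ (m + 1))
    {N : Submodule K (W K n f)} (hN : Stable K n f Dtil N) (q : Polynomial K) :
    Stable K n f Dtil
      (N.comap (LinearMap.mulLeft K (q.map (algebraMap K (V K n f)) : W K n f))) := by
  refine ⟨?_, ?_, ?_⟩
  · intro i w hw
    rw [Submodule.mem_comap, LinearMap.mulLeft_apply] at hw ⊢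
    rw [mul_left_comm]
    exact hN.x i _ hw
  · intro w hw
    rw [Submodule.mem_comap, LinearMap.mulLeft_apply] at hw ⊢
    rw [mul_left_comm]
    exact hN.s _ hw
  · intro i w hw
    rw [Submodule.mem_comap, LinearMap.mulLeft_apply] at hw ⊢
    rw [← Dtil_poly_mul hDtil]
    exact hN.d i _ hw

variable (f) in
/-- `f⁻¹`. -/
def g : V K n f := Ring.inverse (algebraMap (MvPolynomial (Fin n) K) (V K n f) f)

lemma f_mul_g : algebraMap (MvPolynomial (Fin n) K) (V K n f) f * g f = 1 :=
  Ring.mul_inverse_cancel _ (IsLocalization.Away.algebraMap_isUnit f)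

lemma D_g
    (hDx : ∀ i (a : MvPolynomial (Fin n) K),
      Dx i (algebraMap (MvPolynomial (Fin n) K) (V K n f) a) =
        algebraMap (MvPolynomial (Fin n) K) (V K n f) (MvPolynomial.pderiv i a))
    (i : Fin n) : Dx i (g f) = - (c K n f i * g f) := by
  have h := congrArg (Dx i) (f_mul_g (f := f))
  rw [Derivation.leibniz, hDx, Derivation.map_one_eq_zero] at h
  simp only [smul_eq_mul] at h
  have h1 := f_mul_g (f := f)
  have hc : c K n f i = algebraMap (MvPolynomial (Fin n) K) (V K n f) (MvPolynomial.pderiv i f)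
    * g f := rfl
  rw [hc]
  linear_combination g f * h - Dx i (g f) * h1

lemma D_g_pow
    (hDx : ∀ i (a : MvPolynomial (Fin n) K),
      Dx i (algebraMap (MvPolynomial (Fin n) K) (V K n f) a) =
        algebraMap (MvPolynomial (Fin n) K) (V K n f) (MvPolynomial.pderiv i a))
    (i : Fin n) (j : ℕ) : Dx i (g f ^ j) = - ((j : V K n f) * c K n f i * g f ^ j) := by
  induction j with
  | zero => simp
  | succ j ih =>
    rw [pow_succ, Derivation.leibniz, ih, D_g hDx]
    simp only [smul_eq_mul]
    push_cast
    ring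

variable (f) in
/-- The shift `w(s) f^s ↦ w(s-j) f^{s-j}`. -/
def T (j : ℕ) : W K n f →ₗ[K] W K n f where
  toFun w := w.comp (X - C (j : V K n f)) * C (g f ^ j)
  map_add' p q := by rw [add_comp, add_mul]
  map_smul' r p := by
    rw [RingHom.id_apply, ← mapC, ← mapC, mul_comp, Polynomial.map_C, C_comp, mul_assoc]

lemma T_apply (j : ℕ) (w : W K n f) :
    T f j w = w.comp (X - C (j : V K n f)) * C (g f ^ j) := rfl

lemma T_C_mul (j : ℕ) (a : V K n f) (w : W K n f) : T f j (C a * w) = C a * T f j w := by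
  rw [T_apply, T_apply, mul_comp, C_comp, mul_assoc]

lemma T_X_mul (j : ℕ) (w : W K n f) :
    T f j (X * w) = X * T f j w - (j : K) • T f j w := by
  rw [T_apply, T_apply, mul_comp, X_comp, ← mapC]
  simp only [Polynomial.map_natCast, map_natCast]
  ring

lemma T_X_mul' (j : ℕ) (w : W K n f) :
    T f j (X * w) = (X - C (j : K)).map (algebraMap K (V K n f)) * T f j w := by
  rw [T_X_mul, Polynomial.map_sub, sub_mul, mapC, Polynomial.map_X]

lemma T_X_pow_mul (j m : ℕ) (w : W K n f) :
    T f j (X ^ m * w) = ((X - C (j : K)) ^ m).map (algebraMap K (V K n f)) * T f j w := by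
  induction m with
  | zero => simp
  | succ m ih =>
    rw [pow_succ', mul_assoc, T_X_mul', ih, pow_succ', Polynomial.map_mul, mul_assoc]

lemma T_C (j : ℕ) (a : V K n f) : T f j (C a) = C (a * g f ^ j) := by
  rw [T_apply, C_comp, C_mul]

lemma T_Dtil
    (hDx : ∀ i (a : MvPolynomial (Fin n) K),
      Dx i (algebraMap (MvPolynomial (Fin n) K) (V K n f) a) =
        algebraMap (MvPolynomial (Fin n) K) (V K n f) (MvPolynomial.pderiv i a))
    (hDtil : ∀ i (a : V K n f) (m : ℕ),
      Dtil i (C a * X ^ m) = C (Dx i a) * X ^ m + C (c K n f i * a) * X ^ (m + 1))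
    (i : Fin n) (j : ℕ) (w : W K n f) : T f j (Dtil i w) = Dtil i (T f j w) := by
  induction w using Polynomial.induction_on' with
  | add p q hp hq => simp only [map_add, hp, hq]
  | monomial m a =>
    have h0 : Dtil i (C a * X ^ m) = X ^ m * Dtil i (C a) := by
      rw [hDtil, Dtil_C hDtil]; ring
    rw [← C_mul_X_pow_eq_monomial, h0, mul_comm (C a), T_X_pow_mul, T_X_pow_mul,
      Dtil_poly_mul hDtil]
    congr 1
    rw [Dtil_C hDtil, T_C, Dtil_C hDtil, Derivation.leibniz, D_g_pow hDx, map_add, T_C,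
      mul_comm _ X, T_X_mul, T_C, ← mapC]
    simp only [Polynomial.map_natCast, map_natCast, smul_eq_mul, map_add, map_mul, map_neg, map_pow]
    ring

lemma Stable.comap_T
    (hDx : ∀ i (a : MvPolynomial (Fin n) K),
      Dx i (algebraMap (MvPolynomial (Fin n) K) (V K n f) a) =
        algebraMap (MvPolynomial (Fin n) K) (V K n f) (MvPolynomial.pderiv i a))
    (hDtil : ∀ i (a : V K n f) (m : ℕ),
      Dtil i (C a * X ^ m) = C (Dx i a) * X ^ m + C (c K n f i * a) * X ^ (m + 1))
    {N : Submodule K (W K n f)} (hN : Stable K n f Dtil N) (j : ℕ) :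
    Stable K n f Dtil (N.comap (T f j)) := by
  refine ⟨?_, ?_, ?_⟩
  · intro i w hw
    rw [Submodule.mem_comap] at hw ⊢
    rw [T_C_mul]
    exact hN.x i _ hw
  · intro w hw
    rw [Submodule.mem_comap] at hw ⊢
    rw [T_X_mul]
    exact N.sub_mem (hN.s _ hw) (N.smul_mem _ hw)
  · intro i w hw
    rw [Submodule.mem_comap] at hw ⊢
    rw [T_Dtil hDx hDtil]
    exact hN.d i _ hw

lemma exists_g_pow
    (hDx : ∀ i (a : MvPolynomial (Fin n) K),
      Dx i (algebraMap (MvPolynomial (Fin n) K) (V K n f) a) =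
        algebraMap (MvPolynomial (Fin n) K) (V K n f) (MvPolynomial.pderiv i a))
    (hDtil : ∀ i (a : V K n f) (m : ℕ),
      Dtil i (C a * X ^ m) = C (Dx i a) * X ^ m + C (c K n f i * a) * X ^ (m + 1))
    (b : Polynomial K)
    (hbI : b.map (algebraMap K (V K n f)) ∈
      Orb K n f Dtil (C (algebraMap (MvPolynomial (Fin n) K) (V K n f) f)))
    (lam : K) (hlam : ∀ k : ℕ, 1 ≤ k → b.eval (lam - k) ≠ 0) (k : ℕ) :
    ∃ B : Polynomial K, B.eval lam ≠ 0 ∧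
      B.map (algebraMap K (V K n f)) * C (g f ^ k) ∈ Orb K n f Dtil 1 := by
  induction k with
  | zero => exact ⟨1, by simp, by simpa using self_mem_Orb _⟩
  | succ k ih =>
    obtain ⟨B, hB, hBm⟩ := ih
    refine ⟨B * b.comp (X - C ((k + 1 : ℕ) : K)), ?_, ?_⟩
    · rw [eval_mul, eval_comp, eval_sub, eval_X, eval_C]
      exact mul_ne_zero hB (hlam _ (by omega))
    · have hS := ((stable_Orb (f := f) (Dtil := Dtil) 1).comap_poly hDtil B).comap_T
        hDx hDtil (k + 1)
      have h := Orb_le hS (v := C (algebraMap (MvPolynomial (Fin n) K) (V K n f) f)) (by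
        rw [Submodule.mem_comap, Submodule.mem_comap, LinearMap.mulLeft_apply, T_C, pow_succ',
          ← mul_assoc, f_mul_g, one_mul]
        exact hBm) hbI
      rw [Submodule.mem_comap, Submodule.mem_comap, LinearMap.mulLeft_apply, T_apply] at h
      rw [Polynomial.map_mul, Polynomial.map_comp, Polynomial.map_sub, Polynomial.map_X,
        Polynomial.map_C, map_natCast, mul_assoc]
      exact h

lemma exists_mul_mem
    (hDx : ∀ i (a : MvPolynomial (Fin n) K),
      Dx i (algebraMap (MvPolynomial (Fin n) K) (V K n f) a) =
        algebraMap (MvPolynomial (Fin n) K) (V K n f) (MvPolynomial.pderiv i a))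
    (hDtil : ∀ i (a : V K n f) (m : ℕ),
      Dtil i (C a * X ^ m) = C (Dx i a) * X ^ m + C (c K n f i * a) * X ^ (m + 1))
    (b : Polynomial K)
    (hbI : b.map (algebraMap K (V K n f)) ∈
      Orb K n f Dtil (C (algebraMap (MvPolynomial (Fin n) K) (V K n f) f)))
    (lam : K) (hlam : ∀ k : ℕ, 1 ≤ k → b.eval (lam - k) ≠ 0) (w : W K n f) :
    ∃ B : Polynomial K, B.eval lam ≠ 0 ∧
      B.map (algebraMap K (V K n f)) * w ∈ Orb K n f Dtil 1 := by
  have hS := stable_Orb (f := f) (Dtil := Dtil) 1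
  induction w using Polynomial.induction_on' with
  | add p q hp hq =>
    obtain ⟨B, hB, hBm⟩ := hp
    obtain ⟨B', hB', hBm'⟩ := hq
    refine ⟨B * B', by rw [eval_mul]; exact mul_ne_zero hB hB', ?_⟩
    have h1 := hS.poly B' _ hBm
    have h2 := hS.poly B _ hBm'
    have h3 := Submodule.add_mem _ h1 h2
    convert h3 using 1
    rw [Polynomial.map_mul]
    ring
  | monomial m v =>
    obtain ⟨k, a, ha⟩ := IsLocalization.Away.surj f v
    obtain ⟨B, hB, hBm⟩ := exists_g_pow hDx hDtil b hbI lam hlam k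
    refine ⟨B, hB, ?_⟩
    have hv : v = algebraMap (MvPolynomial (Fin n) K) (V K n f) a * g f ^ k := by
      rw [← ha, mul_assoc, ← mul_pow, f_mul_g, one_pow, mul_one]
    have h1 := hS.poly (X ^ m) _ (hS.coeff a _ hBm)
    rw [Polynomial.map_pow, Polynomial.map_X] at h1
    convert h1 using 1
    rw [← C_mul_X_pow_eq_monomial, hv, C_mul]
    ring

variable (f) in
/-- Evaluation at `s = μ`, i.e. `f^s ↦ f^μ`. -/
def ev (lam : K) : W K n f →ₗ[K] V K n f where
  toFun w := w.eval (algebraMap K (V K n f) lam)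
  map_add' p q := eval_add
  map_smul' r p := by
    rw [RingHom.id_apply, ← mapC, Polynomial.map_C, eval_mul, eval_C, Algebra.smul_def]

lemma ev_apply (lam : K) (w : W K n f) : ev f lam w = w.eval (algebraMap K (V K n f) lam) := rfl

lemma ev_map (lam : K) (B : Polynomial K) (w : W K n f) :
    ev f lam (B.map (algebraMap K (V K n f)) * w) = B.eval lam • ev f lam w := by
  rw [ev_apply, ev_apply, eval_mul, eval_map_algebraMap, aeval_algebraMap_apply,
    Algebra.smul_def, coe_aeval_eq_eval]

lemma ev_Dtil
    (hDtil : ∀ i (a : V K n f) (m : ℕ),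
      Dtil i (C a * X ^ m) = C (Dx i a) * X ^ m + C (c K n f i * a) * X ^ (m + 1))
    (lam : K) (i : Fin n) (w : W K n f) :
    ev f lam (Dtil i w) = Dx i (ev f lam w) + lam • (c K n f i * ev f lam w) := by
  induction w using Polynomial.induction_on' with
  | add p q hp hq => simp only [map_add, hp, hq, mul_add, smul_add]; abel
  | monomial m a =>
    rw [← C_mul_X_pow_eq_monomial, hDtil]
    simp only [ev_apply, eval_add, eval_mul, eval_C, eval_pow, eval_X]
    rw [← map_pow, Derivation.leibniz, Derivation.map_algebraMap]
    simp only [Algebra.smul_def, map_pow, Algebra.algebraMap_self, RingHom.id_apply]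
    ring

lemma self_mem_Dgen (lam : K) (v : V K n f) : v ∈ Dgen K n f Dx lam v := by
  unfold Dgen
  rw [Submodule.mem_sInf]
  exact fun N hN => hN.1

lemma Dgen_le {lam : K} {v : V K n f} {N : Submodule K (V K n f)} (hv : v ∈ N)
    (hx : ∀ i : Fin n, ∀ u ∈ N,
      algebraMap (MvPolynomial (Fin n) K) (V K n f) (MvPolynomial.X i) * u ∈ N)
    (hd : ∀ i : Fin n, ∀ u ∈ N, Dx i u + lam • (c K n f i * u) ∈ N) :
    Dgen K n f Dx lam v ≤ N :=
  sInf_le ⟨hv, hx, hd⟩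

lemma Dgen_x (lam : K) (v : V K n f) (i : Fin n) (u : V K n f)
    (hu : u ∈ Dgen K n f Dx lam v) :
    algebraMap (MvPolynomial (Fin n) K) (V K n f) (MvPolynomial.X i) * u
      ∈ Dgen K n f Dx lam v := by
  unfold Dgen at hu ⊢
  rw [Submodule.mem_sInf] at hu ⊢
  exact fun N hN => hN.2.1 i u (hu N hN)

lemma Dgen_d (lam : K) (v : V K n f) (i : Fin n) (u : V K n f)
    (hu : u ∈ Dgen K n f Dx lam v) :
    Dx i u + lam • (c K n f i * u) ∈ Dgen K n f Dx lam v := by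
  unfold Dgen at hu ⊢
  rw [Submodule.mem_sInf] at hu ⊢
  exact fun N hN => hN.2.2 i u (hu N hN)

lemma Dgen_eq_map
    (hDtil : ∀ i (a : V K n f) (m : ℕ),
      Dtil i (C a * X ^ m) = C (Dx i a) * X ^ m + C (c K n f i * a) * X ^ (m + 1))
    (lam : K) (v : V K n f) :
    Dgen K n f Dx lam v = (Orb K n f Dtil (C v)).map (ev f lam) := by
  have hS := stable_Orb (f := f) (Dtil := Dtil) (C v)
  have hC : ev f lam (C v) = v := by rw [ev_apply, eval_C]
  apply le_antisymm
  · refine Dgen_le ⟨C v, self_mem_Orb _, hC⟩ ?_ ?_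
    · rintro i _ ⟨w, hw, rfl⟩
      refine ⟨_, hS.x i w hw, ?_⟩
      rw [ev_apply, eval_mul, eval_C, ev_apply]
    · rintro i _ ⟨w, hw, rfl⟩
      exact ⟨_, hS.d i w hw, ev_Dtil hDtil lam i w⟩
  · rw [Submodule.map_le_iff_le_comap]
    refine Orb_le ⟨?_, ?_, ?_⟩ ?_
    · intro i w hw
      rw [Submodule.mem_comap] at hw ⊢
      rw [ev_apply, eval_mul, eval_C]
      exact Dgen_x lam v i _ hw
    · intro w hw
      rw [Submodule.mem_comap] at hw ⊢
      rw [ev_apply, eval_mul, eval_X, ← Algebra.smul_def]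
      exact Submodule.smul_mem _ _ hw
    · intro i w hw
      rw [Submodule.mem_comap] at hw ⊢
      rw [ev_Dtil hDtil]
      exact Dgen_d lam v i _ hw
    · rw [Submodule.mem_comap, hC]
      exact self_mem_Dgen lam v

end Dt

variable (K n)

/-- if `b` is a nonzero element of minimal degree of
`I(f) = {b : ∃ P ∈ 𝒟_s, P(f·1) = b(s)·1}` (the b-function) and `λ ∈ K` satisfies
`b(λ) = 0` and `b(λ−k) ≠ 0` for all integers `k ≥ 1`, then
`D_X·f^{λ+1} = D⟨f⟩_λ ⊊ D⟨1⟩_λ = D_X·f^λ`; in particular `K[x,f⁻¹]f^λ` is generated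
over `D_X` by `f^λ` but not by `f^{λ+1}`. -/
theorem stmt13 [CharZero K] (hn : 1 ≤ n)
    (f : MvPolynomial (Fin n) K) (hf : 1 ≤ f.totalDegree)
    (Dx : Fin n → Derivation K (V K n f) (V K n f))
    (hDx : ∀ i (a : MvPolynomial (Fin n) K),
      Dx i (algebraMap (MvPolynomial (Fin n) K) (V K n f) a) =
        algebraMap (MvPolynomial (Fin n) K) (V K n f) (MvPolynomial.pderiv i a))
    (Dtil : Fin n → Module.End K (W K n f))
    (hDtil : ∀ i (a : V K n f) (m : ℕ),
      Dtil i (C a * X ^ m) = C (Dx i a) * X ^ m + C (c K n f i * a) * X ^ (m + 1))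
    (b : Polynomial K) (hb : b ≠ 0)
    (hbI : ∃ P ∈ Ds K n f Dtil,
      P (C (algebraMap (MvPolynomial (Fin n) K) (V K n f) f)) =
        b.map (algebraMap K (V K n f)))
    (hbmin : ∀ b' : Polynomial K, b' ≠ 0 →
      (∃ P ∈ Ds K n f Dtil,
        P (C (algebraMap (MvPolynomial (Fin n) K) (V K n f) f)) =
          b'.map (algebraMap K (V K n f))) →
      b.degree ≤ b'.degree)
    (lam : K) (hlam0 : b.eval lam = 0)
    (hlam : ∀ k : ℕ, 1 ≤ k → b.eval (lam - k) ≠ 0) :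
    Dgen K n f Dx lam (algebraMap (MvPolynomial (Fin n) K) (V K n f) f) <
        Dgen K n f Dx lam 1 ∧
      Dgen K n f Dx lam 1 = ⊤ := by
  have hbO : b.map (algebraMap K (V K n f)) ∈
      Orb K n f Dtil (C (algebraMap (MvPolynomial (Fin n) K) (V K n f) f)) := mem_Orb.2 hbI
  have hS1 := stable_Orb (f := f) (Dtil := Dtil) 1
  have hSf := stable_Orb (f := f) (Dtil := Dtil)
    (C (algebraMap (MvPolynomial (Fin n) K) (V K n f) f))
  have htop : Dgen K n f Dx lam 1 = ⊤ := by
    rw [eq_top_iff]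
    intro v _
    obtain ⟨B, hB, hBm⟩ := exists_mul_mem hDx hDtil b hbO lam hlam (C v)
    have h : B.eval lam • v ∈ Dgen K n f Dx lam 1 := by
      rw [Dgen_eq_map hDtil]
      refine ⟨_, hBm, ?_⟩
      rw [ev_map, ev_apply, eval_C]
    exact (Submodule.smul_mem_iff _ hB).1 h
  refine ⟨?_, htop⟩
  rw [htop, lt_top_iff_ne_top]
  intro hcon
  have h1 : (1 : V K n f) ∈
      Dgen K n f Dx lam (algebraMap (MvPolynomial (Fin n) K) (V K n f) f) := by
    rw [hcon]; trivial
  rw [Dgen_eq_map hDtil] at h1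
  obtain ⟨w0, hw0, hw1⟩ := h1
  have hle : Orb K n f Dtil (C (algebraMap (MvPolynomial (Fin n) K) (V K n f) f))
      ≤ Orb K n f Dtil 1 := by
    refine Orb_le hS1 ?_
    simpa using hS1.coeff f _ (self_mem_Orb _)
  have hdvd : (X - C (algebraMap K (V K n f) lam)) ∣ (1 - w0) := by
    rw [dvd_iff_isRoot, IsRoot.def, eval_sub, eval_one, ← ev_apply, hw1, sub_self]
  obtain ⟨w, hw⟩ := hdvd
  have hXl : (X - C lam : Polynomial K).map (algebraMap K (V K n f))
      = X - C (algebraMap K (V K n f) lam) := by simp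
  -- `w` lies in `D_X[s] f^s`
  have hwm : w ∈ Orb K n f Dtil 1 := by
    obtain ⟨B, hB, hBm⟩ := exists_mul_mem hDx hDtil b hbO lam hlam w
    obtain ⟨q, hq⟩ : (X - C lam) ∣ (B - C (B.eval lam)) := X_sub_C_dvd_sub_C_eval
    have h2 := hS1.poly q _ (Submodule.sub_mem _ (self_mem_Orb 1) (hle hw0))
    have h3 := Submodule.sub_mem _ hBm h2
    refine (Submodule.smul_mem_iff _ hB).1 ?_
    convert h3 using 1
    rw [← mapC, hw, ← hXl, ← mul_assoc, ← sub_mul, ← Polynomial.map_mul, ← Polynomial.map_sub]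
    congr 2
    linear_combination -hq
  obtain ⟨b', hb'⟩ := dvd_iff_isRoot.2 hlam0
  have hbw : b.map (algebraMap K (V K n f)) * w ∈
      Orb K n f Dtil (C (algebraMap (MvPolynomial (Fin n) K) (V K n f) f)) := by
    refine Orb_le (hSf.comap_poly hDtil b) (v := 1) ?_ hwm
    rw [Submodule.mem_comap, LinearMap.mulLeft_apply, mul_one]
    exact hbO
  have hfin : b'.map (algebraMap K (V K n f)) ∈
      Orb K n f Dtil (C (algebraMap (MvPolynomial (Fin n) K) (V K n f) f)) := by
    have h4 := Submodule.add_mem _ (hSf.poly b' _ hw0) hbw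
    convert h4 using 1
    rw [hb', Polynomial.map_mul, hXl]
    linear_combination (b'.map (algebraMap K (V K n f))) * hw
  have hb'0 : b' ≠ 0 := by
    rintro rfl
    exact hb (by rw [hb', mul_zero])
  have hdeg := hbmin b' hb'0 (mem_Orb.1 hfin)
  have h5 := natDegree_le_natDegree hdeg
  rw [hb', natDegree_mul (X_sub_C_ne_zero lam) hb'0, natDegree_X_sub_C] at h5
  omega

end Stmt13
end
end

section
/- Let K be a field of characteristic zero, A = K[x₁,…,xₙ], f ∈ A non-constant, V = Localization.Away f, W = V[s] with twisted derivations ∂̃_i(a·s^m) = (∂_i a)·s^m + (f_i/f)·a·s^{m+1}, 𝒟_s ⊆ End_K(W) the K-subalgebra generated by multiplication by x₁,…,xₙ, multiplication by s, and the ∂̃_i, and I(f) = {b ∈ K[s] : ∃ P ∈ 𝒟_s, P(f·1) = b(s)·1}. Suppose b ∈ I(f) is nonzero of minimal degree among the nonzero elements of I(f). Then for every λ ∈ K the following are equivalent: (1) b(λ−k) ≠ 0 for every integer k ≥ 1; (2) the smallest K-subspace of V containing 1, stable under multiplication by each x_i and under each ∂_i^{(λ)} := ∂_i + λ·(f_i/f),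 equals V. -/
open Polynomial

set_option synthInstance.maxHeartbeats 4000000
set_option maxHeartbeats 4000000
set_option maxSynthPendingDepth 3

noncomputable section

namespace Stmt14

variable (K : Type) [Field K] (n : ℕ)

/-- `V = K[x,f⁻¹]`. -/
abbrev V (f : MvPolynomial (Fin n) K) := Localization.Away f

/-- `W = V[s]`, realizing `K[x,f⁻¹,s]·f^s` (with `f^s ↔ 1`). -/
abbrev W (f : MvPolynomial (Fin n) K) := Polynomial (V K n f)

/-- `f_i/f ∈ V`. -/
def c (f : MvPolynomial (Fin n) K) (i : Fin n) : V K n f :=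
  algebraMap (MvPolynomial (Fin n) K) (V K n f) (MvPolynomial.pderiv i f) *
    Ring.inverse (algebraMap (MvPolynomial (Fin n) K) (V K n f) f)

/-- `𝒟_s ⊆ End_K(W)`: the `K`-subalgebra generated by multiplication by `x₁,…,xₙ`,
multiplication by `s`, and the twisted derivations `∂̃_i`; it models `D_X[s]`. -/
def Ds (f : MvPolynomial (Fin n) K) (Dtil : Fin n → Module.End K (W K n f)) :
    Subalgebra K (Module.End K (W K n f)) :=
  Algebra.adjoin K
    (((Set.range fun i : Fin n =>
          (LinearMap.mulLeft K
            (C (algebraMap (MvPolynomial (Fin n) K) (V K n f) (MvPolynomial.X i)) : W K n f)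
            : Module.End K (W K n f))) ∪
        {(LinearMap.mulLeft K (X : W K n f) : Module.End K (W K n f))}) ∪
      Set.range Dtil)

/-- `N = D_X[s]·f^s ⊆ W`: the smallest `K`-subspace of `W` containing `1` and stable
under all operators of `𝒟_s`; it realizes `M(u,f,s) = D_X[s](u ⊗ f^s)` for `M = K[x]`. -/
def NN (f : MvPolynomial (Fin n) K) (Dtil : Fin n → Module.End K (W K n f)) :
    Submodule K (W K n f) :=
  sInf {N : Submodule K (W K n f) |
    (1 : W K n f) ∈ N ∧ ∀ P ∈ Ds K n f Dtil, ∀ w ∈ N, P w ∈ N}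


section Abstract

variable {k : Type*} {R : Type*} {ι : Type*} [Field k] [CommRing R] [Algebra k R]

/-- Abstract version of `Ds`. -/
def SS (x : ι → R) (Dt : ι → Module.End k R[X]) : Subalgebra k (Module.End k R[X]) :=
  Algebra.adjoin k
    (((Set.range fun i : ι => (LinearMap.mulLeft k (C (x i) : R[X]) : Module.End k R[X])) ∪
        {(LinearMap.mulLeft k (X : R[X]) : Module.End k R[X])}) ∪ Set.range Dt)

theorem SS_x (x : ι → R) (Dt : ι → Module.End k R[X]) (i : ι) :
    (LinearMap.mulLeft k (C (x i) : R[X]) : Module.End k R[X]) ∈ SS x Dt :=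
  Algebra.subset_adjoin (Or.inl (Or.inl ⟨i, rfl⟩))

theorem SS_X (x : ι → R) (Dt : ι → Module.End k R[X]) :
    (LinearMap.mulLeft k (X : R[X]) : Module.End k R[X]) ∈ SS x Dt :=
  Algebra.subset_adjoin (Or.inl (Or.inr rfl))

theorem SS_D (x : ι → R) (Dt : ι → Module.End k R[X]) (i : ι) : Dt i ∈ SS x Dt :=
  Algebra.subset_adjoin (Or.inr ⟨i, rfl⟩)

theorem SS_a (x : ι → R) (Dt : ι → Module.End k R[X]) (a : R)
    (ha : a ∈ Algebra.adjoin k (Set.range x)) :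
    (LinearMap.mulLeft k (C a : R[X]) : Module.End k R[X]) ∈ SS x Dt := by
  induction ha using Algebra.adjoin_induction with
  | mem a ha => obtain ⟨i, rfl⟩ := ha; exact SS_x x Dt i
  | algebraMap r =>
    have : (LinearMap.mulLeft k (C (algebraMap k R r) : R[X]) : Module.End k R[X])
        = algebraMap k _ r := by
      ext1 w
      simp [Module.algebraMap_end_apply, Algebra.smul_def]
    rw [this]; exact Subalgebra.algebraMap_mem _ r
  | add a b _ _ h1 h2 =>
    have : (LinearMap.mulLeft k (C (a + b) : R[X]) : Module.End k R[X])
        = LinearMap.mulLeft k (C a : R[X]) + LinearMap.mulLeft k (C b : R[X]) := by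
      ext1 w; simp [add_mul]
    rw [this]; exact add_mem h1 h2
  | mul a b _ _ h1 h2 =>
    have : (LinearMap.mulLeft k (C (a * b) : R[X]) : Module.End k R[X])
        = (LinearMap.mulLeft k (C a : R[X]) : Module.End k R[X]) *
          (LinearMap.mulLeft k (C b : R[X]) : Module.End k R[X]) := by
      ext1 w; simp [mul_assoc, Module.End.mul_apply]
    rw [this]; exact mul_mem h1 h2

theorem SS_p (x : ι → R) (Dt : ι → Module.End k R[X]) (p : k[X]) :
    (LinearMap.mulLeft k (p.map (algebraMap k R)) : Module.End k R[X]) ∈ SS x Dt := by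
  have : (LinearMap.mulLeft k (p.map (algebraMap k R)) : Module.End k R[X])
      = aeval (LinearMap.mulLeft k (X : R[X]) : Module.End k R[X]) p := by
    induction p using Polynomial.induction_on' with
    | add p q hp hq =>
      rw [map_add, ← hp, ← hq]; ext1 w; simp [add_mul]
    | monomial m a =>
      rw [aeval_monomial]
      ext1 w
      simp [Module.End.mul_apply, Module.algebraMap_end_apply, ← C_mul_X_pow_eq_monomial,
        Algebra.smul_def, mul_assoc, LinearMap.pow_mulLeft]
  rw [this]
  rw [aeval_eq_sum_range]
  exact sum_mem fun i _ => Subalgebra.smul_mem _ (pow_mem (SS_X x Dt) i) _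

variable (x : ι → R) (D : ι → Derivation k R R) (c : ι → R) (Dt : ι → Module.End k R[X])

theorem SS_comm_X
  (hDt : ∀ i (a : R) (m : ℕ),
      Dt i (C a * X ^ m) = C (D i a) * X ^ m + C (c i * a) * X ^ (m + 1))
    (P : Module.End k R[X]) (hP : P ∈ SS x Dt) :
    ∀ w, P (X * w) = X * P w := by
  induction hP using Algebra.adjoin_induction with
  | mem P hP =>
    rcases hP with (⟨i, rfl⟩ | rfl) | ⟨i, rfl⟩
    · intro w; simp [mul_left_comm]
    · intro w; simp
    · intro w
      induction w using Polynomial.induction_on' with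
      | add p q hp hq => rw [mul_add, map_add, hp, hq, map_add, mul_add]
      | monomial m a =>
        rw [← C_mul_X_pow_eq_monomial, hDt,
          show X * (C a * X ^ m) = C a * X ^ (m + 1) by ring, hDt]
        ring
  | algebraMap r => intro w; simp [Module.algebraMap_end_apply]
  | add P Q _ _ h1 h2 => intro w; simp [h1, h2, mul_add]
  | mul P Q _ _ h1 h2 => intro w; simp [Module.End.mul_apply, h1, h2]

theorem SS_comm_p
  (hDt : ∀ i (a : R) (m : ℕ),
      Dt i (C a * X ^ m) = C (D i a) * X ^ m + C (c i * a) * X ^ (m + 1))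
    (P : Module.End k R[X]) (hP : P ∈ SS x Dt) (p : k[X]) :
    ∀ w, P (p.map (algebraMap k R) * w) = p.map (algebraMap k R) * P w := by
  have hX := SS_comm_X x D c Dt hDt P hP
  induction p using Polynomial.induction_on with
  | C a =>
    intro w
    have : ∀ w : R[X], (C a).map (algebraMap k R) * w = a • w := by
      intro w; simp [Algebra.smul_def]
    rw [this, this, map_smul]
  | add p q hp hq => intro w; simp [add_mul, hp, hq]
  | monomial m a h =>
    intro w
    have e : ∀ w : R[X], (C a * X ^ (m + 1)).map (algebraMap k R) * w
      = (C a * X ^ m).map (algebraMap k R) * (X * w) := by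
      intro w; simp [pow_succ, mul_assoc]
    rw [e, e, h, hX]

theorem ev_Dt
  (hDt : ∀ i (a : R) (m : ℕ),
      Dt i (C a * X ^ m) = C (D i a) * X ^ m + C (c i * a) * X ^ (m + 1))
    (α : k) (i : ι) (w : R[X]) :
    (Dt i w).eval (algebraMap k R α) =
      D i (w.eval (algebraMap k R α)) + α • (c i * w.eval (algebraMap k R α)) := by
  induction w using Polynomial.induction_on' with
  | add p q hp hq => rw [map_add, eval_add, hp, hq, eval_add, map_add, mul_add, smul_add]; abel
  | monomial m a =>
    have h : D i ((algebraMap k R α) ^ m) = 0 := by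
      rw [← map_pow]; exact (D i).map_algebraMap _
    rw [← C_mul_X_pow_eq_monomial, hDt]
    simp only [eval_add, eval_mul, eval_C, eval_pow, eval_X, Derivation.leibniz, h,
      Algebra.smul_def, Algebra.algebraMap_self, RingHom.id_apply]
    ring

theorem ev_mem
  (hDt : ∀ i (a : R) (m : ℕ),
      Dt i (C a * X ^ m) = C (D i a) * X ^ m + C (c i * a) * X ^ (m + 1))
    (α : k) (N : Submodule k R) (hx : ∀ i, ∀ u ∈ N, x i * u ∈ N)
    (hD : ∀ i, ∀ u ∈ N, D i u + α • (c i * u) ∈ N)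
    (P : Module.End k R[X]) (hP : P ∈ SS x Dt) :
    ∀ w : R[X], w.eval (algebraMap k R α) ∈ N → (P w).eval (algebraMap k R α) ∈ N := by
  induction hP using Algebra.adjoin_induction with
  | mem P hP =>
    rcases hP with (⟨i, rfl⟩ | rfl) | ⟨i, rfl⟩
    · intro w hw; simpa using hx i _ hw
    · intro w hw; simpa [← Algebra.smul_def] using N.smul_mem α hw
    · intro w hw
      rw [ev_Dt D c Dt hDt]; exact hD i _ hw
  | algebraMap r =>
    intro w hw; simpa [Module.algebraMap_end_apply] using N.smul_mem r hw
  | add P Q _ _ h1 h2 => intro w hw; simpa using N.add_mem (h1 w hw) (h2 w hw)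
  | mul P Q _ _ h1 h2 => intro w hw; exact h1 _ (h2 w hw)

theorem shift_SS
  (hDt : ∀ i (a : R) (m : ℕ),
      Dt i (C a * X ^ m) = C (D i a) * X ^ m + C (c i * a) * X ^ (m + 1))
    (G F : R) (hFG : F * G = 1) (hDF : ∀ i, D i F = c i * F)
    (P : Module.End k R[X]) (hP : P ∈ SS x Dt) :
    ∃ P' ∈ SS x Dt, ∀ w : R[X], C G * (P w).comp (X - 1) = P' (C G * w.comp (X - 1)) := by
  have hDG : ∀ i, D i G = - (c i * G) := by
    intro i
    have h := (D i).leibniz F G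
    rw [hFG, Derivation.map_one_eq_zero, hDF] at h
    simp only [smul_eq_mul] at h
    linear_combination (-G) * h - (D i G + c i * G) * hFG
  induction hP using Algebra.adjoin_induction with
  | mem P hP =>
    rcases hP with (⟨i, rfl⟩ | rfl) | ⟨i, rfl⟩
    · refine ⟨_, SS_x x Dt i, fun w => ?_⟩
      simp [mul_left_comm]
    · refine ⟨_, sub_mem (SS_X x Dt) (one_mem _), fun w => ?_⟩
      simp; ring
    · refine ⟨_, SS_D x Dt i, fun w => ?_⟩
      induction w using Polynomial.induction_on with
      | add p q hp hq => simp only [map_add, add_comp, mul_add, hp, hq]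
      | C a =>
        have h1 := hDt i a 0
        have h2 := hDt i (G * a) 0
        simp only [pow_zero, mul_one, zero_add, pow_one] at h1 h2
        rw [h1, C_comp, ← C_mul, h2]
        simp only [add_comp, mul_comp, C_comp, X_comp, Derivation.leibniz, hDG, smul_eq_mul]
        simp only [C_mul, C_add, C_neg, mul_neg]
        ring
      | monomial m a h =>
        have hX := SS_comm_X x D c Dt hDt _ (SS_D x Dt i)
        rw [show C a * X ^ (m + 1) = X * (C a * X ^ m) by ring, hX, mul_comp, X_comp,
          mul_comp X, X_comp,
          show C G * ((X - 1) * ((C a * X ^ m : R[X]).comp (X - 1)))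
            = X * (C G * ((C a * X ^ m : R[X]).comp (X - 1)))
              - (C G * ((C a * X ^ m : R[X]).comp (X - 1))) by ring,
          map_sub, hX, ← h]
        ring
  | algebraMap r =>
    refine ⟨_, Subalgebra.algebraMap_mem _ r, fun w => ?_⟩
    simp [Module.algebraMap_end_apply]
  | add P Q _ _ h1 h2 =>
    obtain ⟨P', hP', h1⟩ := h1
    obtain ⟨Q', hQ', h2⟩ := h2
    exact ⟨_, add_mem hP' hQ', fun w => by simp [mul_add, h1, h2]⟩
  | mul P Q _ _ h1 h2 =>
    obtain ⟨P', hP', h1⟩ := h1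
    obtain ⟨Q', hQ', h2⟩ := h2
    exact ⟨_, mul_mem hP' hQ', fun w => by simp [Module.End.mul_apply, h1, h2]⟩

theorem exists_step
  (hDt : ∀ i (a : R) (m : ℕ),
      Dt i (C a * X ^ m) = C (D i a) * X ^ m + C (c i * a) * X ^ (m + 1))
    (G F : R) (hFG : F * G = 1) (hDF : ∀ i, D i F = c i * F) (b : k[X])
    (hb : ∃ P ∈ SS x Dt, P (C F) = b.map (algebraMap k R)) (m : ℕ) :
    ∃ P ∈ SS x Dt, P (C (G ^ m)) =
      (b.comp (X - C (m + 1 : k))).map (algebraMap k R) * C (G ^ (m + 1)) := by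
  induction m with
  | zero =>
    obtain ⟨P, hP, h⟩ := hb
    obtain ⟨P', hP', h'⟩ := shift_SS x D c Dt hDt G F hFG hDF P hP
    refine ⟨P', hP', ?_⟩
    have := h' (C F)
    rw [h, C_comp, ← C_mul, mul_comm G F, hFG] at this
    rw [pow_zero, ← this]
    simp [Polynomial.map_comp, mul_comm]
  | succ m ih =>
    obtain ⟨P, hP, h⟩ := ih
    obtain ⟨P', hP', h'⟩ := shift_SS x D c Dt hDt G F hFG hDF P hP
    refine ⟨P', hP', ?_⟩
    have := h' (C (G ^ m))
    rw [h, C_comp, ← C_mul, ← pow_succ'] at this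
    rw [← this]
    simp only [Polynomial.map_comp, mul_comp, comp_assoc, C_comp, Polynomial.map_sub, map_X, map_C,
      sub_comp, X_comp, pow_succ G (m + 1), C_mul]
    have : (X - 1 - C ((algebraMap k R) (m + 1 : k)) : R[X])
        = X - C ((algebraMap k R) (((m + 1 : ℕ) : k) + 1)) := by
      simp; ring
    rw [this]; ring

/-- product of shifted b-functions -/
theorem exists_prod
  (hDt : ∀ i (a : R) (m : ℕ),
      Dt i (C a * X ^ m) = C (D i a) * X ^ m + C (c i * a) * X ^ (m + 1))
    (G F : R) (hFG : F * G = 1) (hDF : ∀ i, D i F = c i * F) (b : k[X])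
    (hb : ∃ P ∈ SS x Dt, P (C F) = b.map (algebraMap k R)) (m : ℕ) :
    ∃ Q ∈ SS x Dt, Q 1 =
      (∏ j ∈ Finset.range m, b.comp (X - C (j + 1 : k))).map (algebraMap k R) * C (G ^ m) := by
  induction m with
  | zero => exact ⟨1, one_mem _, by simp⟩
  | succ m ih =>
    obtain ⟨Q, hQ, h⟩ := ih
    obtain ⟨P, hP, h'⟩ := exists_step x D c Dt hDt G F hFG hDF b hb m
    refine ⟨P * Q, mul_mem hP hQ, ?_⟩
    rw [Module.End.mul_apply, h, SS_comm_p x D c Dt hDt P hP, h', Finset.prod_range_succ,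
      Polynomial.map_mul]
    ring

theorem exists_R (G F : R) (hFG : F * G = 1) (hF : F ∈ Algebra.adjoin k (Set.range x))
    (hloc : ∀ v : R, ∃ m : ℕ, F ^ m * v ∈ Algebra.adjoin k (Set.range x)) (w : R[X]) :
    ∃ m : ℕ, ∀ l ≥ m, ∃ P ∈ SS x Dt, w = P (C (G ^ l)) := by
  induction w using Polynomial.induction_on' with
  | add p q hp hq =>
    obtain ⟨m, hm⟩ := hp
    obtain ⟨m', hm'⟩ := hq
    refine ⟨max m m', fun l hl => ?_⟩
    obtain ⟨P, hP, h⟩ := hm l (le_trans (le_max_left _ _) hl)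
    obtain ⟨Q, hQ, h'⟩ := hm' l (le_trans (le_max_right _ _) hl)
    exact ⟨P + Q, add_mem hP hQ, by rw [LinearMap.add_apply, ← h, ← h']⟩
  | monomial j a =>
    obtain ⟨m, hm⟩ := hloc a
    refine ⟨m, fun l hl => ?_⟩
    have h1 : F ^ l * a ∈ Algebra.adjoin k (Set.range x) := by
      obtain ⟨e, rfl⟩ := Nat.exists_eq_add_of_le hl
      rw [add_comm, pow_add, mul_assoc]
      exact mul_mem (pow_mem hF e) hm
    refine ⟨_, mul_mem (pow_mem (SS_X x Dt) j) (SS_a x Dt _ h1), ?_⟩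
    have h2 : F ^ l * a * G ^ l = a := by
      rw [mul_right_comm, ← mul_pow, hFG, one_pow, one_mul]
    rw [Module.End.mul_apply, LinearMap.pow_mulLeft, LinearMap.mulLeft_apply,
      LinearMap.mulLeft_apply, ← C_mul, h2, ← C_mul_X_pow_eq_monomial, mul_comm]

/-- every element is brought into `D[s] f^s` by a product of shifted b-functions -/
theorem exists_B
  (hDt : ∀ i (a : R) (m : ℕ),
      Dt i (C a * X ^ m) = C (D i a) * X ^ m + C (c i * a) * X ^ (m + 1))
    (G F : R) (hFG : F * G = 1) (hDF : ∀ i, D i F = c i * F)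
    (hF : F ∈ Algebra.adjoin k (Set.range x))
    (hloc : ∀ v : R, ∃ m : ℕ, F ^ m * v ∈ Algebra.adjoin k (Set.range x)) (b : k[X])
    (hb : ∃ P ∈ SS x Dt, P (C F) = b.map (algebraMap k R)) (w : R[X]) :
    ∃ m : ℕ, ∃ P ∈ SS x Dt, P 1 =
      (∏ j ∈ Finset.range m, b.comp (X - C (j + 1 : k))).map (algebraMap k R) * w := by
  obtain ⟨m, hm⟩ := exists_R x Dt G F hFG hF hloc w
  obtain ⟨P, hP, h⟩ := hm m le_rfl
  obtain ⟨Q, hQ, h'⟩ := exists_prod x D c Dt hDt G F hFG hDF b hb m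
  refine ⟨m, P * Q, mul_mem hP hQ, ?_⟩
  rw [Module.End.mul_apply, h', SS_comm_p x D c Dt hDt P hP, ← h]

theorem eval_B (b : k[X]) (α : k) (h : ∀ j : ℕ, 1 ≤ j → b.eval (α - j) ≠ 0) (m : ℕ) :
    (∏ j ∈ Finset.range m, b.comp (X - C (j + 1 : k))).eval α ≠ 0 := by
  rw [eval_prod]
  refine Finset.prod_ne_zero_iff.2 fun j _ => ?_
  have := h (j + 1) (by omega)
  simpa using this

theorem forward
  (hDt : ∀ i (a : R) (m : ℕ),
      Dt i (C a * X ^ m) = C (D i a) * X ^ m + C (c i * a) * X ^ (m + 1))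
    (G F : R) (hFG : F * G = 1) (hDF : ∀ i, D i F = c i * F)
    (hF : F ∈ Algebra.adjoin k (Set.range x))
    (hloc : ∀ v : R, ∃ m : ℕ, F ^ m * v ∈ Algebra.adjoin k (Set.range x)) (b : k[X])
    (hb : ∃ P ∈ SS x Dt, P (C F) = b.map (algebraMap k R)) (α : k)
    (h : ∀ j : ℕ, 1 ≤ j → b.eval (α - j) ≠ 0)
    (N : Submodule k R) (h1 : 1 ∈ N) (hx : ∀ i, ∀ u ∈ N, x i * u ∈ N)
    (hD : ∀ i, ∀ u ∈ N, D i u + α • (c i * u) ∈ N) : N = ⊤ := by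
  rw [eq_top_iff]
  rintro v -
  obtain ⟨m, P, hP, e⟩ := exists_B x D c Dt hDt G F hFG hDF hF hloc b hb (C v)
  have hB := eval_B b α h m
  have := ev_mem x D c Dt hDt α N hx hD P hP 1 (by simpa using h1)
  rw [e, eval_mul, eval_C, eval_map_apply, ← Algebra.smul_def] at this
  exact (N.smul_mem_iff hB).1 this

theorem backward [CharZero k]
  (hDt : ∀ i (a : R) (m : ℕ),
      Dt i (C a * X ^ m) = C (D i a) * X ^ m + C (c i * a) * X ^ (m + 1))
    (G F : R) (hFG : F * G = 1) (hDF : ∀ i, D i F = c i * F)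
    (hF : F ∈ Algebra.adjoin k (Set.range x))
    (hloc : ∀ v : R, ∃ m : ℕ, F ^ m * v ∈ Algebra.adjoin k (Set.range x)) (b : k[X])
    (hb0 : b ≠ 0)
    (hb : ∃ P ∈ SS x Dt, P (C F) = b.map (algebraMap k R))
    (hbmin : ∀ b' : k[X], b' ≠ 0 → (∃ P ∈ SS x Dt, P (C F) = b'.map (algebraMap k R)) →
      b.degree ≤ b'.degree)
    (lam : k)
    (htop : ∀ N : Submodule k R, 1 ∈ N → (∀ i, ∀ u ∈ N, x i * u ∈ N) →
      (∀ i, ∀ u ∈ N, D i u + lam • (c i * u) ∈ N) → N = ⊤) :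
    ∀ j : ℕ, 1 ≤ j → b.eval (lam - j) ≠ 0 := by
  classical
  by_contra! hcon
  -- choose the largest such index
  have hfin : {j : ℕ | b.eval (lam - j) = 0}.Finite := by
    have h := (b.roots.toFinset.finite_toSet).preimage
      (f := fun j : ℕ => lam - (j : k)) (by
        intro a _ a' _ h
        simpa using h)
    refine h.subset fun j hj => ?_
    simpa [hb0] using hj
  obtain ⟨j0, hj0, hj0'⟩ := hcon
  obtain ⟨p, hp, hmax⟩ := hfin.exists_le_maximal (a := j0) hj0'
  set α : k := lam - p with hα
  have hroot : b.eval α = 0 := hmax.1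
  have hnext : ∀ j : ℕ, 1 ≤ j → b.eval (α - j) ≠ 0 := by
    intro j hj h0
    have : p + j ≤ p := hmax.2 (y := p + j) (by
      show b.eval (lam - ((p + j : ℕ) : k)) = 0
      rw [← h0, hα]; push_cast; congr 1; ring) (by simp)
    omega
  have hp1 : 1 ≤ p := le_trans hj0 hp
  -- the submodule generated by `F` for `α`
  let ev : R[X] →ₗ[k] R := (Polynomial.aeval (R := R) (algebraMap k R α)).toLinearMap.restrictScalars k
  have hev : ∀ w, ev w = w.eval (algebraMap k R α) := fun w => by
    simp [ev, Polynomial.aeval_def, eval₂_eq_eval_map]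
  let N : Submodule k R := 
    (Subalgebra.toSubmodule (SS x Dt)).map (ev ∘ₗ (LinearMap.applyₗ (C F : R[X])))
  have hN : ∀ v, v ∈ N ↔ ∃ P ∈ SS x Dt, (P (C F)).eval (algebraMap k R α) = v := by
    intro v
    simp only [N, Submodule.mem_map, Subalgebra.mem_toSubmodule, LinearMap.comp_apply, hev]
    rfl
  have hNa : ∀ a ∈ Algebra.adjoin k (Set.range x), ∀ u ∈ N, a * u ∈ N := by
    intro a ha u hu
    obtain ⟨P, hP, rfl⟩ := (hN u).1 hu
    exact (hN _).2 ⟨_, mul_mem (SS_a x Dt a ha) hP, by simp [Module.End.mul_apply]⟩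
  have hND : ∀ i, ∀ u ∈ N, D i u + α • (c i * u) ∈ N := by
    intro i u hu
    obtain ⟨P, hP, rfl⟩ := (hN u).1 hu
    exact (hN _).2 ⟨_, mul_mem (SS_D x Dt i) hP, by
      rw [Module.End.mul_apply, ev_Dt D c Dt hDt]⟩
  have hFN : F ∈ N := (hN F).2 ⟨1, one_mem _, by simp⟩
  have hpow : ∀ i, D i (F ^ p) = (p : R) * (c i * F ^ p) := by
    intro i
    obtain ⟨q, rfl⟩ := Nat.exists_eq_add_of_le' hp1
    rw [Derivation.leibniz_pow, hDF]
    simp only [nsmul_eq_mul, smul_eq_mul, Nat.add_sub_cancel]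
    ring
  have hcomap : N.comap (LinearMap.mulLeft k (F ^ p)) = ⊤ := by
    apply htop
    · obtain ⟨q, hq⟩ := Nat.exists_eq_add_of_le' hp1
      rw [Submodule.mem_comap, LinearMap.mulLeft_apply, mul_one, hq, pow_succ]
      exact hNa _ (pow_mem hF q) _ hFN
    · intro i u hu
      rw [Submodule.mem_comap, LinearMap.mulLeft_apply] at hu ⊢
      rw [mul_left_comm]
      exact hNa _ (Algebra.subset_adjoin ⟨i, rfl⟩) _ hu
    · intro i u hu
      rw [Submodule.mem_comap, LinearMap.mulLeft_apply] at hu ⊢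
      have := hND i _ hu
      convert this using 1
      rw [Derivation.leibniz, hpow, hα]
      simp only [Algebra.smul_def, smul_eq_mul, map_sub, map_natCast,
        Algebra.algebraMap_self, RingHom.id_apply]
      ring
  have h1N : (1 : R) ∈ N := by
    have : G ^ p ∈ N.comap (LinearMap.mulLeft k (F ^ p)) := by rw [hcomap]; trivial
    rwa [Submodule.mem_comap, LinearMap.mulLeft_apply, ← mul_pow, hFG, one_pow] at this
  obtain ⟨P, hP, hP1⟩ := (hN 1).1 h1N
  -- divisibility
  have hdvd : (X - C (algebraMap k R α)) ∣ (1 - P (C F)) := by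
    rw [dvd_iff_isRoot, IsRoot, eval_sub, hP1]; simp
  obtain ⟨u, hu⟩ := hdvd
  have hL : (X - C (algebraMap k R α) : R[X]) = (X - C α : k[X]).map (algebraMap k R) := by simp
  rw [hL] at hu
  -- `u` lies in `D[s] f^s`
  have hu1 : ∃ Q ∈ SS x Dt, Q 1 = (X - C α : k[X]).map (algebraMap k R) * u := by
    refine ⟨_, sub_mem (one_mem _) (mul_mem hP (SS_a x Dt F hF)), ?_⟩
    rw [← hu]; simp [Module.End.mul_apply]
  obtain ⟨Q, hQ, hQ1⟩ := hu1
  obtain ⟨m, S, hS, hS1⟩ := exists_B x D c Dt hDt G F hFG hDF hF hloc b hb u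
  have hB := eval_B b α hnext m
  set B := ∏ j ∈ Finset.range m, b.comp (X - C (j + 1 : k)) with hBdef
  obtain ⟨q, hq⟩ : (X - C α) ∣ (B - C (B.eval α)) := by
    rw [dvd_iff_isRoot, IsRoot]; simp
  have hu2 : ∃ T ∈ SS x Dt, T 1 = u := by
    refine ⟨(B.eval α)⁻¹ • (S - LinearMap.mulLeft k (q.map (algebraMap k R)) * Q),
      Subalgebra.smul_mem _ (sub_mem hS (mul_mem (SS_p x Dt q) hQ)) _, ?_⟩
    rw [LinearMap.smul_apply, LinearMap.sub_apply, Module.End.mul_apply, hS1, hQ1,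
      LinearMap.mulLeft_apply, ← mul_assoc, ← sub_mul, ← Polynomial.map_mul,
      ← Polynomial.map_sub,
      show B - q * (X - C α) = C (B.eval α) by rw [mul_comm q, ← hq]; ring,
      Polynomial.map_C]
    rw [show C (algebraMap k R (B.eval α)) * u = (B.eval α) • u by simp [Algebra.smul_def],
      smul_smul, inv_mul_cancel₀ hB, one_smul]
  obtain ⟨T, hT, hT1⟩ := hu2
  obtain ⟨b', hb'⟩ : (X - C α) ∣ b := dvd_iff_isRoot.2 hroot
  have hb'0 : b' ≠ 0 := by rintro rfl; simp at hb'; exact hb0 hb'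
  obtain ⟨E, hE, hE1⟩ := hb
  have hdeg := hbmin b' hb'0 ⟨LinearMap.mulLeft k (b'.map (algebraMap k R)) * P + T * E,
    add_mem (mul_mem (SS_p x Dt b') hP) (mul_mem hT hE), by
      rw [LinearMap.add_apply, Module.End.mul_apply, Module.End.mul_apply, hE1,
        LinearMap.mulLeft_apply]
      have h := SS_comm_p x D c Dt hDt T hT b 1
      rw [mul_one, hT1] at h
      rw [h, hb', Polynomial.map_mul]
      linear_combination (- b'.map (algebraMap k R)) * hu⟩
  rw [hb', degree_mul, degree_X_sub_C, degree_eq_natDegree hb'0] at hdeg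
  have : 1 + b'.natDegree ≤ b'.natDegree := by exact_mod_cast hdeg
  omega

end Abstract

/-- if `b` is a nonzero element of minimal degree of
`I(f) = {b : ∃ P ∈ 𝒟_s, P(f·1) = b(s)·1}` (the b-function), then for every `λ ∈ K`:
`b(λ−k) ≠ 0` for all integers `k ≥ 1` if and only if the smallest `K`-subspace of `V`
containing `1` and stable under multiplication by the `x_i` and under the twisted
operators `∂_i^{(λ)} = ∂_i + λ·(f_i/f)` is all of `V` (i.e. `K[x,f⁻¹]f^λ = D_X·f^λ`). -/
theorem stmt14 [CharZero K] (hn : 1 ≤ n)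
    (f : MvPolynomial (Fin n) K) (hf : 1 ≤ f.totalDegree)
    (Dx : Fin n → Derivation K (V K n f) (V K n f))
    (hDx : ∀ i (a : MvPolynomial (Fin n) K),
      Dx i (algebraMap (MvPolynomial (Fin n) K) (V K n f) a) =
        algebraMap (MvPolynomial (Fin n) K) (V K n f) (MvPolynomial.pderiv i a))
    (Dtil : Fin n → Module.End K (W K n f))
    (hDtil : ∀ i (a : V K n f) (m : ℕ),
      Dtil i (C a * X ^ m) = C (Dx i a) * X ^ m + C (c K n f i * a) * X ^ (m + 1))
    (b : Polynomial K) (hb : b ≠ 0)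
    (hbI : ∃ P ∈ Ds K n f Dtil,
      P (C (algebraMap (MvPolynomial (Fin n) K) (V K n f) f)) =
        b.map (algebraMap K (V K n f)))
    (hbmin : ∀ b' : Polynomial K, b' ≠ 0 →
      (∃ P ∈ Ds K n f Dtil,
        P (C (algebraMap (MvPolynomial (Fin n) K) (V K n f) f)) =
          b'.map (algebraMap K (V K n f))) →
      b.degree ≤ b'.degree)
    (lam : K) :
    (∀ k : ℕ, 1 ≤ k → b.eval (lam - k) ≠ 0) ↔
      sInf {N : Submodule K (V K n f) |
        (1 : V K n f) ∈ N ∧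
        (∀ i : Fin n, ∀ u ∈ N,
          algebraMap (MvPolynomial (Fin n) K) (V K n f) (MvPolynomial.X i) * u ∈ N) ∧
        (∀ i : Fin n, ∀ u ∈ N, Dx i u + lam • (c K n f i * u) ∈ N)} = ⊤ := by
  set φ := algebraMap (MvPolynomial (Fin n) K) (V K n f) with hφ
  have hunit : IsUnit (φ f) := IsLocalization.Away.algebraMap_isUnit f
  have hFG : φ f * Ring.inverse (φ f) = 1 := Ring.mul_inverse_cancel _ hunit
  have hDF : ∀ i, Dx i (φ f) = c K n f i * φ f := by
    intro i
    rw [hDx, c, mul_assoc, ← hφ, mul_comm (Ring.inverse (φ f)), hFG, mul_one]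
  have hadj : ∀ a, φ a ∈ Algebra.adjoin K (Set.range fun i : Fin n => φ (MvPolynomial.X i)) := by
    intro a
    induction a using MvPolynomial.induction_on with
    | C r =>
      have : φ (MvPolynomial.C r) = algebraMap K (V K n f) r := by
        rw [hφ, IsScalarTower.algebraMap_apply K (MvPolynomial (Fin n) K) (V K n f)]; rfl
      rw [this]; exact Subalgebra.algebraMap_mem _ r
    | add p q hp hq => rw [map_add]; exact add_mem hp hq
    | mul_X p i hp => rw [map_mul]; exact mul_mem hp (Algebra.subset_adjoin ⟨i, rfl⟩)
  have hloc : ∀ v : V K n f, ∃ m : ℕ, φ f ^ m * v ∈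
      Algebra.adjoin K (Set.range fun i : Fin n => φ (MvPolynomial.X i)) := by
    intro v
    obtain ⟨m, a, ha⟩ := IsLocalization.Away.surj f v
    exact ⟨m, by rw [mul_comm]; rw [hφ, ha]; exact hadj a⟩
  constructor
  · intro h
    rw [eq_top_iff]
    refine le_sInf fun N hN => ?_
    obtain ⟨h1, h2, h3⟩ := hN
    exact (forward (fun i => φ (MvPolynomial.X i)) Dx (c K n f) Dtil hDtil _ _ hFG hDF (hadj f)
      hloc b hbI lam h N h1 h2 h3).ge
  · intro h
    refine backward (fun i => φ (MvPolynomial.X i)) Dx (c K n f) Dtil hDtil _ _ hFG hDF (hadj f)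
      hloc b hb hbI hbmin lam fun N h1 h2 h3 => ?_
    rw [eq_top_iff, ← h]
    exact sInf_le ⟨h1, h2, h3⟩

end Stmt14
end
end

section
/- Let K be a field of characteristic zero, A = K[x₁,…,xₙ], f ∈ A non-constant, R = A[t], g = t·f − 1, and B = R[g⁻¹]/R the cokernel of R → Localization.Away g. Let ∂_{x_i} and ∂_t be the endomorphisms of B induced by the unique derivations of Localization.Away g extending the partial derivatives of R, and let 𝒜_Y ⊆ Module.End K B be the K-subalgebra generated by multiplication by x₁,…,xₙ, multiplication by t, and ∂_{x_1},…,∂_{x_n}, ∂_t (modeling D_Y). Then the annihilator {P ∈ 𝒜_Y : P(δ) = 0} of the class δ of f/g equals the left ideal of 𝒜_Y generated by: multiplication by (tf − 1), and the operators ∂_{x_i} − M_{f_i}∘∂_t∘M_{t²} for i = 1,…,n, where M_a denotes multiplication by a and f_i = ∂f/∂x_i. -/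
open Polynomial

set_option synthInstance.maxHeartbeats 4000000
set_option maxHeartbeats 4000000
set_option maxSynthPendingDepth 3

noncomputable section

namespace Stmt16

variable (K : Type) [Field K] (n : ℕ)

/-- `R = A[t]` where `A = K[x₁,…,xₙ]`. -/
abbrev R := Polynomial (MvPolynomial (Fin n) K)

/-- `g = t·f − 1 ∈ R`. -/
abbrev g (f : MvPolynomial (Fin n) K) : R K n := X * C f - 1

/-- `R[g⁻¹]`. -/
abbrev L (f : MvPolynomial (Fin n) K) := Localization.Away (g K n f)

/-- `B = R[g⁻¹]/R`, realizing `B_{Z|Y} = K[x,t,(tf−1)⁻¹]/K[x,t]`. -/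
abbrev B (f : MvPolynomial (Fin n) K) :=
  L K n f ⧸ LinearMap.range (Algebra.linearMap (R K n) (L K n f))

/-- Multiplication by `r ∈ R` as a `K`-linear endomorphism of `B`. -/
def mulOp (f : MvPolynomial (Fin n) K) (r : R K n) : Module.End K (B K n f) :=
  (LinearMap.lsmul (R K n) (B K n f) r).restrictScalars K

/-- The element `f/g = f/(tf−1)` of `R[g⁻¹]`. -/
def deltaL (f : MvPolynomial (Fin n) K) : L K n f :=
  Localization.mk (C f) ⟨g K n f, 1, pow_one _⟩


section Abstract

variable {K} {n}

/-- coefficientwise partial derivative -/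
def Px (i : Fin n) (r : R K n) : R K n :=
  r.sum fun m a => C (MvPolynomial.pderiv i a) * X ^ m

lemma coeff_Px (i : Fin n) (r : R K n) (m : ℕ) :
    (Px i r).coeff m = MvPolynomial.pderiv i (r.coeff m) := by
  rw [Px, Polynomial.sum_def, Polynomial.finsetSum_coeff]
  simp only [Polynomial.coeff_C_mul, Polynomial.coeff_X_pow]
  simp only [mul_ite, mul_one, mul_zero, Finset.sum_ite_eq]
  split_ifs with h
  · rfl
  · rw [Polynomial.notMem_support_iff.mp (by simpa using h), map_zero]

lemma Px_derivative (i : Fin n) (r : R K n) :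
    Px i (derivative r) = derivative (Px i r) := by
  ext1 m
  rw [coeff_Px, Polynomial.coeff_derivative, Polynomial.coeff_derivative, coeff_Px,
    Derivation.leibniz]
  have : MvPolynomial.pderiv i ((m : MvPolynomial (Fin n) K) + 1) = 0 := by
    rw [map_add, Derivation.map_natCast, Derivation.map_one_eq_zero, add_zero]
  rw [this]
  simp [mul_comm]

variable {E : Type} [Ring E] [Algebra K E]

lemma mu_mem (μ : R K n →ₐ[K] E) (A : Subalgebra K E)
    (h1 : ∀ i, μ (C (MvPolynomial.X i)) ∈ A) (h2 : μ X ∈ A) (r : R K n) : μ r ∈ A := by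
  induction r using Polynomial.induction_on' with
  | add p q hp hq => rw [map_add]; exact A.add_mem hp hq
  | monomial m a =>
    rw [← Polynomial.C_mul_X_pow_eq_monomial, map_mul, map_pow]
    refine A.mul_mem ?_ (A.pow_mem h2 m)
    induction a using MvPolynomial.induction_on with
    | C c =>
      have : (C (MvPolynomial.C c) : R K n) = algebraMap K (R K n) c := rfl
      rw [this, AlgHom.commutes]
      exact A.algebraMap_mem c
    | add p q hp hq => rw [map_add, map_add]; exact A.add_mem hp hq
    | mul_X p i hp => rw [map_mul, map_mul]; exact A.mul_mem hp (h1 i)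

/-- normal forms -/
def nf (μ : R K n →ₐ[K] E) (d : E) (c : ℕ →₀ R K n) : E := c.sum fun k r => d ^ k * μ r

lemma nf_add (μ : R K n →ₐ[K] E) (d : E) (c c' : ℕ →₀ R K n) :
    nf μ d (c + c') = nf μ d c + nf μ d c' := by
  unfold nf
  exact Finsupp.sum_add_index' (by simp) (by intros; rw [map_add, mul_add])

lemma nf_single (μ : R K n →ₐ[K] E) (d : E) (k : ℕ) (r : R K n) :
    nf μ d (Finsupp.single k r) = d ^ k * μ r := by
  unfold nf
  exact Finsupp.sum_single_index (by simp)

/-- normal forms modulo `J` -/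
def nfS (μ : R K n →ₐ[K] E) (d : E) (A : Subalgebra K E) (J : Submodule A E) :
    AddSubmonoid E where
  carrier := {P | ∃ c, ∃ j ∈ J, P = nf μ d c + j}
  zero_mem' := ⟨0, 0, J.zero_mem, by simp [nf]⟩
  add_mem' := by
    rintro _ _ ⟨c, j, hj, rfl⟩ ⟨c', j', hj', rfl⟩
    exact ⟨c + c', j + j', J.add_mem hj hj', by rw [nf_add]; abel⟩

lemma reduce (μ : R K n →ₐ[K] E) (d : E) (dx : Fin n → E) (f : MvPolynomial (Fin n) K)
    (A : Subalgebra K E)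
    (hA : A = Algebra.adjoin K
        ((((Set.range fun i : Fin n => μ (C (MvPolynomial.X i))) ∪
            {μ X}) ∪ Set.range dx) ∪ {d}))
    (hd : ∀ q, μ q * d = d * μ q - μ (derivative q))
    (hdx : ∀ i q, dx i * μ q = μ q * dx i + μ (Px i q))
    (hc : ∀ i, dx i * d = d * dx i) (J : Submodule A E)
    (hJ : ∀ i, dx i - μ (C (MvPolynomial.pderiv i f)) * d * μ (X ^ 2) ∈ J)
    (P : E) (hP : P ∈ A) : P ∈ nfS μ d A J := by
  have hdA : d ∈ A := by rw [hA]; exact Algebra.subset_adjoin (by simp)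
  have hμA : ∀ r, μ r ∈ A := by
    apply mu_mem
    · intro i; rw [hA]; exact Algebra.subset_adjoin (by simp)
    · rw [hA]; exact Algebra.subset_adjoin (by simp)
  have hdxA : ∀ i, dx i ∈ A := by
    intro i; rw [hA]; exact Algebra.subset_adjoin (by simp)
  have hJA : ∀ a ∈ A, ∀ j ∈ J, a * j ∈ J := fun a ha j hj => J.smul_mem ⟨a, ha⟩ hj
  set S := nfS μ d A J with hS
  have hJS : ∀ j ∈ J, j ∈ S := fun j hj => ⟨0, j, hj, by simp [nf]⟩
  have hmS : ∀ k r, d ^ k * μ r ∈ S := fun k r =>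
    ⟨Finsupp.single k r, 0, J.zero_mem, by rw [nf_single, add_zero]⟩
  -- to show left stability suffices on monomials
  have key : ∀ a ∈ A, (∀ k r, a * (d ^ k * μ r) ∈ S) → ∀ s ∈ S, a * s ∈ S := by
    rintro a ha h _ ⟨c, j, hj, rfl⟩
    rw [mul_add]
    refine S.add_mem ?_ (hJS _ (hJA a ha j hj))
    rw [nf, Finsupp.sum, Finset.mul_sum]
    exact S.sum_mem fun k _ => h k _
  have hdS : ∀ s ∈ S, d * s ∈ S := key d hdA fun k r => by
    rw [← mul_assoc, ← pow_succ']; exact hmS _ _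
  have hdkS : ∀ k, ∀ s ∈ S, d ^ k * s ∈ S := by
    intro k
    induction k with
    | zero => intro s hs; simpa using hs
    | succ k ih => intro s hs; rw [pow_succ, mul_assoc]; exact ih _ (hdS _ hs)
  have hμm : ∀ k q r, μ q * (d ^ k * μ r) ∈ S := by
    intro k
    induction k with
    | zero => intro q r; simpa [map_mul] using hmS 0 (q * r)
    | succ k ih =>
      intro q r
      have : μ q * (d ^ (k+1) * μ r) =
          d * (μ q * (d ^ k * μ r)) + μ (-derivative q) * (d ^ k * μ r) := by
        rw [pow_succ', ← mul_assoc, ← mul_assoc, hd, map_neg]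
        noncomm_ring
      rw [this]
      exact S.add_mem (hdS _ (ih _ _)) (ih _ _)
  have hμS : ∀ q, ∀ s ∈ S, μ q * s ∈ S := fun q => key _ (hμA q) fun k r => hμm k q r
  have hdxk : ∀ i k, dx i * d ^ k = d ^ k * dx i := by
    intro i k
    exact (Commute.pow_right (hc i) k)
  have hdxS : ∀ i, ∀ s ∈ S, dx i * s ∈ S := fun i => key _ (hdxA i) fun k r => by
    rw [← mul_assoc, hdxk, mul_assoc]
    apply hdkS
    rw [hdx]
    refine S.add_mem ?_ (by simpa using hmS 0 (Px i r))
    have : μ r * dx i = μ r * (dx i - μ (C (MvPolynomial.pderiv i f)) * d * μ (X ^ 2)) +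
        μ r * (μ (C (MvPolynomial.pderiv i f)) * (d ^ 1 * μ (X ^ 2))) := by
      rw [pow_one]; noncomm_ring
    rw [this]
    exact S.add_mem (hJS _ (hJA _ (hμA r) _ (hJ i))) (hμS _ _ (hμS _ _ (hmS _ _)))
  have main : ∀ a ∈ A, ∀ s ∈ S, a * s ∈ S := by
    intro a ha
    rw [hA] at ha
    induction ha using Algebra.adjoin_induction with
    | mem x hx =>
      rcases hx with ((⟨i, rfl⟩ | hx) | ⟨i, rfl⟩) | hx
      · exact hμS _
      · rw [Set.mem_singleton_iff] at hx; subst hx; exact hμS _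
      · exact hdxS i
      · rw [Set.mem_singleton_iff] at hx; subst hx; exact hdS
    | algebraMap c => rw [← AlgHom.commutes μ]; exact hμS _
    | add x y _ _ hx hy => intro s hs; rw [add_mul]; exact S.add_mem (hx s hs) (hy s hs)
    | mul x y _ _ hx hy => intro s hs; rw [mul_assoc]; exact hx _ (hy s hs)
  have h1 : (1 : E) ∈ S := by simpa using hmS 0 1
  simpa using main P hP 1 h1

end Abstract

section Concrete

variable {K} {n}

/-- `mulOp` as an algebra homomorphism -/
def mulHom (f : MvPolynomial (Fin n) K) : R K n →ₐ[K] Module.End K (B K n f) where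
  toFun := mulOp K n f
  map_one' := LinearMap.ext fun x => one_smul (R K n) x
  map_mul' a b := LinearMap.ext fun x => mul_smul a b x
  map_zero' := LinearMap.ext fun x => zero_smul (R K n) x
  map_add' a b := LinearMap.ext fun x => add_smul a b x
  commutes' c := LinearMap.ext fun x => algebraMap_smul (R K n) c x

lemma mulOp_mk (f : MvPolynomial (Fin n) K) (r : R K n) (q : L K n f) :
    mulOp K n f r (Submodule.Quotient.mk q) =
      Submodule.Quotient.mk (algebraMap (R K n) (L K n f) r * q) := by
  rw [← Algebra.smul_def]; rfl

lemma mk_eq_zero' (f : MvPolynomial (Fin n) K) (q : L K n f) :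
    (Submodule.Quotient.mk q : B K n f) = 0 ↔ ∃ r, algebraMap (R K n) (L K n f) r = q := by
  rw [Submodule.Quotient.mk_eq_zero]; rfl

lemma g_ne_zero (f : MvPolynomial (Fin n) K) : g K n f ≠ 0 := by
  intro h
  have := congrArg (fun p => Polynomial.coeff p 0) h
  simp [g] at this

/-- `1/g` -/
def u (f : MvPolynomial (Fin n) K) : L K n f := IsLocalization.Away.invSelf (g K n f)

lemma g_mul_u (f : MvPolynomial (Fin n) K) :
    algebraMap (R K n) (L K n f) (g K n f) * u f = 1 :=
  IsLocalization.Away.mul_invSelf _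

lemma a_inj (f : MvPolynomial (Fin n) K) :
    Function.Injective (algebraMap (R K n) (L K n f)) :=
  IsLocalization.injective _ (powers_le_nonZeroDivisors_of_noZeroDivisors (g_ne_zero f))

lemma deltaL_eq (f : MvPolynomial (Fin n) K) :
    deltaL K n f = algebraMap (R K n) (L K n f) (C f) * u f := by
  have h1 : deltaL K n f * algebraMap (R K n) (L K n f) (g K n f)
      = algebraMap (R K n) (L K n f) (C f) := by
    rw [deltaL, Localization.mk_eq_mk']
    exact IsLocalization.mk'_spec (L K n f) (C f)
      (⟨g K n f, 1, pow_one _⟩ : Submonoid.powers (g K n f))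
  rw [← h1, mul_assoc, g_mul_u, mul_one]

lemma der_u (f : MvPolynomial (Fin n) K) (D : Derivation K (L K n f) (L K n f)) :
    D (u f) = - u f ^ 2 * D (algebraMap (R K n) (L K n f) (g K n f)) := by
  have h := congrArg D (g_mul_u f)
  rw [Derivation.leibniz, Derivation.map_one_eq_zero, smul_eq_mul, smul_eq_mul] at h
  linear_combination (u f) * h - D (u f) * g_mul_u f

lemma der_zero (f : MvPolynomial (Fin n) K) (D : Derivation K (L K n f) (L K n f))
    (h : ∀ r, D (algebraMap (R K n) (L K n f) r) = 0) (q : L K n f) : D q = 0 := by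
  obtain ⟨⟨r, s⟩, hs⟩ := IsLocalization.surj (Submonoid.powers (g K n f)) q
  have h2 := congrArg D hs
  rw [Derivation.leibniz, h, h, smul_zero, zero_add, smul_eq_mul] at h2
  exact (IsUnit.mul_right_eq_zero (IsLocalization.map_units (L K n f) s)).mp h2

lemma Px_g (f : MvPolynomial (Fin n) K) (i : Fin n) :
    Px i (g K n f) = X * C (MvPolynomial.pderiv i f) := by
  ext1 m
  rw [coeff_Px]
  rcases m with _ | m
  · simp [g]
  · rcases m with _ | m
    · simp [g, Polynomial.coeff_one]
    · simp [g, Polynomial.coeff_one, Polynomial.coeff_X_mul, Polynomial.coeff_C_succ]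

lemma derivative_g (f : MvPolynomial (Fin n) K) : derivative (g K n f) = C f := by
  simp [g]

/-- pole computation -/
lemma dt_pow (f : MvPolynomial (Fin n) K)
    (Dt : Derivation K (L K n f) (L K n f))
    (hDt : ∀ r : R K n,
      Dt (algebraMap (R K n) (L K n f) r) = algebraMap (R K n) (L K n f) (derivative r))
    (dt : Module.End K (B K n f))
    (hdt : ∀ q : L K n f,
      dt (Submodule.Quotient.mk q) = Submodule.Quotient.mk (Dt q)) (s : R K n) (k : ℕ) :
    ∃ p : R K n, (dt ^ k) (Submodule.Quotient.mk (algebraMap (R K n) (L K n f) s * u f)) =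
      Submodule.Quotient.mk (algebraMap (R K n) (L K n f)
        (p * g K n f + (-1) ^ k * (k.factorial : R K n) * C f ^ k * s) * u f ^ (k + 1)) := by
  induction k with
  | zero => exact ⟨0, by simp⟩
  | succ k ih =>
    obtain ⟨p, hp⟩ := ih
    set w := p * g K n f + (-1) ^ k * (k.factorial : R K n) * C f ^ k * s with hw
    refine ⟨derivative w - (k+1 : R K n) * C f * p, ?_⟩
    rw [pow_succ', Module.End.mul_apply, hp, hdt, Derivation.leibniz, Derivation.leibniz_pow,
      der_u, hDt, hDt, derivative_g]
    congr 1
    have e : (derivative w - (k+1 : R K n) * C f * p) * g K n f +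
        (-1) ^ (k+1) * ((k+1).factorial : R K n) * C f ^ (k+1) * s =
        derivative w * g K n f - (k+1 : R K n) * C f * w := by
      rw [hw, Nat.factorial_succ]; push_cast; ring
    rw [e, map_sub, map_mul, map_mul _ _ w, map_mul _ _ (C f)]
    have e1 := g_mul_u f
    generalize algebraMap (R K n) (L K n f) (g K n f) = G at *
    simp only [smul_eq_mul, nsmul_eq_mul, map_add, map_one, map_natCast, Nat.add_sub_cancel]
    push_cast
    linear_combination (-(algebraMap (R K n) (L K n f) (derivative w)) * u f ^ (k+1)) * e1

lemma dvd_of (f : MvPolynomial (Fin n) K) (r : R K n) (m : ℕ)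
    (h : g K n f ∣ C f ^ m * r) : g K n f ∣ r := by
  have h1 : g K n f ∣ (X * C f) ^ m - 1 := by
    have := sub_dvd_pow_sub_pow (X * C f : R K n) 1 m
    rwa [one_pow] at this
  have h2 : r = X ^ m * (C f ^ m * r) - ((X * C f) ^ m - 1) * r := by ring
  rw [h2]
  exact dvd_sub (h.mul_left _) (h1.mul_right _)

lemma ann_nf [CharZero K] (f : MvPolynomial (Fin n) K)
    (Dt : Derivation K (L K n f) (L K n f))
    (hDt : ∀ r : R K n,
      Dt (algebraMap (R K n) (L K n f) r) = algebraMap (R K n) (L K n f) (derivative r))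
    (dt : Module.End K (B K n f))
    (hdt : ∀ q : L K n f,
      dt (Submodule.Quotient.mk q) = Submodule.Quotient.mk (Dt q))
    (c : ℕ → R K n) (m : ℕ)
    (h : (∑ k ∈ Finset.range m, dt ^ k * mulHom f (c k)) (Submodule.Quotient.mk (deltaL K n f))
      = 0) : ∀ k < m, g K n f ∣ c k := by
  have hm : ∀ r : R K n, mulHom f r (Submodule.Quotient.mk (deltaL K n f)) =
      Submodule.Quotient.mk (algebraMap (R K n) (L K n f) (r * C f) * u f) := by
    intro r
    rw [deltaL_eq, map_mul, mul_assoc]; exact mulOp_mk f r _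
  have hex : ∀ m, ∃ q : R K n,
      (∑ k ∈ Finset.range m, dt ^ k * mulHom f (c k)) (Submodule.Quotient.mk (deltaL K n f)) =
      Submodule.Quotient.mk (algebraMap (R K n) (L K n f) q * u f ^ m) := by
    intro m
    induction m with
    | zero => exact ⟨0, by simp⟩
    | succ m ih =>
      obtain ⟨q, hq⟩ := ih
      obtain ⟨p, hp⟩ := dt_pow f Dt hDt dt hdt (c m * C f) m
      rw [Finset.sum_range_succ, LinearMap.add_apply, hq, Module.End.mul_apply, hm, hp,
        ← Submodule.Quotient.mk_add]
      refine ⟨q * g K n f + (p * g K n f +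
        (-1) ^ m * (m.factorial : R K n) * C f ^ m * (c m * C f)), ?_⟩
      congr 1
      rw [map_add _ (q * g K n f), map_mul _ q]
      have e1 := g_mul_u f
      generalize algebraMap (R K n) (L K n f) (g K n f) = G at *
      linear_combination (-(algebraMap (R K n) (L K n f) q) * u f ^ m) * e1
  induction m with
  | zero => intro k hk; omega
  | succ m ih =>
    have hcm : g K n f ∣ c m := by
      obtain ⟨q, hq⟩ := hex m
      obtain ⟨p, hp⟩ := dt_pow f Dt hDt dt hdt (c m * C f) m
      rw [Finset.sum_range_succ, LinearMap.add_apply, hq, Module.End.mul_apply, hm, hp,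
        ← Submodule.Quotient.mk_add, mk_eq_zero'] at h
      obtain ⟨r, hr⟩ := h
      have hgu : algebraMap (R K n) (L K n f) (g K n f) ^ m * u f ^ m = 1 := by
        rw [← mul_pow, g_mul_u, one_pow]
      have h2 : r * g K n f ^ (m+1) = q * g K n f + (p * g K n f +
          (-1) ^ m * (m.factorial : R K n) * C f ^ m * (c m * C f)) := by
        apply a_inj f
        rw [map_add _ (q * g K n f), map_mul _ q, map_mul, map_pow, hr]
        set W := algebraMap (R K n) (L K n f) (p * g K n f +
          (-1) ^ m * (m.factorial : R K n) * C f ^ m * (c m * C f))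
        have e1 := g_mul_u f
        generalize algebraMap (R K n) (L K n f) (g K n f) = G at *
        linear_combination (algebraMap (R K n) (L K n f) q * G + W * G * u f) * hgu + W * e1
      have h3 : g K n f ∣ C f ^ (m+1) * (((-1) ^ m * (m.factorial : R K n)) * c m) := by
        refine ⟨r * g K n f ^ m - q - p, ?_⟩
        linear_combination -h2
      have h4 := dvd_of f _ _ h3
      have hu : IsUnit ((-1) ^ m * (m.factorial : R K n)) := by
        refine IsUnit.mul (IsUnit.pow _ isUnit_one.neg) ?_
        have : (m.factorial : R K n) = algebraMap K (R K n) (m.factorial : K) := by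
          rw [map_natCast]
        rw [this]
        exact IsUnit.map _ (isUnit_iff_ne_zero.mpr (by exact_mod_cast m.factorial_ne_zero))
      exact (hu.dvd_mul_left).mp h4
    have hz : (dt ^ m * mulHom f (c m)) (Submodule.Quotient.mk (deltaL K n f)) = 0 := by
      obtain ⟨w, hw⟩ := hcm
      rw [Module.End.mul_apply, hm, hw]
      have : (Submodule.Quotient.mk (algebraMap (R K n) (L K n f) (g K n f * w * C f) * u f) :
          B K n f) = 0 := by
        rw [mk_eq_zero']
        refine ⟨w * C f, ?_⟩
        rw [map_mul, map_mul, map_mul]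
        have e1 := g_mul_u f
        generalize algebraMap (R K n) (L K n f) (g K n f) = G at *
        linear_combination (-(algebraMap (R K n) (L K n f) w) *
          algebraMap (R K n) (L K n f) (C f)) * e1
      rw [this, map_zero]
    rw [Finset.sum_range_succ, LinearMap.add_apply, hz, add_zero] at h
    intro k hk
    rcases Nat.lt_succ_iff_lt_or_eq.mp hk with hk | rfl
    · exact ih h k hk
    · exact hcm

lemma comm_dt (f : MvPolynomial (Fin n) K)
    (Dt : Derivation K (L K n f) (L K n f))
    (hDt : ∀ r : R K n,
      Dt (algebraMap (R K n) (L K n f) r) = algebraMap (R K n) (L K n f) (derivative r))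
    (dt : Module.End K (B K n f))
    (hdt : ∀ q : L K n f,
      dt (Submodule.Quotient.mk q) = Submodule.Quotient.mk (Dt q)) (q : R K n) :
    mulHom f q * dt = dt * mulHom f q - mulHom f (derivative q) := by
  refine LinearMap.ext fun x => ?_
  obtain ⟨x, rfl⟩ := Submodule.Quotient.mk_surjective _ x
  change mulOp K n f q (dt _) = dt (mulOp K n f q _) - mulOp K n f (derivative q) _
  rw [mulOp_mk, mulOp_mk, hdt, hdt, mulOp_mk, ← Submodule.Quotient.mk_sub,
    Derivation.leibniz, hDt, smul_eq_mul, smul_eq_mul]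
  congr 1; ring

lemma comm_dx (f : MvPolynomial (Fin n) K) (i : Fin n)
    (Dx : Derivation K (L K n f) (L K n f))
    (hDx : ∀ (r : R K n),
      Dx (algebraMap (R K n) (L K n f) r) = algebraMap (R K n) (L K n f) (Px i r))
    (dx : Module.End K (B K n f))
    (hdx : ∀ (q : L K n f),
      dx (Submodule.Quotient.mk q) = Submodule.Quotient.mk (Dx q)) (q : R K n) :
    dx * mulHom f q = mulHom f q * dx + mulHom f (Px i q) := by
  refine LinearMap.ext fun x => ?_
  obtain ⟨x, rfl⟩ := Submodule.Quotient.mk_surjective _ x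
  change dx (mulOp K n f q _) = mulOp K n f q (dx _) + mulOp K n f (Px i q) _
  rw [mulOp_mk, mulOp_mk, hdx, hdx, mulOp_mk, ← Submodule.Quotient.mk_add,
    Derivation.leibniz, hDx, smul_eq_mul, smul_eq_mul]
  congr 1; ring

lemma comm_dx_dt (f : MvPolynomial (Fin n) K) (i : Fin n)
    (Dx : Derivation K (L K n f) (L K n f))
    (hDx : ∀ (r : R K n),
      Dx (algebraMap (R K n) (L K n f) r) = algebraMap (R K n) (L K n f) (Px i r))
    (Dt : Derivation K (L K n f) (L K n f))
    (hDt : ∀ r : R K n,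
      Dt (algebraMap (R K n) (L K n f) r) = algebraMap (R K n) (L K n f) (derivative r))
    (dx : Module.End K (B K n f))
    (hdx : ∀ (q : L K n f),
      dx (Submodule.Quotient.mk q) = Submodule.Quotient.mk (Dx q))
    (dt : Module.End K (B K n f))
    (hdt : ∀ q : L K n f,
      dt (Submodule.Quotient.mk q) = Submodule.Quotient.mk (Dt q)) :
    dx * dt = dt * dx := by
  refine LinearMap.ext fun x => ?_
  obtain ⟨x, rfl⟩ := Submodule.Quotient.mk_surjective _ x
  rw [Module.End.mul_apply, Module.End.mul_apply, hdt, hdx, hdx, hdt]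
  congr 1
  have h := der_zero f ⁅Dx, Dt⁆ (by
    intro r
    rw [Derivation.commutator_apply, hDt, hDx, hDx, hDt, ← map_sub, Px_derivative, sub_self,
      map_zero]) x
  rw [Derivation.commutator_apply] at h
  exact sub_eq_zero.mp h

end Concrete

/-- let `𝒜_Y ⊆ End_K(B)` be the `K`-subalgebra generated by multiplication
by `x₁,…,xₙ` and `t` and by the induced derivations `∂_{x_1},…,∂_{x_n},∂_t` (modeling
`D_Y`). The annihilator in `𝒜_Y` of the class `δ` of `f/g` equals the left ideal of
`𝒜_Y` generated by multiplication by `tf − 1` and the operators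
`∂_{x_i} − M_{f_i}∘∂_t∘M_{t²}`, `i = 1,…,n`. -/
theorem stmt16 [CharZero K] (hn : 1 ≤ n)
    (f : MvPolynomial (Fin n) K) (hf : 1 ≤ f.totalDegree)
    -- the unique derivations of `R[g⁻¹]` extending `∂/∂x_i` (coefficientwise on `R = A[t]`)
    -- and `∂/∂t`:
    (Dx : Fin n → Derivation K (L K n f) (L K n f))
    (hDx : ∀ i (r : R K n),
      Dx i (algebraMap (R K n) (L K n f) r) =
        algebraMap (R K n) (L K n f)
          (r.sum fun m a => C (MvPolynomial.pderiv i a) * X ^ m))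
    (Dt : Derivation K (L K n f) (L K n f))
    (hDt : ∀ r : R K n,
      Dt (algebraMap (R K n) (L K n f) r) =
        algebraMap (R K n) (L K n f) (derivative r))
    -- the induced `K`-linear endomorphisms of `B`:
    (dx : Fin n → Module.End K (B K n f))
    (hdx : ∀ i (q : L K n f),
      dx i (Submodule.Quotient.mk q) = Submodule.Quotient.mk (Dx i q))
    (dt : Module.End K (B K n f))
    (hdt : ∀ q : L K n f,
      dt (Submodule.Quotient.mk q) = Submodule.Quotient.mk (Dt q)) :
    ∀ 𝒜 : Subalgebra K (Module.End K (B K n f)),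
      𝒜 = Algebra.adjoin K
        ((((Set.range fun i : Fin n => mulOp K n f (C (MvPolynomial.X i))) ∪
            {mulOp K n f X}) ∪ Set.range dx) ∪ {dt}) →
      ∀ P ∈ 𝒜,
        (P (Submodule.Quotient.mk (deltaL K n f)) = 0 ↔
          ∃ (Q0 : Module.End K (B K n f)) (Q : Fin n → Module.End K (B K n f)),
            Q0 ∈ 𝒜 ∧ (∀ i, Q i ∈ 𝒜) ∧
            P = Q0 * mulOp K n f (g K n f) +
              ∑ i : Fin n,
                Q i * (dx i -
                  mulOp K n f (C (MvPolynomial.pderiv i f)) * dt *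
                    mulOp K n f (X ^ 2))) := by
  intro 𝒜 h𝒜 P hP
  have hdtA : dt ∈ 𝒜 := by rw [h𝒜]; exact Algebra.subset_adjoin (by simp)
  have hμA : ∀ r, mulHom f r ∈ 𝒜 := by
    apply mu_mem
    · intro i; rw [h𝒜]
      exact Algebra.subset_adjoin (Or.inl (Or.inl (Or.inl ⟨i, rfl⟩)))
    · rw [h𝒜]; exact Algebra.subset_adjoin (Or.inl (Or.inl (Or.inr rfl)))
  set γ : Fin n → Module.End K (B K n f) := fun i => dx i -
    mulOp K n f (C (MvPolynomial.pderiv i f)) * dt * mulOp K n f (X ^ 2) with hγ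
  have hgδ : mulOp K n f (g K n f) (Submodule.Quotient.mk (deltaL K n f)) = 0 := by
    rw [mulOp_mk, mk_eq_zero', deltaL_eq]
    refine ⟨C f, ?_⟩
    have e1 := g_mul_u f
    generalize algebraMap (R K n) (L K n f) (g K n f) = G at *
    linear_combination (-(algebraMap (R K n) (L K n f) (C f))) * e1
  have hγδ : ∀ i, γ i (Submodule.Quotient.mk (deltaL K n f)) = 0 := by
    intro i
    have hPC : (C f : R K n).sum (fun m a => C (MvPolynomial.pderiv i a) * X ^ m) =
        C (MvPolynomial.pderiv i f) := by
      rw [Polynomial.sum_C_index] <;> simp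
    have hPg : (g K n f).sum (fun m a => C (MvPolynomial.pderiv i a) * X ^ m) =
        X * C (MvPolynomial.pderiv i f) := Px_g f i
    have hX2 : derivative (X ^ 2 : R K n) = 2 * X := by
      rw [pow_two, Polynomial.derivative_mul, Polynomial.derivative_X]; ring
    rw [hγ]
    simp only [LinearMap.sub_apply, Module.End.mul_apply]
    rw [mulOp_mk, hdt, mulOp_mk, hdx, ← Submodule.Quotient.mk_sub, mk_eq_zero', deltaL_eq]
    refine ⟨- C (MvPolynomial.pderiv i f), ?_⟩
    rw [Derivation.leibniz (Dx i), Derivation.leibniz Dt, Derivation.leibniz Dt, der_u, der_u,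
      hDx, hDx, hDt, hDt, hDt, hPC, hPg, derivative_g]
    simp only [Polynomial.derivative_C, hX2, map_zero, map_mul, map_neg,
      map_pow, map_ofNat, smul_eq_mul]
    have e1 := g_mul_u f
    have e2 : algebraMap (R K n) (L K n f) (g K n f) =
      algebraMap (R K n) (L K n f) X * algebraMap (R K n) (L K n f) (C f) - 1 := by
      rw [← map_mul, ← map_one (algebraMap (R K n) (L K n f)), ← map_sub]
    rw [e2] at e1
    generalize algebraMap (R K n) (L K n f) (C (MvPolynomial.pderiv i f)) = F' at *
    generalize algebraMap (R K n) (L K n f) (C f) = F at *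
    generalize algebraMap (R K n) (L K n f) X = T at *
    generalize u f = v at *
    have e3 : T * F * v = 1 + v := by linear_combination e1
    linear_combination (-F' * (T * F * v - 1)) * e3
  constructor
  · intro h0
    set J : Submodule 𝒜 (Module.End K (B K n f)) :=
      Submodule.span 𝒜 {mulOp K n f (g K n f)} ⊔ Submodule.span 𝒜 (Set.range γ) with hJ
    suffices hPJ : P ∈ J by
      rw [hJ, Submodule.mem_sup] at hPJ
      obtain ⟨y, hy, z, hz, rfl⟩ := hPJ
      rw [Submodule.mem_span_singleton] at hy
      obtain ⟨a, rfl⟩ := hy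
      rw [Submodule.mem_span_range_iff_exists_fun] at hz
      obtain ⟨b, rfl⟩ := hz
      exact ⟨a, fun i => b i, a.2, fun i => (b i).2, rfl⟩
    have hJA : ∀ a ∈ 𝒜, ∀ j ∈ J, a * j ∈ J := fun a ha j hj => J.smul_mem ⟨a, ha⟩ hj
    have hgJ : mulHom f (g K n f) ∈ J :=
      Submodule.mem_sup_left (Submodule.mem_span_singleton_self _)
    have hγJ : ∀ i, γ i ∈ J := fun i =>
      Submodule.mem_sup_right (Submodule.subset_span ⟨i, rfl⟩)
    have hJ0 : ∀ j ∈ J, j (Submodule.Quotient.mk (deltaL K n f)) = 0 := by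
      intro j hj
      rw [hJ, Submodule.mem_sup] at hj
      obtain ⟨y, hy, z, hz, rfl⟩ := hj
      rw [Submodule.mem_span_singleton] at hy
      obtain ⟨a, rfl⟩ := hy
      rw [Submodule.mem_span_range_iff_exists_fun] at hz
      obtain ⟨b, rfl⟩ := hz
      rw [LinearMap.add_apply, LinearMap.sum_apply]
      have e1 : (a • mulOp K n f (g K n f)) (Submodule.Quotient.mk (deltaL K n f)) = 0 := by
        change a.1 (mulOp K n f (g K n f) _) = 0
        rw [hgδ, map_zero]
      rw [e1, zero_add]
      refine Finset.sum_eq_zero fun i _ => ?_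
      change (b i).1 (γ i _) = 0
      rw [hγδ, map_zero]
    obtain ⟨c, j, hj, rfl⟩ := reduce (mulHom f) dt dx f 𝒜 h𝒜
      (comm_dt f Dt hDt dt hdt) (fun i => comm_dx f i (Dx i) (hDx i) (dx i) (hdx i))
      (fun i => comm_dx_dt f i (Dx i) (hDx i) Dt hDt (dx i) (hdx i) dt hdt)
      J hγJ P hP
    refine J.add_mem ?_ hj
    rw [LinearMap.add_apply, hJ0 j hj, add_zero] at h0
    obtain ⟨m, hm⟩ : ∃ m, c.support ⊆ Finset.range m := c.support.exists_nat_subset_range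
    have hs : nf (mulHom f) dt c = ∑ k ∈ Finset.range m, dt ^ k * mulHom f (c k) :=
      Finsupp.sum_of_support_subset _ hm _ (by simp)
    rw [hs] at h0 ⊢
    have hdvd := ann_nf f Dt hDt dt hdt c m h0
    refine J.sum_mem fun k hk => ?_
    obtain ⟨w, hw⟩ := hdvd k (Finset.mem_range.mp hk)
    rw [hw, mul_comm, map_mul, ← mul_assoc]
    exact hJA _ (𝒜.mul_mem (𝒜.pow_mem hdtA k) (hμA w)) _ hgJ
  · rintro ⟨Q0, Q, -, -, rfl⟩
    rw [LinearMap.add_apply, LinearMap.sum_apply, Module.End.mul_apply, hgδ, map_zero, zero_add]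
    refine Finset.sum_eq_zero fun i _ => ?_
    change Q i (γ i _) = 0
    rw [hγδ, map_zero]

end Stmt16
end
end
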